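/- arXiv:2112.04654 — 6 statements merged into one kernel-verified Lean document; each statement's English description precedes it below -/
import Mathlib

section
/- Let T = conv{v₀, v₁, …, v_k} ⊂ ℝ^d be a simplex of dimension k ≥ 1, let v = v₀, let f = conv{v₁, …, v_k} be the facet of T opposite v, and let c ≥ 1 be a real number. Then c·T = (v + (c−1)·T) ∪ conv((v + (c−1)·f) ∪ c·f), the relative interiors of the two polytopes on the right are disjoint, and their intersection equals v + (c−1)·f. -/
open Pointwise

/-- A relative interior point `x` of `s` can be moved slightly away from any `p ∈ s`
without leaving `s`. -/
lemma exists_lineMap_mem_of_mem_intrinsicInterior {E : Type*} [AddCommGroup E] [Module ℝ E]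
    [TopologicalSpace E] [IsTopologicalAddGroup E] [ContinuousSMul ℝ E] {s : Set E} {x p : E}
    (hx : x ∈ intrinsicInterior ℝ s) (hp : p ∈ s) :
    ∃ t : ℝ, 1 < t ∧ AffineMap.lineMap p x t ∈ s := by
  obtain ⟨y, hy, rfl⟩ := mem_intrinsicInterior.1 hx
  let g : ℝ → affineSpan ℝ s := fun t =>
    ⟨AffineMap.lineMap p (y : E) t,
      AffineMap.lineMap_mem t (subset_affineSpan ℝ s hp) y.2⟩
  have hg : Continuous g := by
    refine Continuous.subtype_mk ?_ _
    exact AffineMap.lineMap_continuous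
  have hg1 : g 1 = y := by simp [g]
  have hev : ∀ᶠ t in nhdsWithin (1 : ℝ) (Set.Ioi 1), g t ∈ ((↑) ⁻¹' s : Set (affineSpan ℝ s)) := by
    refine nhdsWithin_le_nhds (hg.continuousAt ?_)
    rw [hg1]
    exact mem_interior_iff_mem_nhds.1 hy
  obtain ⟨t, ht, ht1⟩ := (hev.and self_mem_nhdsWithin).exists
  exact ⟨t, ht1, ht⟩

/-- Prescribing the values of a linear functional on differences with a vertex. -/
lemma AffineIndependent.exists_linearMap_eq_sub_one {ι E : Type*} [AddCommGroup E] [Module ℝ E]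
    {v : ι → E} (hv : AffineIndependent ℝ v) (i₀ : ι) :
    ∃ l : E →ₗ[ℝ] ℝ, ∀ i ≠ i₀, l (v i) = l (v i₀) - 1 := by
  have hl := (affineIndependent_iff_linearIndependent_vsub ℝ v i₀).1 hv
  obtain ⟨l, hl'⟩ := LinearMap.exists_extend ((Module.Basis.span hl).constr ℝ fun _ => (-1 : ℝ))
  refine ⟨l, fun i hi => ?_⟩
  have h := (Module.Basis.span hl).constr_basis ℝ (fun _ => (-1 : ℝ)) ⟨i, hi⟩
  rw [← hl', LinearMap.comp_apply, Submodule.subtype_apply, Module.Basis.span_apply] at h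
  change l (v i - v i₀) = -1 at h
  rw [map_sub] at h
  linarith

section Pyramid

variable {E : Type*} [AddCommGroup E] [Module ℝ E] {v₀ : E} {f : Set E} {c : ℝ}

lemma mem_convexHull_insert_iff_exists (hf : Convex ℝ f) (hne : f.Nonempty) {x : E} :
    x ∈ convexHull ℝ (insert v₀ f) ↔
      ∃ y ∈ f, ∃ s : ℝ, 0 ≤ s ∧ s ≤ 1 ∧ x = s • v₀ + (1 - s) • y := by
  rw [convexHull_insert hne, hf.convexHull_eq, mem_convexJoin]
  constructor
  · rintro ⟨_, rfl, y, hy, a, b, ha, hb, hab, rfl⟩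
    exact ⟨y, hy, a, ha, by linarith, by rw [← hab, add_sub_cancel_left]⟩
  · rintro ⟨y, hy, s, hs0, hs1, rfl⟩
    exact ⟨v₀, rfl, y, hy, s, 1 - s, hs0, by linarith, by ring, rfl⟩

/-- A dilated pyramid is a translated smaller copy together with a frustum. -/
lemma smul_convexHull_insert_eq_union (hf : Convex ℝ f) (hne : f.Nonempty) (hc : 1 ≤ c) :
    c • convexHull ℝ (insert v₀ f) = (v₀ +ᵥ (c - 1) • convexHull ℝ (insert v₀ f)) ∪
      convexHull ℝ ((v₀ +ᵥ (c - 1) • f) ∪ c • f) := by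
  have hc0 : 0 < c := by linarith
  have hfT : f ⊆ convexHull ℝ (insert v₀ f) :=
    (Set.subset_insert _ _).trans (subset_convexHull ℝ _)
  have hT : Convex ℝ (convexHull ℝ (insert v₀ f)) := convex_convexHull ℝ _
  have hsub : v₀ +ᵥ (c - 1) • convexHull ℝ (insert v₀ f) ⊆ c • convexHull ℝ (insert v₀ f) := by
    rintro _ ⟨_, ⟨x, hx, rfl⟩, rfl⟩
    refine ⟨c⁻¹ • v₀ + ((c - 1) / c) • x,
      hT (subset_convexHull ℝ _ (Set.mem_insert _ _)) hx (by positivity)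
        (div_nonneg (by linarith) hc0.le) (by field_simp; ring), ?_⟩
    simp only [vadd_eq_add, smul_add, smul_smul]
    rw [mul_inv_cancel₀ hc0.ne', mul_div_cancel₀ _ hc0.ne', one_smul]
  apply Set.Subset.antisymm
  · rintro _ ⟨x, hx, rfl⟩
    obtain ⟨y, hy, s, hs0, hs1, rfl⟩ := (mem_convexHull_insert_iff_exists hf hne).1 hx
    rcases le_total (c * s) 1 with h | h
    · right
      have := convex_convexHull ℝ ((v₀ +ᵥ (c - 1) • f) ∪ c • f)
        (subset_convexHull ℝ _ (Or.inl ⟨_, ⟨y, hy, rfl⟩, rfl⟩))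
        (subset_convexHull ℝ _ (Or.inr ⟨y, hy, rfl⟩))
        (mul_nonneg hc0.le hs0) (sub_nonneg.2 h) (add_sub_cancel _ _)
      convert this using 1
      simp only [vadd_eq_add]
      module
    · left
      rcases hc.eq_or_lt with rfl | hc1
      · obtain rfl : s = 1 := by linarith
        exact ⟨_, ⟨y, hfT hy, rfl⟩, by simp⟩
      · have hd : 0 < c - 1 := by linarith
        refine ⟨_, ⟨((c * s - 1) / (c - 1)) • v₀ + (c * (1 - s) / (c - 1)) • y,
          hT (subset_convexHull ℝ _ (Set.mem_insert _ _)) (hfT hy)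
            (div_nonneg (by linarith) hd.le)
            (div_nonneg (mul_nonneg hc0.le (by linarith)) hd.le)
            (by field_simp; ring), rfl⟩, ?_⟩
        simp only [vadd_eq_add, smul_add, smul_smul]
        rw [mul_div_cancel₀ _ hd.ne', mul_div_cancel₀ _ hd.ne']
        module
  · refine Set.union_subset hsub (convexHull_min (Set.union_subset ?_ ?_) (hT.smul c))
    · exact (Set.vadd_set_mono (Set.smul_set_mono hfT)).trans hsub
    · exact Set.smul_set_mono hfT

variable {l : E →ₗ[ℝ] ℝ}

/-- The frustum lies below the hyperplane through its top face. -/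
lemma map_le_of_mem_convexHull_frustum (hl : ∀ y ∈ f, l y = l v₀ - 1) {x : E}
    (hx : x ∈ convexHull ℝ ((v₀ +ᵥ (c - 1) • f) ∪ c • f)) :
    l x ≤ c * l v₀ + 1 - c := by
  refine convexHull_min (t := {x | l x ≤ c * l v₀ + 1 - c}) ?_
    (convex_halfSpace_le l.isLinear _) hx
  rintro _ (⟨_, ⟨y, hy, rfl⟩, rfl⟩ | ⟨y, hy, rfl⟩) <;>
    simp only [Set.mem_ofPred_eq, vadd_eq_add, map_add, map_smul, smul_eq_mul, hl y hy] <;>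
    nlinarith

lemma vadd_smul_convexHull_inter_frustum (hf : Convex ℝ f) (hne : f.Nonempty)
    (hl : ∀ y ∈ f, l y = l v₀ - 1) (hc : 1 ≤ c) :
    (v₀ +ᵥ (c - 1) • convexHull ℝ (insert v₀ f)) ∩
      convexHull ℝ ((v₀ +ᵥ (c - 1) • f) ∪ c • f) = v₀ +ᵥ (c - 1) • f := by
  apply Set.Subset.antisymm
  · rintro _ ⟨⟨_, ⟨z, hz, rfl⟩, rfl⟩, h2⟩
    have h := map_le_of_mem_convexHull_frustum hl h2
    obtain ⟨y, hy, s, hs0, hs1, rfl⟩ := (mem_convexHull_insert_iff_exists hf hne).1 hz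
    refine ⟨_, ⟨y, hy, rfl⟩, ?_⟩
    rcases hc.eq_or_lt with rfl | hc1
    · simp
    · simp only [vadd_eq_add, map_add, map_smul, smul_eq_mul, hl y hy] at h
      obtain rfl : s = 0 := by nlinarith
      simp
  · exact Set.subset_inter
      (Set.vadd_set_mono (Set.smul_set_mono
        ((Set.subset_insert _ _).trans (subset_convexHull ℝ _))))
      (Set.subset_union_left.trans (subset_convexHull ℝ _))

lemma disjoint_intrinsicInterior_frustum [TopologicalSpace E] [IsTopologicalAddGroup E]
    [ContinuousSMul ℝ E] (hf : Convex ℝ f) (hne : f.Nonempty)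
    (hl : ∀ y ∈ f, l y = l v₀ - 1) (hc : 1 ≤ c) :
    intrinsicInterior ℝ (v₀ +ᵥ (c - 1) • convexHull ℝ (insert v₀ f)) ∩
      intrinsicInterior ℝ (convexHull ℝ ((v₀ +ᵥ (c - 1) • f) ∪ c • f)) = ∅ := by
  refine Set.eq_empty_of_forall_notMem ?_
  rintro x ⟨h1, h2⟩
  have hx : x ∈ v₀ +ᵥ (c - 1) • f := by
    rw [← vadd_smul_convexHull_inter_frustum hf hne hl hc]
    exact ⟨intrinsicInterior_subset h1, intrinsicInterior_subset h2⟩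
  obtain ⟨_, ⟨y, hy, rfl⟩, rfl⟩ := hx
  obtain ⟨t, ht, hmem⟩ := exists_lineMap_mem_of_mem_intrinsicInterior h2
    (subset_convexHull ℝ _ (Or.inr ⟨y, hy, rfl⟩))
  have h := map_le_of_mem_convexHull_frustum hl hmem
  simp only [AffineMap.lineMap_apply, vsub_eq_sub, vadd_eq_add, map_add, map_sub, map_smul,
    smul_eq_mul, hl y hy] at h
  nlinarith

end Pyramid

theorem statement10 (d k : ℕ) (hk : 1 ≤ k)
    (v : Fin (k + 1) → (Fin d → ℝ)) (hv : AffineIndependent ℝ v)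
    (T f : Set (Fin d → ℝ))
    (hT : T = convexHull ℝ (Set.range v))
    (hf : f = convexHull ℝ (v '' {i | i ≠ 0}))
    (c : ℝ) (hc : 1 ≤ c) :
    c • T = (v 0 +ᵥ (c - 1) • T) ∪ convexHull ℝ ((v 0 +ᵥ (c - 1) • f) ∪ c • f) ∧
    intrinsicInterior ℝ (v 0 +ᵥ (c - 1) • T) ∩
      intrinsicInterior ℝ (convexHull ℝ ((v 0 +ᵥ (c - 1) • f) ∪ c • f)) = ∅ ∧
    (v 0 +ᵥ (c - 1) • T) ∩ convexHull ℝ ((v 0 +ᵥ (c - 1) • f) ∪ c • f) =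
      v 0 +ᵥ (c - 1) • f := by
  have hconv : Convex ℝ f := hf ▸ convex_convexHull ℝ _
  have hne : f.Nonempty := by
    rw [hf, convexHull_nonempty_iff]
    exact ⟨_, Fin.last k, Fin.ne_of_val_ne (Nat.ne_of_gt hk), rfl⟩
  have hTf : T = convexHull ℝ (insert (v 0) f) := by
    have hrange : Set.range v = insert (v 0) (v '' {i | i ≠ 0}) := by
      rw [← Set.image_insert_eq, ← Set.image_univ]
      congr 1
      ext i
      simp [em]
    rw [hT, hf, hrange, Set.insert_eq, Set.insert_eq, convexHull_convexHull_union_right]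
  obtain ⟨l, hl⟩ := hv.exists_linearMap_eq_sub_one 0
  have hlf : ∀ y ∈ f, l y = l (v 0) - 1 := by
    intro y hy
    rw [hf] at hy
    refine convexHull_min (t := {y | l y = l (v 0) - 1}) ?_ (convex_hyperplane l.isLinear _) hy
    rintro _ ⟨i, hi, rfl⟩
    exact hl i hi
  subst hTf
  exact ⟨smul_convexHull_insert_eq_union hconv hne hc,
    disjoint_intrinsicInterior_frustum hconv hne hlf hc,
    vadd_smul_convexHull_inter_frustum hconv hne hlf hc⟩
end

section
/- Let F ⊂ ℝ^d be an integral simplex, let w ∈ ℤ^d with w not in the affine hull of F, and let S = conv(F ∪ {w}), which is again an integral simplex. Let v be any vertex of F and let h = [N(S) : N(F) + ℤ·(w − v)] (this index is finite and independent of the choice of v; it is the lattice height of S with respect to the facet F). Then the index of S equals h times the index of F: [N(S) : L(S)] = h · [N(F) : L(F)]. -/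
open Pointwise

/-- A point of `ℝ^d` with integer coordinates. -/
def IsLatticePt {d : ℕ} (x : Fin d → ℝ) : Prop := ∀ i, ∃ z : ℤ, x i = (z : ℝ)

/-- The subgroup `ℤ^d` of integral points of `ℝ^d`. -/
def intLattice (d : ℕ) : AddSubgroup (Fin d → ℝ) where
  carrier := {x | IsLatticePt x}
  zero_mem' := fun i => ⟨0, by simp⟩
  add_mem' := by
    rintro a b ha hb i
    obtain ⟨z, hz⟩ := ha i
    obtain ⟨w, hw⟩ := hb i
    exact ⟨z + w, by simp [hz, hw]⟩
  neg_mem' := by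
    rintro a ha i
    obtain ⟨z, hz⟩ := ha i
    exact ⟨-z, by simp [hz]⟩

/-- A polytope: the convex hull of a nonempty finite set of points. -/
def IsPolytope {d : ℕ} (P : Set (Fin d → ℝ)) : Prop :=
  ∃ V : Finset (Fin d → ℝ), V.Nonempty ∧ P = convexHull ℝ (V : Set (Fin d → ℝ))

/-- An integral polytope: the convex hull of a nonempty finite set of integral points. -/
def IsIntegralPolytope {d : ℕ} (P : Set (Fin d → ℝ)) : Prop :=
  ∃ V : Finset (Fin d → ℝ), V.Nonempty ∧ (∀ v ∈ V, IsLatticePt v) ∧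
    P = convexHull ℝ (V : Set (Fin d → ℝ))

/-- A simplex: the convex hull of a nonempty affinely independent finite set. -/
def IsSimplex {d : ℕ} (P : Set (Fin d → ℝ)) : Prop :=
  ∃ V : Finset (Fin d → ℝ), V.Nonempty ∧
    AffineIndependent ℝ (Subtype.val : ↥(V : Set (Fin d → ℝ)) → (Fin d → ℝ)) ∧
    P = convexHull ℝ (V : Set (Fin d → ℝ))

/-- An integral simplex. -/
def IsIntegralSimplex {d : ℕ} (P : Set (Fin d → ℝ)) : Prop :=
  ∃ V : Finset (Fin d → ℝ), V.Nonempty ∧ (∀ v ∈ V, IsLatticePt v) ∧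
    AffineIndependent ℝ (Subtype.val : ↥(V : Set (Fin d → ℝ)) → (Fin d → ℝ)) ∧
    P = convexHull ℝ (V : Set (Fin d → ℝ))

/-- The set of differences of vertices (= extreme points) of a polytope. -/
def vertexDiffs {d : ℕ} (P : Set (Fin d → ℝ)) : Set (Fin d → ℝ) :=
  {w | ∃ u ∈ P.extremePoints ℝ, ∃ v ∈ P.extremePoints ℝ, w = u - v}

/-- `L(P)`: the subgroup of `ℤ^d` generated by differences of vertices of `P`. -/
def latL {d : ℕ} (P : Set (Fin d → ℝ)) : AddSubgroup (Fin d → ℝ) :=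
  AddSubgroup.closure (vertexDiffs P)

/-- `N(P)`: the intersection of the real span of `L(P)` with `ℤ^d`. -/
def latN {d : ℕ} (P : Set (Fin d → ℝ)) : AddSubgroup (Fin d → ℝ) :=
  (Submodule.span ℝ (vertexDiffs P)).toAddSubgroup ⊓ intLattice d

/-- The (normalized) index of an integral polytope: the group index `[N(P) : L(P)]`. -/
noncomputable def polyIndex {d : ℕ} (P : Set (Fin d → ℝ)) : ℕ :=
  ((latL P).addSubgroupOf (latN P)).index

/-- A unimodular simplex: an integral simplex of index 1. -/
def IsUnimodularSimplex {d : ℕ} (P : Set (Fin d → ℝ)) : Prop :=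
  IsIntegralSimplex P ∧ polyIndex P = 1

/-- `F` is a face of `P`: the (nonempty) set of maximizers on `P` of a linear functional. -/
def IsFaceOf {d : ℕ} (F P : Set (Fin d → ℝ)) : Prop :=
  F.Nonempty ∧ ∃ φ : (Fin d → ℝ) →ₗ[ℝ] ℝ, F = {x ∈ P | ∀ y ∈ P, φ y ≤ φ x}

/-- A triangulation of `Q`: a finite, face-closed collection of simplices with union `Q`,
any two of which meet in a (possibly empty) common face. -/
def IsTriangulation {d : ℕ} (T : Set (Set (Fin d → ℝ))) (Q : Set (Fin d → ℝ)) : Prop :=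
  T.Finite ∧ (∀ S ∈ T, IsSimplex S) ∧ ⋃₀ T = Q ∧
    (∀ S ∈ T, ∀ F, IsFaceOf F S → F ∈ T) ∧
    ∀ S₁ ∈ T, ∀ S₂ ∈ T, S₁ ∩ S₂ = ∅ ∨ (IsFaceOf (S₁ ∩ S₂) S₁ ∧ IsFaceOf (S₁ ∩ S₂) S₂)

/-- A unimodular triangulation: all of its simplices are unimodular. -/
def IsUnimodularTriangulation {d : ℕ} (T : Set (Set (Fin d → ℝ))) (Q : Set (Fin d → ℝ)) : Prop :=
  IsTriangulation T Q ∧ ∀ S ∈ T, IsUnimodularSimplex S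

/-- The extreme points of the convex hull of a finite affinely independent set are its elements. -/
theorem AffineIndependent.extremePoints_convexHull_eq {d : ℕ} {A : Set (Fin d → ℝ)}
    (hfin : A.Finite) (hA : AffineIndependent ℝ (Subtype.val : A → (Fin d → ℝ))) :
    (convexHull ℝ A).extremePoints ℝ = A := by
  refine extremePoints_convexHull_subset.antisymm fun x hx => ?_
  by_contra hne
  have hsub : (convexHull ℝ A).extremePoints ℝ ⊆ A \ {x} := fun y hy =>
    ⟨extremePoints_convexHull_subset hy, fun h => hne (Set.mem_singleton_iff.1 h ▸ hy)⟩
  have hmem : x ∈ closure (convexHull ℝ ((convexHull ℝ A).extremePoints ℝ)) := by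
    rw [closure_convexHull_extremePoints (hfin.isCompact_convexHull ℝ) (convex_convexHull ℝ A)]
    exact subset_convexHull ℝ A hx
  have hx' : x ∈ affineSpan ℝ (A \ {x}) :=
    convexHull_subset_affineSpan _ <|
      closure_minimal (convexHull_mono hsub) ((hfin.sdiff (t := {x})).isClosed_convexHull ℝ) hmem
  refine hA.notMem_affineSpan_sdiff (⟨x, hx⟩ : A) Set.univ ?_
  convert! hx' using 2
  ext y
  simp [and_comm]

/-- Adding a point outside the affine span preserves affine independence of a set. -/
theorem AffineIndependent.insert_of_notMem_affineSpan {d : ℕ} {A : Set (Fin d → ℝ)}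
    (hA : AffineIndependent ℝ (Subtype.val : A → (Fin d → ℝ))) {w : Fin d → ℝ}
    (hw : w ∉ affineSpan ℝ A) :
    AffineIndependent ℝ (Subtype.val : ↥(insert w A : Set (Fin d → ℝ)) → (Fin d → ℝ)) := by
  refine AffineIndependent.affineIndependent_of_notMem_span
    (i := ⟨w, Set.mem_insert w A⟩) ?_ ?_
  · let e : {y : (insert w A : Set (Fin d → ℝ)) // y ≠ ⟨w, Set.mem_insert w A⟩} ↪ A :=
      ⟨fun y => ⟨y.1.1, y.1.2.resolve_left fun h => y.2 (Subtype.ext h)⟩, fun y z h =>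
        Subtype.ext (Subtype.ext (Subtype.mk.inj h))⟩
    exact AffineIndependent.comp_embedding e hA
  · refine fun h => hw (affineSpan_mono ℝ ?_ h)
    rintro _ ⟨y, hy, rfl⟩
    exact y.2.resolve_left fun h => hy (Subtype.ext h)

theorem vertexDiffs_convexHull {d : ℕ} {A : Set (Fin d → ℝ)} (hfin : A.Finite)
    (hA : AffineIndependent ℝ (Subtype.val : A → (Fin d → ℝ))) :
    vertexDiffs (convexHull ℝ A) = A -ᵥ A := by
  ext x
  simp [vertexDiffs, hA.extremePoints_convexHull_eq hfin, Set.mem_vsub, eq_comm]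

theorem latL_le_latN_convexHull {d : ℕ} {A : Set (Fin d → ℝ)} (hint : ∀ u ∈ A, IsLatticePt u) :
    latL (convexHull ℝ A) ≤ latN (convexHull ℝ A) := by
  refine (AddSubgroup.closure_le _).2 fun x hx => ⟨Submodule.subset_span hx, ?_⟩
  obtain ⟨u, hu, v, hv, rfl⟩ := hx
  exact (intLattice d).sub_mem (hint u (extremePoints_convexHull_subset hu))
    (hint v (extremePoints_convexHull_subset hv))

theorem AddSubgroup.closure_insert_vsub_insert {G : Type*} [AddCommGroup G] {A : Set G} {v : G}
    (hv : v ∈ A) (w : G) :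
    closure ((insert w A : Set G) -ᵥ (insert w A : Set G)) =
      closure (A -ᵥ A) ⊔ closure {w - v} := by
  apply le_antisymm
  · have hw : w - v ∈ closure (A -ᵥ A) ⊔ closure {w - v} :=
      mem_sup_right (subset_closure rfl)
    have hsub : ∀ x ∈ insert w A, x - v ∈ closure (A -ᵥ A) ⊔ closure {w - v} := by
      rintro x (rfl | hx)
      · exact hw
      · exact mem_sup_left (subset_closure ⟨x, hx, v, hv, rfl⟩)
    rw [closure_le]
    rintro _ ⟨x, hx, y, hy, rfl⟩
    simpa using sub_mem (hsub x hx) (hsub y hy)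
  · refine sup_le (closure_mono (Set.vsub_subset_vsub (Set.subset_insert _ _)
      (Set.subset_insert _ _))) (closure_mono ?_)
    rintro _ rfl
    exact ⟨w, Set.mem_insert _ _, v, Set.mem_insert_of_mem _ hv, rfl⟩

/-- Adding a common summand `K` that meets the larger group trivially preserves the index. -/
theorem AddSubgroup.relIndex_sup_sup_of_disjoint {G : Type*} [AddCommGroup G]
    {L N K : AddSubgroup G} (hLN : L ≤ N) (hK : Disjoint K N) :
    (L ⊔ K).relIndex (N ⊔ K) = L.relIndex N := by
  have h1 : N ⊔ K = N ⊔ (L ⊔ K) := by rw [← sup_assoc, sup_eq_left.2 hLN]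
  rw [h1, relIndex_sup_right, ← inf_relIndex_right, sup_inf_assoc_of_le K hLN, hK.eq_bot,
    sup_bot_eq]

theorem AddSubgroup.disjoint_closure_singleton_of_notMem {E : Type*} [AddCommGroup E] [Module ℝ E]
    {W : Submodule ℝ E} {x : E} (hx : x ∉ W) :
    Disjoint (closure {x}) W.toAddSubgroup := by
  rw [disjoint_def]
  intro y hy hyW
  obtain ⟨n, rfl⟩ := mem_closure_singleton.1 hy
  by_cases hn : (n : ℝ) = 0
  · simp [Int.cast_eq_zero.1 hn]
  · rw [← Int.cast_smul_eq_zsmul ℝ n x] at hyW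
    exact absurd ((W.smul_mem_iff hn).1 hyW) hx

theorem statement11 (d : ℕ) (hd : 0 < d)
    (V : Finset (Fin d → ℝ)) (hne : V.Nonempty)
    (hint : ∀ u ∈ V, IsLatticePt u)
    (haff : AffineIndependent ℝ (Subtype.val : ↥(V : Set (Fin d → ℝ)) → (Fin d → ℝ)))
    (w : Fin d → ℝ) (hw : IsLatticePt w)
    (hw' : w ∉ affineSpan ℝ (V : Set (Fin d → ℝ)))
    (F S : Set (Fin d → ℝ))
    (hF : F = convexHull ℝ (V : Set (Fin d → ℝ)))
    (hS : S = convexHull ℝ (insert w (V : Set (Fin d → ℝ))))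
    (v : Fin d → ℝ) (hv : v ∈ V) :
    polyIndex S =
      ((latN F ⊔ AddSubgroup.closure {w - v}).addSubgroupOf (latN S)).index * polyIndex F := by
  subst hF hS
  have hfin : (V : Set (Fin d → ℝ)).Finite := V.finite_toSet
  have hdF := vertexDiffs_convexHull hfin haff
  have hdS := vertexDiffs_convexHull (hfin.insert w) (haff.insert_of_notMem_affineSpan hw')
  set F := convexHull ℝ (V : Set (Fin d → ℝ))
  set S := convexHull ℝ (insert w (V : Set (Fin d → ℝ)))
  have hsup : latL S = latL F ⊔ AddSubgroup.closure {w - v} := by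
    rw [latL, latL, hdF, hdS, AddSubgroup.closure_insert_vsub_insert hv]
  have hLF : latL F ≤ latN F := latL_le_latN_convexHull hint
  have hLS : latL S ≤ latN S := latL_le_latN_convexHull fun u hu =>
    hu.elim (fun h => h ▸ hw) (hint u)
  have hNFS : latN F ≤ latN S := by
    refine inf_le_inf_right _ (Submodule.span_mono (R := ℝ) ?_)
    rw [hdF, hdS]
    exact Set.vsub_subset_vsub (Set.subset_insert _ _) (Set.subset_insert _ _)
  have hnot : w - v ∉ Submodule.span ℝ (vertexDiffs F) := by
    intro h
    rw [hdF, ← vectorSpan_def, ← direction_affineSpan] at h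
    refine hw' ?_
    simpa using AffineSubspace.vadd_mem_of_mem_direction h (mem_affineSpan ℝ hv)
  have hdisj : Disjoint (AddSubgroup.closure {w - v}) (latN F) :=
    (AddSubgroup.disjoint_closure_singleton_of_notMem hnot).mono_right inf_le_left
  change (latL S).relIndex (latN S) =
    (latN F ⊔ AddSubgroup.closure {w - v}).relIndex (latN S) * (latL F).relIndex (latN F)
  rw [← AddSubgroup.relIndex_sup_sup_of_disjoint hLF hdisj, ← hsup, mul_comm]
  refine (AddSubgroup.relIndex_mul_relIndex _ _ _ ?_ (sup_le hNFS ?_)).symm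
  · rw [hsup]
    exact sup_le_sup_right hLF _
  · exact le_sup_right.trans (hsup ▸ hLS)
end

section
/- Let S ⊂ ℝ^d be an integral simplex of positive dimension with a distinguished vertex v, and let x be a nonzero element of G(S) = N(S)/L(S). Let c be the unique positive integer such that c·(S − v) contains exactly one element x₀' of N(S) with x₀' + L(S) = x, and set x₀ = x₀' + c·v ∈ c·S. Let F be a facet of S with x₀ ∉ c·F, let w be the vertex of S opposite F, let u be a vertex of F, and let φ : N(S) → ℤ be a surjective group homomorphism vanishing on L(F). Then 0 < |φ(x₀ − c·u)| < |φ(w − u)|; that is, the lattice distance from x₀ to the affine hull of c·F is strictly smaller than the lattice height of S with respect to F. -/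
open Pointwise

section SimplexLattice

variable {d : ℕ} {V : Finset (Fin d → ℝ)}

/-- Every vertex of an affinely independent finite set is an extreme point of its convex hull. -/
theorem AffineIndependent.mem_extremePoints_convexHull
    (hV : AffineIndependent ℝ (Subtype.val : ↥(V : Set (Fin d → ℝ)) → (Fin d → ℝ)))
    {t : Fin d → ℝ} (ht : t ∈ V) :
    t ∈ (convexHull ℝ (V : Set (Fin d → ℝ))).extremePoints ℝ := by
  classical
  refine mem_extremePoints_iff_left.2 ⟨subset_convexHull ℝ _ ht, ?_⟩
  rintro x hx y hy ⟨a, b, ha, hb, hab, hxy⟩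
  rw [Finset.mem_convexHull'] at hx hy
  obtain ⟨f, hf0, hf1, rfl⟩ := hx
  obtain ⟨g, hg0, hg1, rfl⟩ := hy
  have key := hV.eq_zero_of_sum_eq_zero_subtype
    (w := fun s => a * f s + b * g s - if s = t then 1 else 0) (s := V)
    (by simp [Finset.sum_sub_distrib, Finset.sum_add_distrib, ← Finset.mul_sum, hf1, hg1, hab, ht])
    (by
      simp only [sub_smul, add_smul, mul_smul, Finset.sum_sub_distrib, Finset.sum_add_distrib,
        ← Finset.smul_sum, hxy, ite_smul, one_smul, zero_smul, Finset.sum_ite_eq', ht, if_true,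
        sub_self])
  have hf (s) (hs : s ∈ V) (hst : s ≠ t) : f s = 0 := by
    have h := key s hs
    simp only [hst, if_false, sub_zero] at h
    have h1 := mul_nonneg ha.le (hf0 s hs)
    have h2 := mul_nonneg hb.le (hg0 s hs)
    have h3 : a * f s = 0 := by linarith
    exact (mul_eq_zero.1 h3).resolve_left ha.ne'
  rw [Finset.sum_eq_single_of_mem t ht fun s hs hst => by simp [hf s hs hst]]
  rw [Finset.sum_eq_single_of_mem t ht fun s hs hst => hf s hs hst] at hf1
  simp [hf1]

theorem sub_mem_vertexDiffs_convexHull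
    (hV : AffineIndependent ℝ (Subtype.val : ↥(V : Set (Fin d → ℝ)) → (Fin d → ℝ)))
    {s t : Fin d → ℝ} (hs : s ∈ V) (ht : t ∈ V) :
    s - t ∈ vertexDiffs (convexHull ℝ (V : Set (Fin d → ℝ))) :=
  ⟨s, hV.mem_extremePoints_convexHull hs, t, hV.mem_extremePoints_convexHull ht, rfl⟩

theorem sub_mem_latN_convexHull (hint : ∀ u ∈ V, IsLatticePt u)
    (hV : AffineIndependent ℝ (Subtype.val : ↥(V : Set (Fin d → ℝ)) → (Fin d → ℝ)))
    {s t : Fin d → ℝ} (hs : s ∈ V) (ht : t ∈ V) :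
    s - t ∈ latN (convexHull ℝ (V : Set (Fin d → ℝ))) :=
  ⟨Submodule.subset_span (sub_mem_vertexDiffs_convexHull hV hs ht),
    (intLattice d).sub_mem (hint s hs) (hint t ht)⟩

/-- The span of the vertex differences consists of linear combinations of total weight zero. -/
theorem exists_weights_of_mem_span_vertexDiffs {y : Fin d → ℝ}
    (hy : y ∈ Submodule.span ℝ (vertexDiffs (convexHull ℝ (V : Set (Fin d → ℝ))))) :
    ∃ k : (Fin d → ℝ) → ℝ, ∑ t ∈ V, k t = 0 ∧ ∑ t ∈ V, k t • t = y := by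
  classical
  induction hy using Submodule.span_induction with
  | mem y hy =>
    obtain ⟨a, ha, b, hb, rfl⟩ := hy
    have ha' : a ∈ V := extremePoints_convexHull_subset ha
    have hb' : b ∈ V := extremePoints_convexHull_subset hb
    exact ⟨fun t => (if t = a then 1 else 0) - if t = b then 1 else 0,
      by simp [Finset.sum_sub_distrib, ha', hb'],
      by simp [Finset.sum_sub_distrib, sub_smul, ha', hb']⟩
  | zero => exact ⟨0, by simp, by simp⟩
  | add y z _ _ hy hz =>
    obtain ⟨k, hk, rfl⟩ := hy
    obtain ⟨l, hl, rfl⟩ := hz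
    exact ⟨k + l, by simp [Finset.sum_add_distrib, hk, hl],
      by simp [Finset.sum_add_distrib, add_smul]⟩
  | smul r y _ hy =>
    obtain ⟨k, hk, rfl⟩ := hy
    exact ⟨r • k, by simp [← Finset.mul_sum, hk], by simp [mul_smul, Finset.smul_sum]⟩

/-- A positive multiple of any element of `N(S)` is an integral combination of the vertices of `S`
of total weight zero, so `L(S)` has torsion quotient in `N(S)`. -/
theorem exists_int_weights_of_mem_latN (hint : ∀ u ∈ V, IsLatticePt u) {y : Fin d → ℝ}
    (hy : y ∈ latN (convexHull ℝ (V : Set (Fin d → ℝ)))) :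
    ∃ m : ℤ, m ≠ 0 ∧ ∃ n : (Fin d → ℝ) → ℤ,
      ∑ t ∈ V, n t = 0 ∧ ∑ t ∈ V, n t • t = m • y := by
  obtain ⟨k, hk, hky⟩ := exists_weights_of_mem_span_vertexDiffs hy.1
  obtain ⟨π, hπ⟩ := (Algebra.linearMap ℚ ℝ).exists_leftInverse_of_injective
    (LinearMap.ker_eq_bot.2 (algebraMap ℚ ℝ).injective)
  have hπz (z : ℤ) : π (z : ℝ) = z := by
    simpa using LinearMap.congr_fun hπ (z : ℚ)
  have hπmul (r : ℝ) (z : ℤ) : π (r * z) = π r * z := by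
    have := π.map_smul (z : ℚ) r
    rw [Rat.smul_def, Rat.cast_intCast, smul_eq_mul] at this
    rw [mul_comm, this, mul_comm]
  have hq0 : ∑ t ∈ V, π (k t) = 0 := by rw [← map_sum, hk, map_zero]
  have hqy : ∑ t ∈ V, (π (k t) : ℝ) • t = y := by
    funext i
    obtain ⟨z, hz⟩ := hy.2 i
    choose! b hb using fun t (ht : t ∈ V) => hint t ht i
    have h1 : ∑ t ∈ V, k t * b t = z := by
      rw [← hz, ← hky, Finset.sum_apply]
      exact Finset.sum_congr rfl fun t ht => by simp [hb t ht]
    have h2 : ∑ t ∈ V, π (k t) * b t = z := by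
      rw [← hπz z, ← h1, map_sum]
      exact Finset.sum_congr rfl fun t _ => (hπmul _ _).symm
    rw [hz, Finset.sum_apply]
    have h3 := congrArg (fun q : ℚ => (q : ℝ)) h2
    push_cast at h3
    rw [← h3]
    exact Finset.sum_congr rfl fun t ht => by simp [hb t ht]
  obtain ⟨⟨m, hm⟩, hmk⟩ := IsLocalization.exist_integer_multiples (nonZeroDivisors ℤ) V
    fun t => π (k t)
  choose! n hn using hmk
  have hn' (t) (ht : t ∈ V) : (n t : ℚ) = m * π (k t) := by simpa using hn t ht
  refine ⟨m, nonZeroDivisors.ne_zero hm, n, ?_, ?_⟩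
  · have : ∑ t ∈ V, (n t : ℚ) = 0 := by
      rw [Finset.sum_congr rfl hn', ← Finset.mul_sum, hq0, mul_zero]
    exact_mod_cast this
  · rw [← hqy, Finset.smul_sum]
    refine Finset.sum_congr rfl fun t ht => ?_
    rw [← Int.cast_smul_eq_zsmul ℝ, ← Int.cast_smul_eq_zsmul ℝ, smul_smul]
    congr 1
    exact_mod_cast congrArg (fun q : ℚ => (q : ℝ)) (hn' t ht)

/-- A homomorphism on `N(S)` vanishing on the edges of the facet opposite `w` is determined by
its value on an edge at `w`, through the coefficient of `w`. -/
theorem map_zsmul_eq_of_weights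
    (φ : ↥(latN (convexHull ℝ (V : Set (Fin d → ℝ)))) →+ ℤ) {u w : Fin d → ℝ} (hw : w ∈ V)
    (hN : ∀ t ∈ V, t - u ∈ latN (convexHull ℝ (V : Set (Fin d → ℝ))))
    (hφ : ∀ t (ht : t ∈ V), t ≠ w → φ ⟨t - u, hN t ht⟩ = 0)
    (y : ↥(latN (convexHull ℝ (V : Set (Fin d → ℝ))))) {m : ℤ} {n : (Fin d → ℝ) → ℤ}
    (hn0 : ∑ t ∈ V, n t = 0) (hn : ∑ t ∈ V, n t • t = m • (y : Fin d → ℝ)) :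
    m * φ y = n w * φ ⟨w - u, hN w hw⟩ := by
  have h : m • y = ∑ t ∈ V.attach, n t • (⟨t.1 - u, hN t t.2⟩ : ↥(latN _)) := by
    apply Subtype.ext
    push_cast
    rw [← hn, Finset.sum_attach V fun t => n t • (t - u)]
    simp only [smul_sub, Finset.sum_sub_distrib, ← Finset.sum_smul, hn0, zero_smul, sub_zero]
  have h' := congrArg φ h
  rw [map_zsmul, map_sum, Finset.sum_eq_single_of_mem ⟨w, hw⟩ (Finset.mem_attach _ _)] at h'
  · simpa using h'
  · intro t _ ht
    rw [map_zsmul, hφ t t.2 fun h => ht (Subtype.ext h), smul_zero]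

end SimplexLattice

theorem statement14 (d : ℕ) (hd : 0 < d)
    (V : Finset (Fin d → ℝ)) (hcard : 2 ≤ V.card)
    (hint : ∀ u ∈ V, IsLatticePt u)
    (haff : AffineIndependent ℝ (Subtype.val : ↥(V : Set (Fin d → ℝ)) → (Fin d → ℝ)))
    (S : Set (Fin d → ℝ)) (hS : S = convexHull ℝ (V : Set (Fin d → ℝ)))
    -- the distinguished vertex `v`
    (v : Fin d → ℝ) (hv : v ∈ V)
    -- `x` is a nonzero element of `G(S) = N(S)/L(S)`, given by a representative
    (x : Fin d → ℝ) (hxN : x ∈ latN S) (hxL : x ∉ latL S)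
    -- `c` is the unique positive integer such that `c • (S − v)` contains exactly one
    -- element `x₀'` of `N(S)` representing `x`
    (c : ℕ) (hc : 0 < c)
    (x₀' : Fin d → ℝ)
    (hx₀'mem : x₀' ∈ (c : ℝ) • ((-v) +ᵥ S) ∧ x₀' ∈ latN S ∧ x₀' - x ∈ latL S)
    (hx₀'uniq : ∀ y : Fin d → ℝ,
      (y ∈ (c : ℝ) • ((-v) +ᵥ S) ∧ y ∈ latN S ∧ y - x ∈ latL S) → y = x₀')
    (hcuniq : ∀ c'' : ℕ, 0 < c'' →
      (∃! y : Fin d → ℝ, y ∈ (c'' : ℝ) • ((-v) +ᵥ S) ∧ y ∈ latN S ∧ y - x ∈ latL S) →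
      c'' = c)
    (x₀ : Fin d → ℝ) (hx₀ : x₀ = x₀' + (c : ℝ) • v)
    -- `F` is a facet of `S` with `x₀ ∉ c•F`, `w` is the vertex of `S` opposite `F`,
    -- and `u` is a vertex of `F`
    (w : Fin d → ℝ) (hw : w ∈ V)
    (F : Set (Fin d → ℝ)) (hF : F = convexHull ℝ ((V : Set (Fin d → ℝ)) \ {w}))
    (hx₀F : x₀ ∉ (c : ℝ) • F)
    (u : Fin d → ℝ) (hu : u ∈ V) (huw : u ≠ w)
    -- `φ : N(S) → ℤ` is a surjective homomorphism vanishing on `L(F)`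
    (φ : ↥(latN S) →+ ℤ) (hsurj : Function.Surjective φ)
    (hvanish : ∀ y : ↥(latN S), (y : Fin d → ℝ) ∈ latL F → φ y = 0)
    (h1 : x₀ - (c : ℝ) • u ∈ latN S) (h2 : w - u ∈ latN S) :
    0 < |φ ⟨x₀ - (c : ℝ) • u, h1⟩| ∧ |φ ⟨x₀ - (c : ℝ) • u, h1⟩| < |φ ⟨w - u, h2⟩| := by
  classical
  subst hS hF hx₀
  obtain ⟨hmem, hx₀N, hx₀L⟩ := hx₀'mem
  obtain ⟨_, ⟨s, hs, rfl⟩, rfl⟩ := hmem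
  have hs' := hs
  rw [Finset.mem_convexHull'] at hs'
  obtain ⟨b, hb0, hb1, hbs⟩ := hs'
  have hcR : (0 : ℝ) < c := by exact_mod_cast hc
  have hx₀s : (c : ℝ) • ((-v) +ᵥ s) + (c : ℝ) • v = (c : ℝ) • s := by
    simp [smul_add]
  have hVe : ((V.erase w : Finset (Fin d → ℝ)) : Set (Fin d → ℝ)) =
      (V : Set (Fin d → ℝ)) \ {w} := Finset.coe_erase w V
  -- the weight of `w` is positive
  have hbw : 0 < b w := by
    refine (hb0 w hw).lt_of_ne' fun h0 => hx₀F ?_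
    simp only [hx₀s]
    refine Set.smul_mem_smul_set ?_
    rw [← hVe, Finset.mem_convexHull']
    refine ⟨b, fun y hy => hb0 y (Finset.mem_of_mem_erase hy), ?_, ?_⟩
    · rw [Finset.sum_erase _ h0, hb1]
    · rw [Finset.sum_erase _ (by simp [h0]), hbs]
  -- otherwise, moving one step from `w` to `u` gives a second representative
  have hbw1 : c * b w < 1 := by
    by_contra! h
    have hsub := sub_mem_vertexDiffs_convexHull haff hu hw
    have heq := hx₀'uniq ((c : ℝ) • ((-v) +ᵥ s) + (u - w)) ⟨?_, ?_, ?_⟩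
    · exact huw (sub_eq_zero.1 (by simpa using heq))
    · refine ⟨(-v) +ᵥ (s + (c : ℝ)⁻¹ • (u - w)), Set.vadd_mem_vadd_set ?_, ?_⟩
      · rw [Finset.mem_convexHull']
        refine ⟨fun t => b t + (c : ℝ)⁻¹ * ((if t = u then 1 else 0) - if t = w then 1 else 0),
          fun t ht => ?_, ?_, ?_⟩
        · have hci : (0 : ℝ) < (c : ℝ)⁻¹ := inv_pos.2 hcR
          rcases eq_or_ne t w with rfl | htw
          · have : (c : ℝ)⁻¹ ≤ b t := by
              rw [inv_le_iff_one_le_mul₀ hcR]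
              linarith
            simpa [huw.symm] using this
          · have := hb0 t ht
            by_cases htu : t = u
            · simp only [htu, huw, if_true, if_false, sub_zero, mul_one]
              rw [htu] at this
              positivity
            · simpa [htw, htu] using this
        · simp [Finset.sum_add_distrib, ← Finset.mul_sum, hb1, hu, hw]
        · simp [add_smul, mul_smul, sub_smul, Finset.sum_add_distrib, ← Finset.smul_sum, hbs,
            hu, hw]
      · simp [smul_add, smul_smul, hcR.ne', add_assoc]
    · exact add_mem hx₀N (sub_mem_latN_convexHull hint haff hu hw)
    · rw [add_sub_right_comm]
      exact add_mem hx₀L (AddSubgroup.subset_closure hsub)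
  have hN (t) (ht : t ∈ V) := sub_mem_latN_convexHull hint haff ht hu
  have haffF : AffineIndependent ℝ
      (Subtype.val : ↥((V.erase w : Finset (Fin d → ℝ)) : Set (Fin d → ℝ)) → (Fin d → ℝ)) :=
    haff.mono (Finset.coe_subset.2 (Finset.erase_subset w V))
  have hφ (t) (ht : t ∈ V) (htw : t ≠ w) : φ ⟨t - u, hN t ht⟩ = 0 := by
    refine hvanish _ (AddSubgroup.subset_closure ?_)
    rw [← hVe]
    exact sub_mem_vertexDiffs_convexHull haffF (Finset.mem_erase.2 ⟨htw, ht⟩)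
      (Finset.mem_erase.2 ⟨huw, hu⟩)
  have hφw : φ ⟨w - u, h2⟩ ≠ 0 := by
    intro h0
    obtain ⟨y, hy⟩ := hsurj 1
    obtain ⟨m, hm, n, hn0, hn⟩ := exists_int_weights_of_mem_latN hint y.2
    have := map_zsmul_eq_of_weights φ hw hN hφ y hn0 hn
    rw [h0, hy] at this
    exact hm (by simpa using this)
  obtain ⟨m, hm, n, hn0, hn⟩ := exists_int_weights_of_mem_latN hint h1
  have hφx := map_zsmul_eq_of_weights φ hw hN hφ ⟨_, h1⟩ hn0 hn
  have hnw : (n w : ℝ) = m * (c * b w) := by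
    have := haff.eq_zero_of_sum_eq_zero_subtype
      (w := fun t => n t - m * (c * b t - if t = u then (c : ℝ) else 0)) (s := V)
      (by
        have : ∑ t ∈ V, (n t : ℝ) = 0 := by exact_mod_cast hn0
        simp [Finset.sum_sub_distrib, ← Finset.mul_sum, hb1, hu, this])
      (by
        have : ∑ t ∈ V, (n t : ℝ) • t = (m : ℝ) • ((c : ℝ) • s - (c : ℝ) • u) := by
          rw [← hx₀s, Int.cast_smul_eq_zsmul, ← hn]
          exact Finset.sum_congr rfl fun t _ => Int.cast_smul_eq_zsmul ℝ _ _
        simp only [sub_smul, mul_smul, Finset.sum_sub_distrib, ← Finset.smul_sum, this, hbs,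
          ite_smul, zero_smul, Finset.sum_ite_eq', hu, if_true, sub_self]) w hw
    simpa [huw.symm, sub_eq_zero] using this
  have hφR : ((φ ⟨_, h1⟩ : ℤ) : ℝ) = c * b w * (φ ⟨w - u, h2⟩ : ℤ) := by
    have hmR : (m : ℝ) ≠ 0 := by exact_mod_cast hm
    apply mul_left_cancel₀ hmR
    rw [← mul_assoc, ← hnw]
    exact_mod_cast hφx
  have hcb : 0 < c * b w := mul_pos hcR hbw
  have hφwR : (0 : ℝ) < |((φ ⟨w - u, h2⟩ : ℤ) : ℝ)| := abs_pos.2 (by exact_mod_cast hφw)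
  have habs : |((φ ⟨_, h1⟩ : ℤ) : ℝ)| = c * b w * |((φ ⟨w - u, h2⟩ : ℤ) : ℝ)| := by
    rw [hφR, abs_mul, abs_of_pos hcb]
  constructor
  · have : 0 < |((φ ⟨_, h1⟩ : ℤ) : ℝ)| := habs ▸ mul_pos hcb hφwR
    exact_mod_cast this
  · have : |((φ ⟨_, h1⟩ : ℤ) : ℝ)| < |((φ ⟨w - u, h2⟩ : ℤ) : ℝ)| :=
      habs ▸ mul_lt_of_lt_one_left hφwR hbw1
    exact_mod_cast this
end

section
/- Let S ⊂ ℝ^d be a simplex of dimension ≥ 1 and let x₀ ∈ S. Let 𝔉 be the set of facets F of S with x₀ ∉ F. Then for each F ∈ 𝔉, x₀ is not in the affine hull of F, so conv({x₀} ∪ F) is a simplex of the same dimension as S; the union of the simplices conv({x₀} ∪ F) over F ∈ 𝔉 equals S; and the relative interiors of these simplices are pairwise disjoint. -/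
open Pointwise

/-- Barycentric coordinates of an affinely independent set extend to affine maps on the whole
space. -/
theorem AffineIndependent.exists_affineMap_apply_eq_ite {E : Type*} [AddCommGroup E] [Module ℝ E]
    [DecidableEq E] {s : Set E} (hs : AffineIndependent ℝ (Subtype.val : s → E)) :
    ∃ c : E → E →ᵃ[ℝ] ℝ, ∀ v ∈ s, ∀ u ∈ s, c v u = if u = v then 1 else 0 := by
  classical
  obtain ⟨t, hst, ht, htop⟩ := exists_subset_affineIndependent_affineSpan_eq_top hs
  let b : AffineBasis t ℝ E := ⟨Subtype.val, ht, by simpa using htop⟩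
  refine ⟨fun v => if h : v ∈ t then b.coord ⟨v, h⟩ else 0, fun v hv u hu => ?_⟩
  have h : b.coord ⟨v, hst hv⟩ u = _ := b.coord_apply ⟨v, hst hv⟩ ⟨u, hst hu⟩
  simp only [Subtype.mk.injEq, eq_comm (a := v)] at h
  simp only [dif_pos (hst hv)]
  convert h

/-- An affine function that vanishes on a set vanishes on its affine span. -/
theorem AffineMap.eq_zero_of_mem_affineSpan {E : Type*} [AddCommGroup E] [Module ℝ E]
    (f : E →ᵃ[ℝ] ℝ) {s : Set E} (hf : ∀ y ∈ s, f y = 0)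
    {x : E} (hx : x ∈ affineSpan ℝ s) : f x = 0 := by
  refine affineSpan_induction (p := fun y => f y = 0) hx hf fun c u v w hu hv hw => ?_
  rw [AffineMap.map_vadd, LinearMap.map_smul, AffineMap.linearMap_vsub, hu, hv, hw]
  simp

/-- An affine function that is nonpositive on a set is nonpositive on its convex hull. -/
theorem AffineMap.nonpos_of_mem_convexHull {E : Type*} [AddCommGroup E] [Module ℝ E]
    (f : E →ᵃ[ℝ] ℝ) {s : Set E} (hf : ∀ y ∈ s, f y ≤ 0)
    {x : E} (hx : x ∈ convexHull ℝ s) : f x ≤ 0 :=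
  convexHull_min (t := f ⁻¹' Set.Iic 0) hf ((convex_Iic 0).affine_preimage f) hx

/-- Affine maps that are barycentric coordinates on the points of a finite set recover every point
of its convex hull. -/
theorem barycentric_of_mem_convexHull {E : Type*} [AddCommGroup E] [Module ℝ E] [DecidableEq E]
    {V : Finset E} {c : E → E →ᵃ[ℝ] ℝ}
    (hc : ∀ v ∈ V, ∀ u ∈ V, c v u = if u = v then 1 else 0) {x : E}
    (hx : x ∈ convexHull ℝ (V : Set E)) :
    (∀ v ∈ V, 0 ≤ c v x) ∧ ∑ v ∈ V, c v x = 1 ∧ ∑ v ∈ V, c v x • v = x := by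
  obtain ⟨a, ha, hsum, rfl⟩ := Finset.mem_convexHull'.1 hx
  have key : ∀ v ∈ V, c v (∑ y ∈ V, a y • y) = a v := fun v hv => by
    rw [← Finset.affineCombination_eq_linear_combination _ _ _ hsum,
      Finset.map_affineCombination _ _ _ hsum,
      Finset.affineCombination_eq_linear_combination _ _ _ hsum]
    simp +contextual [hc v hv, hv]
  refine ⟨fun v hv => (key v hv).symm ▸ ha v hv, ?_, ?_⟩
  · rw [Finset.sum_congr rfl key, hsum]
  · exact Finset.sum_congr rfl fun v hv => by rw [key v hv]

/-- A point of a simplex has a positive barycentric coordinate at every vertex whose opposite facet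
does not contain the point. -/
theorem barycentric_pos_of_notMem_convexHull {E : Type*} [AddCommGroup E] [Module ℝ E]
    [DecidableEq E] {V : Finset E} {c : E → E →ᵃ[ℝ] ℝ}
    (hc : ∀ v ∈ V, ∀ u ∈ V, c v u = if u = v then 1 else 0) {x w : E}
    (hx : x ∈ convexHull ℝ (V : Set E)) (hw : w ∈ V)
    (hxw : x ∉ convexHull ℝ ((V : Set E) \ {w})) : 0 < c w x := by
  obtain ⟨hnn, hsum, hcomb⟩ := barycentric_of_mem_convexHull hc hx
  refine (hnn w hw).lt_of_ne' fun h0 => hxw ?_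
  rw [← Finset.coe_erase, Finset.mem_convexHull']
  refine ⟨fun v => c v x, fun v hv => hnn v (Finset.mem_of_mem_erase hv), ?_, ?_⟩
  · rw [Finset.sum_erase (f := fun v => c v x) _ h0, hsum]
  · rw [Finset.sum_erase _ (by simp [h0]), hcomb]

/-- An affine function that is nonpositive on a set and vanishes at a point of its relative interior
vanishes on the whole set. -/
theorem AffineMap.eq_zero_of_mem_intrinsicInterior {E : Type*} [NormedAddCommGroup E]
    [NormedSpace ℝ E] (f : E →ᵃ[ℝ] ℝ) {s : Set E} (hf : ∀ y ∈ s, f y ≤ 0) {x : E}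
    (hx : x ∈ intrinsicInterior ℝ s) (hfx : f x = 0) {y : E} (hy : y ∈ s) : f y = 0 := by
  obtain ⟨x, hxi, rfl⟩ := mem_intrinsicInterior.1 hx
  have hline : ∀ t : ℝ, AffineMap.lineMap (x : E) y t ∈ affineSpan ℝ s := fun t =>
    AffineMap.lineMap_mem t x.2 (subset_affineSpan ℝ s hy)
  let g : ℝ → affineSpan ℝ s := fun t => ⟨AffineMap.lineMap (x : E) y t, hline t⟩
  have hg : Continuous g := Continuous.subtype_mk AffineMap.lineMap_continuous _
  have h0 : g 0 = x := Subtype.ext (by simp [g])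
  have hmem : ∀ᶠ t in nhds (0 : ℝ), (g t : E) ∈ s :=
    hg.continuousAt.eventually (by rw [h0]; exact mem_interior_iff_mem_nhds.1 hxi)
  obtain ⟨t, ht, hneg⟩ := (hmem.filter_mono nhdsWithin_le_nhds |>.and
    (self_mem_nhdsWithin : Set.Iio (0 : ℝ) ∈ nhdsWithin 0 (Set.Iio 0))).exists
  have h1 := hf _ ht
  rw [AffineMap.apply_lineMap, hfx, AffineMap.lineMap_apply_ring', sub_zero, add_zero] at h1
  have h2 := hf y hy
  have h3 : t < 0 := hneg
  nlinarith

/-- Replacing a vertex of an affinely independent finite set by a point of its affine span outside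
the affine span of the other vertices keeps affine independence and the affine span. -/
theorem AffineIndependent.insert_diff_singleton {E : Type*} [AddCommGroup E] [Module ℝ E]
    {V : Finset E} (haff : AffineIndependent ℝ (Subtype.val : ↥(V : Set E) → E))
    {x w : E} (hw : w ∈ V) (hx : x ∈ affineSpan ℝ (V : Set E))
    (hxw : x ∉ affineSpan ℝ ((V : Set E) \ {w})) :
    AffineIndependent ℝ (Subtype.val : ↥(insert x ((V : Set E) \ {w})) → E) ∧
      affineSpan ℝ (insert x ((V : Set E) \ {w})) = affineSpan ℝ (V : Set E) := by
  classical
  let i : ↥(V : Set E) := ⟨w, hw⟩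
  have himg : (Subtype.val : ↥(V : Set E) → E) '' {y | y ≠ i} = (V : Set E) \ {w} := by
    ext y
    simp [i, Subtype.ext_iff, and_comm]
  have hind := haff.affineIndependent_update_of_notMem_affineSpan (i := i) (p₀ := x)
    (by rwa [himg])
  have hrange : Set.range (Function.update (Subtype.val : ↥(V : Set E) → E) i x) =
      insert x ((V : Set E) \ {w}) := by
    ext y
    simp only [Set.mem_range, Function.update_apply, Set.mem_insert_iff, ← himg, Set.mem_image,
      Set.mem_ofPred_eq]
    constructor
    · rintro ⟨a, rfl⟩
      by_cases h : a = i
      · simp [h]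
      · exact .inr ⟨a, h, by simp [h]⟩
    · rintro (rfl | ⟨a, h, rfl⟩)
      · exact ⟨i, by simp⟩
      · exact ⟨a, by simp [h]⟩
  refine ⟨hrange ▸ hind.range, ?_⟩
  have : FiniteDimensional ℝ (affineSpan ℝ (V : Set E)).direction := by
    rw [direction_affineSpan]
    exact finiteDimensional_vectorSpan_of_finite ℝ V.finite_toSet
  rw [← hrange]
  refine hind.affineSpan_eq_of_le_of_card_eq_finrank_add_one ?_ ?_
  · rw [hrange, affineSpan_le, Set.insert_subset_iff]
    exact ⟨hx, Set.sdiff_subset.trans (subset_affineSpan ℝ _)⟩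
  · have hpos : 0 < Fintype.card ↥(V : Set E) := Fintype.card_pos_iff.2 ⟨i⟩
    have h := haff.finrank_vectorSpan (n := Fintype.card ↥(V : Set E) - 1)
      (Nat.sub_add_cancel hpos).symm
    rw [Subtype.range_coe] at h
    rw [direction_affineSpan, h]
    exact (Nat.sub_add_cancel hpos).symm

/-- Every point of a simplex lies in the cone over some facet that misses the apex, for any apex in
the simplex. -/
theorem exists_mem_convexHull_insert_diff_singleton {E : Type*} [AddCommGroup E] [Module ℝ E]
    [DecidableEq E] {V : Finset E} {c : E → E →ᵃ[ℝ] ℝ}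
    (hc : ∀ v ∈ V, ∀ u ∈ V, c v u = if u = v then 1 else 0) {x₀ x : E}
    (hx₀ : x₀ ∈ convexHull ℝ (V : Set E)) (hx : x ∈ convexHull ℝ (V : Set E)) :
    ∃ w ∈ V, 0 < c w x₀ ∧ x ∈ convexHull ℝ (insert x₀ ((V : Set E) \ {w})) := by
  obtain ⟨ha, hasum, hacomb⟩ := barycentric_of_mem_convexHull hc hx₀
  obtain ⟨hb, hbsum, hbcomb⟩ := barycentric_of_mem_convexHull hc hx
  obtain ⟨v, hv, hvpos⟩ : ∃ v ∈ V, 0 < c v x₀ := by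
    by_contra! h
    linarith [Finset.sum_nonpos h]
  obtain ⟨w, hw, hmin⟩ := (V.filter fun v => 0 < c v x₀).exists_min_image
    (fun v => c v x / c v x₀) ⟨v, Finset.mem_filter.2 ⟨hv, hvpos⟩⟩
  obtain ⟨hwV, hwpos⟩ := Finset.mem_filter.1 hw
  refine ⟨w, hwV, hwpos, ?_⟩
  set t := c w x / c w x₀ with ht
  have ht0 : 0 ≤ t := div_nonneg (hb w hwV) hwpos.le
  have hcoef : ∀ v ∈ V, 0 ≤ c v x - t * c v x₀ := fun v hv => by
    rcases (ha v hv).eq_or_lt with h | h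
    · simpa [← h] using hb v hv
    · exact sub_nonneg.2 ((le_div_iff₀ h).1 (hmin v (Finset.mem_filter.2 ⟨hv, h⟩)))
  have hw0 : c w x - t * c w x₀ = 0 := by rw [ht, div_mul_cancel₀ _ hwpos.ne', sub_self]
  have hsum : ∑ v ∈ V.erase w, (c v x - t * c v x₀) = 1 - t := by
    rw [Finset.sum_erase (f := fun v => c v x - t * c v x₀) _ hw0, Finset.sum_sub_distrib,
      ← Finset.mul_sum, hasum, hbsum, mul_one]
  have hcomb : ∑ v ∈ V.erase w, (c v x - t * c v x₀) • v = x - t • x₀ := by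
    rw [Finset.sum_erase _ (by rw [hw0, zero_smul])]
    simp only [sub_smul, mul_smul]
    rw [Finset.sum_sub_distrib, ← Finset.smul_sum, hacomb, hbcomb]
  have h := (convex_convexHull ℝ (insert x₀ ((V : Set E) \ {w}))).sum_mem
    (t := Finset.insertNone (V.erase w))
    (w := fun o => o.elim t fun v => c v x - t * c v x₀) (z := fun o => o.elim x₀ id) ?_ ?_ ?_
  · simpa [Finset.sum_insertNone, hcomb] using h
  · rintro (_ | v) hv
    · exact ht0
    · exact hcoef v (Finset.mem_of_mem_erase (by simpa using hv))
  · simp [Finset.sum_insertNone, hsum]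
  · rintro (_ | v) hv
    · exact subset_convexHull ℝ _ (Set.mem_insert _ _)
    · refine subset_convexHull ℝ _ (Set.mem_insert_of_mem _ ?_)
      simpa [and_comm] using hv

theorem statement15 (d : ℕ)
    (V : Finset (Fin d → ℝ)) (hcard : 2 ≤ V.card)
    (haff : AffineIndependent ℝ (Subtype.val : ↥(V : Set (Fin d → ℝ)) → (Fin d → ℝ)))
    (S : Set (Fin d → ℝ)) (hS : S = convexHull ℝ (V : Set (Fin d → ℝ)))
    (x₀ : Fin d → ℝ) (hx₀ : x₀ ∈ S) :
    -- for each facet `F = conv(V \ {w})` not containing `x₀`: `x₀` is not in the affine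
    -- hull of `F`, and `conv({x₀} ∪ F)` is a simplex of the same dimension as `S`
    (∀ w ∈ V, x₀ ∉ convexHull ℝ ((V : Set (Fin d → ℝ)) \ {w}) →
      x₀ ∉ affineSpan ℝ ((V : Set (Fin d → ℝ)) \ {w}) ∧
      IsSimplex (convexHull ℝ ({x₀} ∪ convexHull ℝ ((V : Set (Fin d → ℝ)) \ {w}))) ∧
      affineSpan ℝ (convexHull ℝ ({x₀} ∪ convexHull ℝ ((V : Set (Fin d → ℝ)) \ {w}))) =
        affineSpan ℝ S) ∧
    -- the union of these simplices is `S`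
    (⋃ w ∈ {w : Fin d → ℝ | w ∈ V ∧ x₀ ∉ convexHull ℝ ((V : Set (Fin d → ℝ)) \ {w})},
      convexHull ℝ ({x₀} ∪ convexHull ℝ ((V : Set (Fin d → ℝ)) \ {w}))) = S ∧
    -- and their relative interiors are pairwise disjoint
    (∀ w₁ w₂ : Fin d → ℝ, w₁ ∈ V → w₂ ∈ V →
      x₀ ∉ convexHull ℝ ((V : Set (Fin d → ℝ)) \ {w₁}) →
      x₀ ∉ convexHull ℝ ((V : Set (Fin d → ℝ)) \ {w₂}) → w₁ ≠ w₂ →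
      intrinsicInterior ℝ (convexHull ℝ ({x₀} ∪ convexHull ℝ ((V : Set (Fin d → ℝ)) \ {w₁}))) ∩
        intrinsicInterior ℝ
          (convexHull ℝ ({x₀} ∪ convexHull ℝ ((V : Set (Fin d → ℝ)) \ {w₂}))) = ∅) := by
  classical
  subst hS
  obtain ⟨c, hc⟩ := haff.exists_affineMap_apply_eq_ite
  have hcone : ∀ w : Fin d → ℝ,
      convexHull ℝ ({x₀} ∪ convexHull ℝ ((V : Set (Fin d → ℝ)) \ {w})) =
        convexHull ℝ (insert x₀ ((V : Set (Fin d → ℝ)) \ {w})) := fun w => by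
    rw [convexHull_convexHull_union_right, Set.singleton_union]
  have hpos : ∀ w ∈ V, x₀ ∉ convexHull ℝ ((V : Set (Fin d → ℝ)) \ {w}) → 0 < c w x₀ :=
    fun w hw h => barycentric_pos_of_notMem_convexHull hc hx₀ hw h
  have hspan : ∀ w ∈ V, 0 < c w x₀ → x₀ ∉ affineSpan ℝ ((V : Set (Fin d → ℝ)) \ {w}) :=
    fun w hw h hmem => h.ne' <| (c w).eq_zero_of_mem_affineSpan
      (fun u hu => by rw [hc w hw u hu.1, if_neg (by simpa using hu.2)]) hmem
  simp only [hcone]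
  refine ⟨fun w hw hxw => ?_, ?_, fun w₁ w₂ hw₁ hw₂ hx₁ hx₂ hne => ?_⟩
  · have hns := hspan w hw (hpos w hw hxw)
    obtain ⟨hind, heq⟩ := haff.insert_diff_singleton hw (convexHull_subset_affineSpan _ hx₀) hns
    refine ⟨hns, ⟨insert x₀ (V.erase w), Finset.insert_nonempty _ _, ?_, ?_⟩, ?_⟩
    · rwa [Finset.coe_insert, Finset.coe_erase]
    · rw [Finset.coe_insert, Finset.coe_erase]
    · rw [affineSpan_convexHull, affineSpan_convexHull, heq]
  · refine Set.Subset.antisymm (Set.iUnion₂_subset fun w _ => ?_) fun x hx => ?_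
    · refine convexHull_min (Set.insert_subset hx₀ ?_) (convex_convexHull ℝ _)
      exact Set.sdiff_subset.trans (subset_convexHull ℝ _)
    · obtain ⟨w, hw, hwpos, hxw⟩ := exists_mem_convexHull_insert_diff_singleton hc hx₀ hx
      exact Set.mem_iUnion₂.2
        ⟨w, ⟨hw, fun h => hspan w hw hwpos (convexHull_subset_affineSpan _ h)⟩, hxw⟩
  · rw [Set.eq_empty_iff_forall_notMem]
    rintro x ⟨hxi₁, hxi₂⟩
    have h₁ := hpos w₁ hw₁ hx₁
    have h₂ := hpos w₂ hw₂ hx₂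
    let g : (Fin d → ℝ) →ᵃ[ℝ] ℝ := c w₂ x₀ • c w₁ - c w₁ x₀ • c w₂
    have hg : ∀ y, g y = c w₂ x₀ * c w₁ y - c w₁ x₀ * c w₂ y := fun y => rfl
    have hg₁ : ∀ y ∈ convexHull ℝ (insert x₀ ((V : Set (Fin d → ℝ)) \ {w₁})), g y ≤ 0 := by
      refine fun y hy => g.nonpos_of_mem_convexHull ?_ hy
      rintro u (rfl | ⟨hu, hne'⟩)
      · rw [hg, mul_comm, sub_self]
      · rw [hg, hc w₁ hw₁ u hu, if_neg (by simpa using hne'), hc w₂ hw₂ u hu]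
        split_ifs <;> linarith
    have hneg : ∀ y, (-g) y = -g y := fun y => rfl
    have hg₂ : (-g) x ≤ 0 := by
      refine (-g).nonpos_of_mem_convexHull ?_ (intrinsicInterior_subset hxi₂)
      rintro u (rfl | ⟨hu, hne'⟩)
      · rw [hneg, hg, mul_comm, sub_self, neg_zero]
      · rw [hneg, hg, hc w₂ hw₂ u hu, if_neg (by simpa using hne'), hc w₁ hw₁ u hu]
        split_ifs <;> linarith
    have hgx : g x = 0 :=
      le_antisymm (hg₁ x (intrinsicInterior_subset hxi₁)) (by rw [hneg] at hg₂; linarith)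
    have h := g.eq_zero_of_mem_intrinsicInterior hg₁ hxi₁ hgx
      (subset_convexHull ℝ _ (Set.mem_insert_of_mem _ ⟨hw₂, hne.symm⟩))
    rw [hg, hc w₁ hw₁ w₂ hw₂, if_neg hne.symm, hc w₂ hw₂ w₂ hw₂, if_pos rfl] at h
    linarith
end

section
/- Let S ⊂ ℝ^d be a simplex of dimension ≥ 1, let a ≥ c > 0 be real numbers, and let x₀ ∈ c·S. Let 𝔉 be the set of facets F of S with x₀ ∉ c·F. Then a·S = (x₀ + (a−c)·S) ∪ ⋃_{F ∈ 𝔉} conv((x₀ + (a−c)·F) ∪ a·F), and the relative interiors of the polytope x₀ + (a−c)·S and of the polytopes conv((x₀ + (a−c)·F) ∪ a·F), F ∈ 𝔉, are pairwise disjoint. -/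
open Pointwise

section RelativeInterior

variable {E : Type*} [AddCommGroup E] [Module ℝ E] [TopologicalSpace E] [ContinuousAdd E]
  [ContinuousSMul ℝ E]

/-- A linear inequality valid on a set and strict at one of its points is strict throughout the
relative interior. -/
lemma lt_of_mem_intrinsicInterior {P : Set E} (φ : E →ₗ[ℝ] ℝ) {k : ℝ} (hle : ∀ x ∈ P, φ x ≤ k)
    {p : E} (hp : p ∈ P) (hlt : φ p < k) {x : E} (hx : x ∈ intrinsicInterior ℝ P) : φ x < k := by
  obtain ⟨y, hy, rfl⟩ := hx
  let g : ℝ → affineSpan ℝ P := fun s =>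
    ⟨AffineMap.lineMap p (y : E) s, AffineMap.lineMap_mem s (subset_affineSpan ℝ P hp) y.2⟩
  have hg : Continuous g := by
    refine Continuous.subtype_mk ?_ _
    simpa only [← AffineMap.lineMap_apply_module] using
      (by fun_prop : Continuous fun s : ℝ => (1 - s) • p + s • (y : E))
  have hg1 : g 1 = y := by ext; simp [g]
  have hnhds : ∀ᶠ s in nhds (1 : ℝ), g s ∈ interior ((↑) ⁻¹' P : Set (affineSpan ℝ P)) :=
    hg.continuousAt.eventually (by rw [hg1]; exact isOpen_interior.mem_nhds hy)
  obtain ⟨s, hs, hs1⟩ :=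
    ((hnhds.filter_mono nhdsWithin_le_nhds).and
      (self_mem_nhdsWithin : Set.Ioi (1 : ℝ) ∈ nhdsWithin 1 (Set.Ioi 1))).exists
  have h := hle _ (interior_subset hs : g s ∈ ((↑) ⁻¹' P : Set (affineSpan ℝ P)))
  have hs1 : 1 < s := hs1
  simp only [g, AffineMap.lineMap_apply_module, map_add, map_smul, smul_eq_mul] at h
  nlinarith

/-- Two sets separated by a hyperplane that does not contain the first one have disjoint relative
interiors. -/
lemma intrinsicInterior_inter_eq_empty {P Q : Set E} (φ : E →ₗ[ℝ] ℝ) (k : ℝ)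
    (hP : ∀ x ∈ P, φ x ≤ k) (hQ : ∀ x ∈ Q, k ≤ φ x) (hlt : ∃ p ∈ P, φ p < k) :
    intrinsicInterior ℝ P ∩ intrinsicInterior ℝ Q = ∅ := by
  obtain ⟨p, hp, hpk⟩ := hlt
  refine Set.eq_empty_of_forall_notMem fun x hx => ?_
  exact (lt_of_mem_intrinsicInterior φ hP hp hpk hx.1).not_ge
    (hQ x (intrinsicInterior_subset hx.2))

end RelativeInterior

section Simplex

variable {E : Type*} [AddCommGroup E] [Module ℝ E]

/-- The barycentric coordinates of an affinely independent set extend to affine functions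
`φ v + k v` on the whole space. -/
lemma exists_barycentric_functionals {s : Set E}
    (h : AffineIndependent ℝ (Subtype.val : s → E)) :
    ∃ (φ : E → E →ₗ[ℝ] ℝ) (k : E → ℝ),
      ∀ v ∈ s, φ v v + k v = 1 ∧ ∀ u ∈ s, u ≠ v → φ v u + k v = 0 := by
  classical
  obtain ⟨t, hst, ht, htop⟩ := exists_subset_affineIndependent_affineSpan_eq_top h
  let b : AffineBasis t ℝ E := ⟨Subtype.val, ht, by simpa using htop⟩
  have key : ∀ (v : t) (x : E), (b.coord v).linear x + b.coord v 0 = b.coord v x := fun v x => by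
    have := (b.coord v).map_vadd 0 x
    simpa using this.symm
  refine ⟨fun v => if hv : v ∈ t then (b.coord ⟨v, hv⟩).linear else 0,
    fun v => if hv : v ∈ t then b.coord ⟨v, hv⟩ 0 else 0, fun v hv => ?_⟩
  simp only [hst hv, dif_pos, key]
  refine ⟨b.coord_apply_eq ⟨v, hst hv⟩, fun u hu huv => ?_⟩
  exact b.coord_apply_ne (i := ⟨v, hst hv⟩) (j := ⟨u, hst hu⟩)
    fun h => huv (congrArg Subtype.val h).symm

/-- The homogeneous barycentric coordinates of a linear combination of vertices. -/
lemma barycentric_sum {V W : Finset E} {φ : E → E →ₗ[ℝ] ℝ} {k : E → ℝ} [DecidableEq E]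
    (h : ∀ v ∈ V, φ v v + k v = 1 ∧ ∀ u ∈ V, u ≠ v → φ v u + k v = 0) (hW : W ⊆ V)
    (w : E → ℝ) {v : E} (hv : v ∈ V) :
    φ v (∑ u ∈ W, w u • u) + (∑ u ∈ W, w u) * k v = if v ∈ W then w v else 0 := by
  rw [map_sum, Finset.sum_mul, ← Finset.sum_add_distrib, ← Finset.sum_ite_eq' W v w]
  refine Finset.sum_congr rfl fun u hu => ?_
  rw [map_smul, smul_eq_mul, ← mul_add]
  split_ifs with huv
  · subst huv
    rw [(h u hv).1, mul_one]
  · rw [(h v hv).2 u (hW hu) huv, mul_zero]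

/-- Points of a dilated convex hull of finitely many points. -/
lemma mem_smul_convexHull_finset {V : Finset E} (hV : V.Nonempty) {r : ℝ} (hr : 0 ≤ r) {x : E} :
    x ∈ r • convexHull ℝ (V : Set E) ↔
      ∃ w : E → ℝ, (∀ v ∈ V, 0 ≤ w v) ∧ ∑ v ∈ V, w v = r ∧ ∑ v ∈ V, w v • v = x := by
  constructor
  · rintro ⟨y, hy, rfl⟩
    obtain ⟨w, hw0, hw1, rfl⟩ := Finset.mem_convexHull'.1 hy
    refine ⟨fun v => r * w v, fun v hv => mul_nonneg hr (hw0 v hv), ?_, ?_⟩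
    · rw [← Finset.mul_sum, hw1, mul_one]
    · simp only [mul_smul, Finset.smul_sum]
  · rintro ⟨w, hw0, rfl, rfl⟩
    rcases hr.eq_or_lt with h0 | hpos
    · have hz := (Finset.sum_eq_zero_iff_of_nonneg hw0).1 h0.symm
      rw [← h0, Set.zero_smul_set (by simpa using hV)]
      exact Finset.sum_eq_zero fun v hv => by rw [hz v hv, zero_smul]
    · rw [Set.mem_smul_set_iff_inv_smul_mem₀ hpos.ne', Finset.mem_convexHull']
      refine ⟨fun v => (∑ v ∈ V, w v)⁻¹ * w v,
        fun v hv => mul_nonneg (inv_nonneg.2 hr) (hw0 v hv), ?_, ?_⟩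
      · rw [← Finset.mul_sum, inv_mul_cancel₀ hpos.ne']
      · simp only [mul_smul, Finset.smul_sum]

/-- The convex hull of a translated dilate and a dilate of a convex set `K` is a union of translated
dilates of `K`. -/
lemma mem_convexHull_vadd_smul_union_smul {K : Set E} (hK : Convex ℝ K) (hne : K.Nonempty)
    {a c : ℝ} (hc : 0 ≤ c) (hac : c ≤ a) {x₀ x : E} :
    x ∈ convexHull ℝ ((x₀ +ᵥ (a - c) • K) ∪ a • K) ↔
      ∃ t : ℝ, 0 ≤ t ∧ t ≤ 1 ∧ ∃ y ∈ (a - t * c) • K, t • x₀ + y = x := by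
  have ha : 0 ≤ a := hc.trans hac
  rw [((hK.smul (a - c)).vadd x₀).convexHull_union (hK.smul a) hne.smul_set.vadd_set hne.smul_set,
    mem_convexJoin]
  have hsplit : ∀ t : ℝ, 0 ≤ t → t ≤ 1 →
      (a - t * c) • K = t • (a - c) • K + (1 - t) • a • K := fun t h0 h1 => by
    rw [smul_smul, smul_smul, ← hK.add_smul (mul_nonneg h0 (sub_nonneg.2 hac))
      (mul_nonneg (sub_nonneg.2 h1) ha)]
    congr 1
    ring
  constructor
  · rintro ⟨_, ⟨p, hp, rfl⟩, q, hq, s, t, hs, ht, hst, rfl⟩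
    refine ⟨s, hs, by linarith, s • p + t • q, ?_, ?_⟩
    · rw [hsplit s hs (by linarith), show 1 - s = t by linarith]
      exact Set.add_mem_add (Set.smul_mem_smul_set hp) (Set.smul_mem_smul_set hq)
    · simp only [vadd_eq_add, smul_add, add_assoc]
  · rintro ⟨t, h0, h1, y, hy, rfl⟩
    rw [hsplit t h0 h1] at hy
    obtain ⟨_, ⟨p, hp, rfl⟩, _, ⟨q, hq, rfl⟩, rfl⟩ := hy
    refine ⟨x₀ +ᵥ p, Set.vadd_mem_vadd_set hp, q, hq, t, 1 - t, h0, sub_nonneg.2 h1, by ring, ?_⟩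
    simp only [vadd_eq_add, smul_add, add_assoc]

end Simplex

theorem statement16 (d : ℕ)
    (V : Finset (Fin d → ℝ)) (hcard : 2 ≤ V.card)
    (haff : AffineIndependent ℝ (Subtype.val : ↥(V : Set (Fin d → ℝ)) → (Fin d → ℝ)))
    (S : Set (Fin d → ℝ)) (hS : S = convexHull ℝ (V : Set (Fin d → ℝ)))
    (a c : ℝ) (hc : 0 < c) (hac : c ≤ a)
    (x₀ : Fin d → ℝ) (hx₀ : x₀ ∈ c • S) :
    -- `a•S` is the union of `x₀ + (a−c)•S` and the pieces
    -- `conv((x₀ + (a−c)•F) ∪ a•F)` over facets `F = conv(V \ {w})` with `x₀ ∉ c•F`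
    a • S = (x₀ +ᵥ (a - c) • S) ∪
      (⋃ w ∈ {w : Fin d → ℝ | w ∈ V ∧ x₀ ∉ c • convexHull ℝ ((V : Set (Fin d → ℝ)) \ {w})},
        convexHull ℝ ((x₀ +ᵥ (a - c) • convexHull ℝ ((V : Set (Fin d → ℝ)) \ {w})) ∪
          a • convexHull ℝ ((V : Set (Fin d → ℝ)) \ {w}))) ∧
    -- the relative interiors are pairwise disjoint
    (∀ w ∈ V, x₀ ∉ c • convexHull ℝ ((V : Set (Fin d → ℝ)) \ {w}) →
      intrinsicInterior ℝ (x₀ +ᵥ (a - c) • S) ∩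
        intrinsicInterior ℝ
          (convexHull ℝ ((x₀ +ᵥ (a - c) • convexHull ℝ ((V : Set (Fin d → ℝ)) \ {w})) ∪
            a • convexHull ℝ ((V : Set (Fin d → ℝ)) \ {w}))) = ∅) ∧
    (∀ w₁ w₂ : Fin d → ℝ, w₁ ∈ V → w₂ ∈ V →
      x₀ ∉ c • convexHull ℝ ((V : Set (Fin d → ℝ)) \ {w₁}) →
      x₀ ∉ c • convexHull ℝ ((V : Set (Fin d → ℝ)) \ {w₂}) → w₁ ≠ w₂ →
      intrinsicInterior ℝ
          (convexHull ℝ ((x₀ +ᵥ (a - c) • convexHull ℝ ((V : Set (Fin d → ℝ)) \ {w₁})) ∪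
            a • convexHull ℝ ((V : Set (Fin d → ℝ)) \ {w₁}))) ∩
        intrinsicInterior ℝ
          (convexHull ℝ ((x₀ +ᵥ (a - c) • convexHull ℝ ((V : Set (Fin d → ℝ)) \ {w₂})) ∪
            a • convexHull ℝ ((V : Set (Fin d → ℝ)) \ {w₂}))) = ∅) := by
  classical
  subst hS
  have ha : 0 < a := hc.trans_le hac
  have hac' : 0 ≤ a - c := sub_nonneg.2 hac
  have hV : V.Nonempty := Finset.card_pos.1 (by lia)
  have hVe : ∀ w, (V.erase w).Nonempty := fun w =>
    Finset.card_pos.1 (by have := Finset.pred_card_le_card_erase (s := V) (a := w); lia)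
  simp only [← Finset.coe_erase]
  obtain ⟨φ, k, hφ⟩ := exists_barycentric_functionals haff
  simp only [Finset.mem_coe] at hφ
  have coord_sum := fun w v (hv : v ∈ V) => barycentric_sum hφ (Finset.Subset.refl V) w hv
  have coord_sum_erase := fun w' w v (hv : v ∈ V) =>
    barycentric_sum hφ (Finset.erase_subset w' V) w hv
  obtain ⟨γ, hγ0, hγc, hγx⟩ := (mem_smul_convexHull_finset hV hc.le).1 hx₀
  have hγ : ∀ v ∈ V, φ v x₀ + c * k v = γ v := fun v hv => by
    have := coord_sum γ v hv
    rwa [hγx, hγc, if_pos hv] at this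
  have hF : ∀ w ∈ V,
      x₀ ∉ c • convexHull ℝ ((V.erase w : Finset (Fin d → ℝ)) : Set (Fin d → ℝ)) ↔ 0 < γ w := by
    intro w hw
    rw [mem_smul_convexHull_finset (hVe w) hc.le]
    constructor
    · intro h
      refine (hγ0 w hw).lt_of_ne fun h0 => h ⟨γ, fun v hv => hγ0 v (Finset.mem_of_mem_erase hv),
        ?_, ?_⟩
      · rw [Finset.sum_erase _ h0.symm, hγc]
      · rw [Finset.sum_erase _ (by rw [← h0, zero_smul]), hγx]
    · rintro hpos ⟨η, -, hηc, hηx⟩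
      have := coord_sum_erase w η w hw
      rw [hηc, hηx, hγ w hw, if_neg (Finset.notMem_erase w V)] at this
      exact hpos.ne' this
  have hpiece : ∀ (w x : Fin d → ℝ),
      x ∈ convexHull ℝ
        ((x₀ +ᵥ (a - c) • convexHull ℝ ((V.erase w : Finset (Fin d → ℝ)) : Set (Fin d → ℝ))) ∪
          a • convexHull ℝ ((V.erase w : Finset (Fin d → ℝ)) : Set (Fin d → ℝ))) ↔
      ∃ t : ℝ, 0 ≤ t ∧ t ≤ 1 ∧ ∃ η : (Fin d → ℝ) → ℝ, (∀ v ∈ V.erase w, 0 ≤ η v) ∧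
        ∑ v ∈ V.erase w, η v = a - t * c ∧ t • x₀ + ∑ v ∈ V.erase w, η v • v = x := by
    intro w x
    rw [mem_convexHull_vadd_smul_union_smul (convex_convexHull ℝ _)
      (convexHull_nonempty_iff.2 (Finset.coe_nonempty.2 (hVe w))) hc.le hac]
    refine exists_congr fun t => and_congr_right fun h0 => and_congr_right fun h1 => ?_
    have hr : 0 ≤ a - t * c := by nlinarith
    simp only [mem_smul_convexHull_finset (hVe w) hr]
    constructor
    · rintro ⟨y, ⟨η, h1, h2, rfl⟩, rfl⟩
      exact ⟨η, h1, h2, rfl⟩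
    · rintro ⟨η, h1, h2, rfl⟩
      exact ⟨_, ⟨η, h1, h2, rfl⟩, rfl⟩
  have hcoord : ∀ w ∈ V, ∀ x ∈ convexHull ℝ
        ((x₀ +ᵥ (a - c) • convexHull ℝ ((V.erase w : Finset (Fin d → ℝ)) : Set (Fin d → ℝ))) ∪
          a • convexHull ℝ ((V.erase w : Finset (Fin d → ℝ)) : Set (Fin d → ℝ))),
      ∃ t : ℝ, 0 ≤ t ∧ t ≤ 1 ∧ φ w x + a * k w = t * γ w ∧
        ∀ v ∈ V, t * γ v ≤ φ v x + a * k v := by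
    intro w hw x hx
    obtain ⟨t, h0, h1, η, hη, hηs, rfl⟩ := (hpiece w x).1 hx
    have hall : ∀ v ∈ V, φ v (t • x₀ + ∑ v ∈ V.erase w, η v • v) + a * k v =
        t * γ v + if v ∈ V.erase w then η v else 0 := fun v hv => by
      rw [← coord_sum_erase w η v hv, ← hγ v hv, hηs, map_add, map_smul, smul_eq_mul]
      ring
    refine ⟨t, h0, h1, ?_, fun v hv => ?_⟩
    · rw [hall w hw, if_neg (Finset.notMem_erase w V), add_zero]
    · rw [hall v hv]
      split_ifs with hvw
      · linarith [hη v hvw]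
      · linarith
  have hvertex : ∀ w v : Fin d → ℝ, v ∈ V.erase w → a • v ∈ convexHull ℝ
        ((x₀ +ᵥ (a - c) • convexHull ℝ ((V.erase w : Finset (Fin d → ℝ)) : Set (Fin d → ℝ))) ∪
          a • convexHull ℝ ((V.erase w : Finset (Fin d → ℝ)) : Set (Fin d → ℝ))) :=
    fun w v hv => subset_convexHull ℝ _
      (Or.inr (Set.smul_mem_smul_set (subset_convexHull ℝ _ (Finset.mem_coe.2 hv))))
  have hcoord_vertex : ∀ w ∈ V, ∀ v ∈ V, v ≠ w → φ w (a • v) + a * k w = 0 := by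
    intro w hw v hv hvw
    rw [map_smul, smul_eq_mul, ← mul_add, (hφ w hw).2 v hv hvw, mul_zero]
  refine ⟨Set.Subset.antisymm ?_ (Set.union_subset ?_ ?_), ?_, ?_⟩
  · intro x hx
    obtain ⟨ξ, hξ0, hξa, rfl⟩ := (mem_smul_convexHull_finset hV ha.le).1 hx
    by_cases hge : ∀ v ∈ V, γ v ≤ ξ v
    · left
      refine ⟨∑ v ∈ V, (ξ v - γ v) • v, (mem_smul_convexHull_finset hV hac').2
        ⟨fun v => ξ v - γ v, fun v hv => sub_nonneg.2 (hge v hv), ?_, rfl⟩, ?_⟩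
      · rw [Finset.sum_sub_distrib, hξa, hγc]
      · simp only [sub_smul, Finset.sum_sub_distrib, hγx, vadd_eq_add, add_sub_cancel]
    · right
      push Not at hge
      obtain ⟨v₀, hv₀, hlt⟩ := hge
      have hv₀pos : 0 < γ v₀ := (hξ0 v₀ hv₀).trans_lt hlt
      obtain ⟨w, hw, hmin⟩ := (V.filter fun v => 0 < γ v).exists_min_image (fun v => ξ v / γ v)
        ⟨v₀, Finset.mem_filter.2 ⟨hv₀, hv₀pos⟩⟩
      obtain ⟨hwV, hwpos⟩ := Finset.mem_filter.1 hw
      simp only [Set.mem_iUnion]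
      refine ⟨w, ⟨hwV, (hF w hwV).2 hwpos⟩, (hpiece w _).2
        ⟨ξ w / γ w, div_nonneg (hξ0 w hwV) hwpos.le, ?_,
          fun v => ξ v - ξ w / γ w * γ v, ?_, ?_, ?_⟩⟩
      · exact (hmin v₀ (Finset.mem_filter.2 ⟨hv₀, hv₀pos⟩)).trans
          ((div_le_one hv₀pos).2 hlt.le)
      · intro v hv
        have hvV := Finset.mem_of_mem_erase hv
        rcases (hγ0 v hvV).eq_or_lt with h0 | hpos
        · simpa [← h0] using hξ0 v hvV
        · have := hmin v (Finset.mem_filter.2 ⟨hvV, hpos⟩)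
          exact sub_nonneg.2 ((le_div_iff₀ hpos).1 this)
      · rw [Finset.sum_erase _ (by rw [div_mul_cancel₀ _ hwpos.ne', sub_self]),
          Finset.sum_sub_distrib, ← Finset.mul_sum, hξa, hγc]
      · rw [Finset.sum_erase _ (by simp only [div_mul_cancel₀ _ hwpos.ne', sub_self, zero_smul])]
        simp only [sub_smul, Finset.sum_sub_distrib, mul_smul, ← Finset.smul_sum, hγx,
          add_sub_cancel]
  · calc x₀ +ᵥ (a - c) • convexHull ℝ (V : Set (Fin d → ℝ))
        ⊆ c • convexHull ℝ (V : Set (Fin d → ℝ)) + (a - c) • convexHull ℝ (V : Set (Fin d → ℝ)) :=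
          fun _ ⟨y, hy, hxy⟩ => ⟨x₀, hx₀, y, hy, hxy⟩
      _ = a • convexHull ℝ (V : Set (Fin d → ℝ)) := by
          rw [← (convex_convexHull ℝ _).add_smul hc.le hac', add_sub_cancel]
  · refine Set.iUnion₂_subset fun w _ => convexHull_min (Set.union_subset ?_ ?_)
      ((convex_convexHull ℝ _).smul a)
    · rintro _ ⟨y, hy, rfl⟩
      have : a • convexHull ℝ (V : Set (Fin d → ℝ)) =
          c • convexHull ℝ (V : Set (Fin d → ℝ)) +
            (a - c) • convexHull ℝ (V : Set (Fin d → ℝ)) := by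
        rw [← (convex_convexHull ℝ _).add_smul hc.le hac', add_sub_cancel]
      rw [this]
      exact ⟨x₀, hx₀, y, Set.smul_set_mono
        (convexHull_mono (Finset.coe_subset.2 (Finset.erase_subset w V))) hy, rfl⟩
    · exact Set.smul_set_mono (convexHull_mono (Finset.coe_subset.2 (Finset.erase_subset w V)))
  · intro w hw hwF
    have hpos := (hF w hw).1 hwF
    rw [Set.inter_comm]
    refine intrinsicInterior_inter_eq_empty (φ w) (γ w - a * k w) (fun x hx => ?_) ?_ ?_
    · obtain ⟨t, h0, h1, hx, -⟩ := hcoord w hw x hx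
      nlinarith
    · rintro _ ⟨y, hy, rfl⟩
      obtain ⟨η, hη0, hηs, rfl⟩ := (mem_smul_convexHull_finset hV hac').1 hy
      have h := coord_sum η w hw
      rw [hηs, if_pos hw] at h
      simp only [vadd_eq_add, map_add]
      linarith [hη0 w hw, hγ w hw]
    · obtain ⟨v, hv⟩ := hVe w
      refine ⟨a • v, hvertex w v hv, ?_⟩
      linarith [hcoord_vertex w hw v (Finset.mem_of_mem_erase hv) (Finset.ne_of_mem_erase hv)]
  · intro w₁ w₂ hw₁ hw₂ hF₁ hF₂ hne
    have hpos₁ := (hF w₁ hw₁).1 hF₁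
    have hpos₂ := (hF w₂ hw₂).1 hF₂
    refine intrinsicInterior_inter_eq_empty (γ w₂ • φ w₁ - γ w₁ • φ w₂)
      (γ w₁ * (a * k w₂) - γ w₂ * (a * k w₁)) (fun x hx => ?_) (fun x hx => ?_)
      ⟨a • w₂, hvertex w₁ w₂ (Finset.mem_erase.2 ⟨hne.symm, hw₂⟩), ?_⟩
    · obtain ⟨t, -, -, h1, h2⟩ := hcoord w₁ hw₁ x hx
      have h2 := h2 w₂ hw₂
      simp only [LinearMap.sub_apply, LinearMap.smul_apply, smul_eq_mul]
      linear_combination γ w₂ * h1 + γ w₁ * h2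
    · obtain ⟨t, -, -, h1, h2⟩ := hcoord w₂ hw₂ x hx
      have h2 := h2 w₁ hw₁
      simp only [LinearMap.sub_apply, LinearMap.smul_apply, smul_eq_mul]
      linear_combination γ w₁ * h1 + γ w₂ * h2
    · have h1 := hcoord_vertex w₁ hw₁ w₂ hw₂ hne.symm
      have h2 : φ w₂ (a • w₂) + a * k w₂ = a := by
        rw [map_smul, smul_eq_mul, ← mul_add, (hφ w₂ hw₂).1, mul_one]
      have h3 : 0 < γ w₁ * a := mul_pos hpos₁ ha
      simp only [LinearMap.sub_apply, LinearMap.smul_apply, smul_eq_mul]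
      linear_combination γ w₂ * h1 - γ w₁ * h2 + h3
end

section
/- Let S ⊂ ℝ^d be a d-dimensional integral simplex whose index is strictly greater than 1. Then the dilated simplex d!·S admits a triangulation into integral simplices, each of which has index strictly smaller than the index of S. -/
open Pointwise

section Complexes

variable {d : ℕ} {ι : Type*} [Fintype ι]

/-- `w` exhibits `x` as a convex combination of the points `φ i`, `i ∈ A`. -/
structure IsConvComb {E : Type*} [AddCommGroup E] [Module ℝ E] (φ : ι → E) (A : Finset ι)
    (w : ι → ℝ) (x : E) : Prop where
  nonneg : ∀ i, 0 ≤ w i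
  supp : ∀ i, i ∉ A → w i = 0
  sum_eq : ∑ i, w i = 1
  comb : ∑ i, w i • φ i = x

/-- The family `φ` is affinely independent (in particular injective) on `A`. -/
def AffIndepOn {E : Type*} [AddCommGroup E] [Module ℝ E] (φ : ι → E) (A : Finset ι) : Prop :=
  ∀ c : ι → ℝ, (∀ i, i ∉ A → c i = 0) → ∑ i, c i = 0 → ∑ i, c i • φ i = 0 → c = 0

theorem IsConvComb.mono {φ : ι → Fin d → ℝ} {A B : Finset ι} {w : ι → ℝ} {x : Fin d → ℝ}
    (h : IsConvComb φ A w x) (hB : ∀ i, i ∉ B → w i = 0) : IsConvComb φ B w x :=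
  ⟨h.nonneg, hB, h.sum_eq, h.comb⟩

theorem mem_convexHull_image_iff (φ : ι → Fin d → ℝ) (A : Finset ι) (x : Fin d → ℝ) :
    x ∈ convexHull ℝ (φ '' (A : Set ι)) ↔ ∃ w, IsConvComb φ A w x := by
  classical
  constructor
  · intro hx
    refine convexHull_min (t := {x | ∃ w, IsConvComb φ A w x}) ?_ ?_ hx
    · rintro _ ⟨i, hi, rfl⟩
      refine ⟨Pi.single i 1, fun j => ?_, fun j hj => ?_, by simp, by simp [Pi.single_apply]⟩
      · by_cases h : j = i <;> simp [h]
      · have : j ≠ i := by rintro rfl; exact hj hi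
        simp [this]
    · rintro x ⟨w, hw⟩ y ⟨w', hw'⟩ a b ha hb hab
      refine ⟨fun i => a * w i + b * w' i, fun i => ?_, fun i hi => ?_, ?_, ?_⟩
      · have := hw.nonneg i; have := hw'.nonneg i; positivity
      · simp [hw.supp i hi, hw'.supp i hi]
      · simp [Finset.sum_add_distrib, ← Finset.mul_sum, hw.sum_eq, hw'.sum_eq, hab]
      · simp [add_smul, mul_smul, Finset.sum_add_distrib, ← Finset.smul_sum, hw.comb, hw'.comb]
  · rintro ⟨w, hw⟩
    have h1 : ∑ i ∈ A, w i = 1 := by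
      rw [← hw.sum_eq]
      exact Finset.sum_subset (Finset.subset_univ _) fun i _ hi => hw.supp i hi
    have h2 : ∑ i ∈ A, w i • φ i = x := by
      rw [← hw.comb]
      exact Finset.sum_subset (Finset.subset_univ _) fun i _ hi => by simp [hw.supp i hi]
    rw [← h2]
    exact (convex_convexHull ℝ _).sum_mem (fun i _ => hw.nonneg i) h1
      fun i hi => subset_convexHull ℝ _ ⟨i, hi, rfl⟩

theorem AffIndepOn.unique {φ : ι → Fin d → ℝ} {A : Finset ι} (h : AffIndepOn φ A)
    {w w' : ι → ℝ} {x : Fin d → ℝ} (hw : IsConvComb φ A w x) (hw' : IsConvComb φ A w' x) :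
    w = w' := by
  refine sub_eq_zero.1 (h (w - w') (fun i hi => ?_) ?_ ?_)
  · simp [hw.supp i hi, hw'.supp i hi]
  · simp [hw.sum_eq, hw'.sum_eq]
  · simp [sub_smul, hw.comb, hw'.comb]

theorem AffIndepOn.affineIndependent {φ : ι → Fin d → ℝ} {A : Finset ι} (h : AffIndepOn φ A) :
    AffineIndependent ℝ (fun i : A => φ i) := by
  classical
  rw [affineIndependent_iff]
  intro s w hw hwφ i hi
  have key := h (fun k => if hk : k ∈ A then (if (⟨k, hk⟩ : A) ∈ s then w ⟨k, hk⟩ else 0) else 0)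
    (fun k hk => by simp [hk]) ?_ ?_
  · have := congrFun key i
    simpa [hi] using this
  · rw [← Finset.sum_subset (Finset.subset_univ A) (fun k _ hk => by simp [hk]),
      ← Finset.sum_coe_sort A]
    simpa [Finset.sum_ite_mem, -Finset.univ_eq_attach] using hw
  · rw [← Finset.sum_subset (Finset.subset_univ A) (fun k _ hk => by simp [hk]),
      ← Finset.sum_coe_sort A]
    simpa [Finset.sum_ite_mem, ite_smul, -Finset.univ_eq_attach] using hwφ

theorem AffIndepOn.exists_functional {φ : ι → Fin d → ℝ} {A : Finset ι} (h : AffIndepOn φ A)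
    (g : ι → ℝ) :
    ∃ (ℓ : (Fin d → ℝ) →ₗ[ℝ] ℝ) (c : ℝ), ∀ i ∈ A, ℓ (φ i) = g i + c := by
  classical
  let Φ : (A → ℝ) →ₗ[ℝ] (Fin d → ℝ) × ℝ := Fintype.linearCombination ℝ fun i : A => (φ i, (1 : ℝ))
  have hker : LinearMap.ker Φ = ⊥ := by
    rw [LinearMap.ker_eq_bot']
    intro c hc
    have h1 : ∑ i : A, c i • φ i = 0 := by
      simpa [Φ, Fintype.linearCombination_apply, Prod.fst_sum] using congrArg Prod.fst hc
    have h2 : ∑ i : A, c i = 0 := by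
      simpa [Φ, Fintype.linearCombination_apply, Prod.snd_sum] using congrArg Prod.snd hc
    funext i
    exact affineIndependent_iff.1 h.affineIndependent Finset.univ c h2 h1 i (Finset.mem_univ _)
  obtain ⟨G, hG⟩ := Φ.exists_leftInverse_of_injective hker
  let F : (Fin d → ℝ) × ℝ →ₗ[ℝ] ℝ := (Fintype.linearCombination ℝ fun i : A => g i) ∘ₗ G
  refine ⟨F ∘ₗ LinearMap.inl ℝ _ _, -F (0, 1), fun i hi => ?_⟩
  have h1 : F (φ i, 1) = g i := by
    have h2 : Φ (Pi.single ⟨i, hi⟩ 1) = (φ i, 1) := by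
      simp [Φ, Fintype.linearCombination_apply, Pi.single_apply]
    have h3 : G (φ i, 1) = Pi.single ⟨i, hi⟩ 1 := by
      rw [← h2]; exact LinearMap.congr_fun hG _
    simp [F, h3, Fintype.linearCombination_apply, Pi.single_apply]
  have h4 : F (φ i, 1) = F (φ i, 0) + F (0, 1) := by rw [← map_add]; simp
  simp only [LinearMap.comp_apply, LinearMap.inl_apply]
  linarith

theorem AffIndepOn.isIntegralSimplex {φ : ι → Fin d → ℝ} {A : Finset ι} (h : AffIndepOn φ A)
    (hA : A.Nonempty) (hφ : ∀ i, IsLatticePt (φ i)) :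
    IsIntegralSimplex (convexHull ℝ (φ '' (A : Set ι))) := by
  classical
  refine ⟨A.image φ, hA.image φ, ?_, ?_, by simp⟩
  · intro v hv
    obtain ⟨i, -, rfl⟩ := Finset.mem_image.1 hv
    exact hφ i
  · have := h.affineIndependent.range
    have e : Set.range (fun i : A => φ i) = ((A.image φ : Finset _) : Set (Fin d → ℝ)) := by
      ext; simp
    rwa [e] at this

theorem AffIndepOn.extremePoints {φ : ι → Fin d → ℝ} {A : Finset ι} (h : AffIndepOn φ A) :
    (convexHull ℝ (φ '' (A : Set ι))).extremePoints ℝ = φ '' (A : Set ι) := by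
  classical
  refine extremePoints_convexHull_subset.antisymm ?_
  rintro _ ⟨i, hi, rfl⟩
  rw [mem_extremePoints_iff_left]
  refine ⟨subset_convexHull ℝ _ ⟨i, hi, rfl⟩, fun x hx y hy hxy => ?_⟩
  obtain ⟨w, hw⟩ := (mem_convexHull_image_iff _ _ _).1 hx
  obtain ⟨w', hw'⟩ := (mem_convexHull_image_iff _ _ _).1 hy
  obtain ⟨a, b, ha, hb, hab, e⟩ := hxy
  have h1 : IsConvComb φ A (fun j => a * w j + b * w' j) (φ i) := by
    refine ⟨fun i => ?_, fun i hi => ?_, ?_, ?_⟩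
    · have := hw.nonneg i; have := hw'.nonneg i; positivity
    · simp [hw.supp i hi, hw'.supp i hi]
    · simp [Finset.sum_add_distrib, ← Finset.mul_sum, hw.sum_eq, hw'.sum_eq, hab]
    · simp [add_smul, mul_smul, Finset.sum_add_distrib, ← Finset.smul_sum, hw.comb, hw'.comb, e]
  have h2 : IsConvComb φ A (Pi.single i 1) (φ i) := by
    refine ⟨fun j => ?_, fun j hj => ?_, by simp, by simp [Pi.single_apply]⟩
    · by_cases h : j = i <;> simp [h]
    · have : j ≠ i := by rintro rfl; exact hj hi
      simp [this]
  have h3 := h.unique h1 h2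
  have h4 : ∀ j, j ≠ i → w j = 0 := by
    intro j hj
    have h5 := congrFun h3 j
    simp only [Pi.single_apply, hj, if_false] at h5
    have := mul_nonneg ha.le (hw.nonneg j)
    have := mul_nonneg hb.le (hw'.nonneg j)
    have h6 : a * w j = 0 := by linarith
    exact (mul_eq_zero.1 h6).resolve_left ha.ne'
  have h7 : w i = 1 := by
    rw [← hw.sum_eq]
    exact (Finset.sum_eq_single i (fun j _ hj => h4 j hj) (by simp)).symm
  rw [← hw.comb, Finset.sum_eq_single i (fun j _ hj => by simp [h4 j hj]) (by simp), h7, one_smul]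

/-- A face of the convex hull of finitely many points is spanned by a subset of these points. -/
theorem IsFaceOf.exists_subset {φ : ι → Fin d → ℝ} {A : Finset ι} {F : Set (Fin d → ℝ)}
    (hF : IsFaceOf F (convexHull ℝ (φ '' (A : Set ι)))) :
    ∃ B ⊆ A, B.Nonempty ∧ F = convexHull ℝ (φ '' (B : Set ι)) := by
  classical
  obtain ⟨⟨x₀, hx₀⟩, ℓ, rfl⟩ := hF
  obtain ⟨hx₀, hmax⟩ := hx₀
  have hle : ∀ i ∈ A, ℓ (φ i) ≤ ℓ x₀ := fun i hi => hmax _ (subset_convexHull ℝ _ ⟨i, hi, rfl⟩)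
  have hval : ∀ w x, IsConvComb φ A w x → ℓ x₀ - ℓ x = ∑ i, w i * (ℓ x₀ - ℓ (φ i)) := by
    intro w x hw
    simp only [mul_sub, Finset.sum_sub_distrib, ← Finset.sum_mul, hw.sum_eq, one_mul]
    rw [← hw.comb]; simp
  have hnn : ∀ w x, IsConvComb φ A w x → ∀ i, 0 ≤ w i * (ℓ x₀ - ℓ (φ i)) := by
    intro w x hw i
    by_cases hi : i ∈ A
    · exact mul_nonneg (hw.nonneg i) (sub_nonneg.2 (hle i hi))
    · simp [hw.supp i hi]
  have hsub : ∀ x, x ∈ {x ∈ convexHull ℝ (φ '' (A : Set ι)) |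
      ∀ y ∈ convexHull ℝ (φ '' (A : Set ι)), ℓ y ≤ ℓ x} →
      x ∈ convexHull ℝ (φ '' ((A.filter fun i => ℓ (φ i) = ℓ x₀ : Finset ι) : Set ι)) := by
    rintro x ⟨hx, hxmax⟩
    obtain ⟨w, hw⟩ := (mem_convexHull_image_iff _ _ _).1 hx
    refine (mem_convexHull_image_iff _ _ _).2 ⟨w, hw.mono fun i hi => ?_⟩
    by_cases hiA : i ∈ A
    · have h0 : ∑ i, w i * (ℓ x₀ - ℓ (φ i)) = 0 := by
        rw [← hval w x hw, sub_eq_zero]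
        exact le_antisymm (hxmax _ hx₀) (hmax _ hx)
      have h1 := (Finset.sum_eq_zero_iff_of_nonneg fun i _ => hnn w x hw i).1 h0 i
        (Finset.mem_univ _)
      refine (mul_eq_zero.1 h1).resolve_right fun h2 => hi ?_
      simp [hiA, (sub_eq_zero.1 h2)]
    · exact hw.supp i hiA
  refine ⟨A.filter fun i => ℓ (φ i) = ℓ x₀, Finset.filter_subset _ _, ?_, ?_⟩
  · by_contra hne
    rw [Finset.not_nonempty_iff_eq_empty] at hne
    have := hsub x₀ ⟨hx₀, hmax⟩
    simp [hne] at this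
  · refine Set.Subset.antisymm hsub fun x hx => ?_
    obtain ⟨w, hw⟩ := (mem_convexHull_image_iff _ _ _).1 hx
    have hwA : IsConvComb φ A w x := hw.mono fun i hi => hw.supp i (by simp [hi])
    have h0 : ℓ x₀ - ℓ x = 0 := by
      rw [hval w x hwA]
      refine Finset.sum_eq_zero fun i _ => ?_
      by_cases hi : i ∈ A.filter fun i => ℓ (φ i) = ℓ x₀
      · simp [(Finset.mem_filter.1 hi).2]
      · simp [hw.supp i hi]
    refine ⟨(mem_convexHull_image_iff _ _ _).2 ⟨w, hwA⟩, fun y hy => ?_⟩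
    rw [← sub_eq_zero.1 h0]
    exact hmax y hy

theorem AffIndepOn.isFaceOf {φ : ι → Fin d → ℝ} {A B : Finset ι} (h : AffIndepOn φ A)
    (hBA : B ⊆ A) (hB : B.Nonempty) :
    IsFaceOf (convexHull ℝ (φ '' (B : Set ι))) (convexHull ℝ (φ '' (A : Set ι))) := by
  classical
  obtain ⟨ℓ, c, hℓ⟩ := h.exists_functional fun i => if i ∈ B then 0 else -1
  have hval : ∀ w x, IsConvComb φ A w x → ℓ x = c - ∑ i, w i * (if i ∈ B then 0 else 1) := by
    intro w x hw
    have : c = ∑ i, w i * c := by rw [← Finset.sum_mul, hw.sum_eq, one_mul]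
    rw [← hw.comb, map_sum, this, ← Finset.sum_sub_distrib]
    refine Finset.sum_congr rfl fun i _ => ?_
    by_cases hi : i ∈ A
    · rw [map_smul, hℓ i hi]
      split_ifs <;> simp
      ring
    · simp [hw.supp i hi]
  have hnn : ∀ w x, IsConvComb φ A w x → ∀ i, 0 ≤ w i * (if i ∈ B then (0 : ℝ) else 1) := by
    intro w x hw i
    have := hw.nonneg i
    split_ifs <;> simp [this]
  have hBval : ∀ y ∈ convexHull ℝ (φ '' (B : Set ι)), ℓ y = c := by
    intro y hy
    obtain ⟨w, hw⟩ := (mem_convexHull_image_iff _ _ _).1 hy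
    rw [hval w y (hw.mono fun i hi => hw.supp i fun hB => hi (hBA hB)),
      Finset.sum_eq_zero, sub_zero]
    intro i _
    by_cases hi : i ∈ B
    · simp [hi]
    · simp [hw.supp i hi]
  refine ⟨?_, ℓ, ?_⟩
  · simpa using hB
  · ext x
    constructor
    · intro hx
      refine ⟨convexHull_mono (Set.image_mono hBA) hx, fun y hy => ?_⟩
      obtain ⟨w, hw⟩ := (mem_convexHull_image_iff _ _ _).1 hy
      rw [hBval x hx, hval w y hw]
      have := Finset.sum_nonneg fun i (_ : i ∈ Finset.univ) => hnn w y hw i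
      linarith
    · rintro ⟨hx, hmax⟩
      obtain ⟨w, hw⟩ := (mem_convexHull_image_iff _ _ _).1 hx
      obtain ⟨b, hb⟩ := hB
      have hbB : φ b ∈ convexHull ℝ (φ '' (B : Set ι)) := subset_convexHull ℝ _ ⟨b, hb, rfl⟩
      have h1 := hmax (φ b) (convexHull_mono (Set.image_mono hBA) hbB)
      rw [hBval _ hbB, hval w x hw] at h1
      have h0 : ∑ i, w i * (if i ∈ B then (0 : ℝ) else 1) = 0 :=
        le_antisymm (by linarith) (Finset.sum_nonneg fun i _ => hnn w x hw i)
      refine (mem_convexHull_image_iff _ _ _).2 ⟨w, hw.mono fun i hi => ?_⟩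
      have := (Finset.sum_eq_zero_iff_of_nonneg fun i _ => hnn w x hw i).1 h0 i (Finset.mem_univ _)
      simpa [hi] using this

/-- A finite abstract simplicial complex, realized so that every point has at most one
representation supported on a simplex, gives a triangulation. -/
theorem isTriangulation_of_unique (φ : ι → Fin d → ℝ) (K : Set (Finset ι))
    (down : ∀ A ∈ K, ∀ B ⊆ A, B ∈ K) (indep : ∀ A ∈ K, AffIndepOn φ A)
    (uniq : ∀ A ∈ K, ∀ A' ∈ K, ∀ w w' x, IsConvComb φ A w x → IsConvComb φ A' w' x → w = w')
    (Q : Set (Fin d → ℝ)) (hQ : ∀ x, x ∈ Q ↔ ∃ A ∈ K, ∃ w, IsConvComb φ A w x) :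
    IsTriangulation {P | ∃ A ∈ K, A.Nonempty ∧ P = convexHull ℝ (φ '' (A : Set ι))} Q := by
  classical
  refine ⟨?_, ?_, ?_, ?_, ?_⟩
  · refine (Set.toFinite (Set.range fun A : Finset ι => convexHull ℝ (φ '' (A : Set ι)))).subset ?_
    rintro _ ⟨A, -, -, rfl⟩
    exact ⟨A, rfl⟩
  · rintro _ ⟨A, hA, hne, rfl⟩
    refine ⟨A.image φ, hne.image φ, ?_, by simp⟩
    have e : Set.range (fun i : A => φ i) = ((A.image φ : Finset _) : Set (Fin d → ℝ)) := by
      ext; simp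
    have := (indep A hA).affineIndependent.range
    rwa [e] at this
  · ext x
    rw [hQ]
    constructor
    · rintro ⟨_, ⟨A, hA, -, rfl⟩, hx⟩
      exact ⟨A, hA, (mem_convexHull_image_iff _ _ _).1 hx⟩
    · rintro ⟨A, hA, w, hw⟩
      have hx := (mem_convexHull_image_iff _ _ _).2 ⟨w, hw⟩
      refine ⟨_, ⟨A, hA, ?_, rfl⟩, hx⟩
      simpa using (convexHull_nonempty_iff (𝕜 := ℝ)).1 ⟨x, hx⟩
  · rintro _ ⟨A, hA, -, rfl⟩ F hF
    obtain ⟨B, hBA, hB, rfl⟩ := hF.exists_subset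
    exact ⟨B, down A hA B hBA, hB, rfl⟩
  · rintro _ ⟨A, hA, -, rfl⟩ _ ⟨A', hA', -, rfl⟩
    have hinter : convexHull ℝ (φ '' (A : Set ι)) ∩ convexHull ℝ (φ '' (A' : Set ι)) =
        convexHull ℝ (φ '' ((A ∩ A' : Finset ι) : Set ι)) := by
      ext x
      constructor
      · rintro ⟨h1, h2⟩
        obtain ⟨w, hw⟩ := (mem_convexHull_image_iff _ _ _).1 h1
        obtain ⟨w', hw'⟩ := (mem_convexHull_image_iff _ _ _).1 h2
        obtain rfl := uniq A hA A' hA' w w' x hw hw'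
        refine (mem_convexHull_image_iff _ _ _).2 ⟨w, hw.mono fun i hi => ?_⟩
        rw [Finset.mem_inter, not_and_or] at hi
        exact hi.elim (hw.supp i) (hw'.supp i)
      · intro hx
        exact ⟨convexHull_mono (Set.image_mono (by simp)) hx,
          convexHull_mono (Set.image_mono (by simp)) hx⟩
    rw [hinter]
    rcases (A ∩ A').eq_empty_or_nonempty with h | h
    · left; simp [h]
    · exact Or.inr ⟨(indep A hA).isFaceOf Finset.inter_subset_left h,
        (indep A' hA').isFaceOf Finset.inter_subset_right h⟩

end Complexes

section Optimal

open Filter Topology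

variable {ι : Type*} [Fintype ι] {E : Type*} [NormedAddCommGroup E] [NormedSpace ℝ E]

/-- Every nonnegative combination supported on `A` has least `ω`-cost among the nonnegative
combinations with the same mass and moment. -/
def IsOptimal (e : ι → E) (ω : ι → ℝ) (A : Finset ι) : Prop :=
  ∀ w μ : ι → ℝ, (∀ i, 0 ≤ w i) → (∀ i, i ∉ A → w i = 0) → (∀ i, 0 ≤ μ i) →
    ∑ i, μ i = ∑ i, w i → ∑ i, μ i • e i = ∑ i, w i • e i →
    ∑ i, w i * ω i ≤ ∑ i, μ i * ω i

theorem IsOptimal.mono {e : ι → E} {ω : ι → ℝ} {A B : Finset ι} (h : IsOptimal e ω A)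
    (hBA : B ⊆ A) : IsOptimal e ω B :=
  fun w μ hw hs => h w μ hw fun i hi => hs i fun hB => hi (hBA hB)

theorem IsOptimal.exchange {e : ι → E} {ω : ι → ℝ} {A : Finset ι} (h : IsOptimal e ω A)
    {a b a' b' : ι} (ha : a ∈ A) (hb : b ∈ A) (hab : e a' + e b' = e a + e b) :
    ω a + ω b ≤ ω a' + ω b' := by
  classical
  have key := h (Pi.single a 1 + Pi.single b 1) (Pi.single a' 1 + Pi.single b' 1)
    (fun i => ?_) (fun i hi => ?_) (fun i => ?_) ?_ ?_
  · simpa [add_mul, Finset.sum_add_distrib, Pi.single_apply] using key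
  · exact add_nonneg (by by_cases h : i = a <;> simp [h])
      (by by_cases h : i = b <;> simp [h])
  · have h1 : i ≠ a := by rintro rfl; exact hi ha
    have h2 : i ≠ b := by rintro rfl; exact hi hb
    simp [h1, h2]
  · exact add_nonneg (by by_cases h : i = a' <;> simp [h])
      (by by_cases h : i = b' <;> simp [h])
  · simp [Finset.sum_add_distrib]
  · simpa [add_smul, Finset.sum_add_distrib, Pi.single_apply] using hab

open Classical in
theorem isOptimal_support {e : ι → E} {ω : ι → ℝ} {w : ι → ℝ} (hw : ∀ i, 0 ≤ w i)
    (hmin : ∀ μ : ι → ℝ, (∀ i, 0 ≤ μ i) → ∑ i, μ i = ∑ i, w i →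
      ∑ i, μ i • e i = ∑ i, w i • e i → ∑ i, w i * ω i ≤ ∑ i, μ i * ω i) :
    IsOptimal e ω (Finset.univ.filter fun i => w i ≠ 0) := by
  intro v μ hv hs hμ hsum hmom
  have hev : ∀ᶠ ε : ℝ in 𝓝[>] 0, ∀ i, ε * v i ≤ w i := by
    rw [eventually_all]
    intro i
    by_cases hi : w i = 0
    · have : v i = 0 := hs i (by simp [hi])
      simp [this, hi]
    · have hpos : 0 < w i := lt_of_le_of_ne (hw i) (Ne.symm hi)
      have ht : Tendsto (fun ε : ℝ => ε * v i) (𝓝[>] 0) (𝓝 (0 * v i)) :=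
        ((continuous_id.mul continuous_const).tendsto 0).mono_left nhdsWithin_le_nhds
      rw [zero_mul] at ht
      exact (ht.eventually (gt_mem_nhds hpos)).mono fun _ h => le_of_lt h
  obtain ⟨ε, hε, hεpos⟩ := (hev.and self_mem_nhdsWithin).exists
  have hεpos : 0 < ε := hεpos
  have key := hmin (fun i => w i - ε * v i + ε * μ i)
    (fun i => add_nonneg (sub_nonneg.2 (hε i)) (mul_nonneg hεpos.le (hμ i))) ?_ ?_
  · have e1 : ∑ i, (w i - ε * v i + ε * μ i) * ω i =
        ∑ i, w i * ω i - ε * ∑ i, v i * ω i + ε * ∑ i, μ i * ω i := by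
      rw [Finset.mul_sum, Finset.mul_sum, ← Finset.sum_sub_distrib, ← Finset.sum_add_distrib]
      exact Finset.sum_congr rfl fun i _ => by ring
    rw [e1] at key
    have : ε * ∑ i, v i * ω i ≤ ε * ∑ i, μ i * ω i := by linarith
    exact le_of_mul_le_mul_left this hεpos
  · simp [Finset.sum_add_distrib, Finset.sum_sub_distrib, ← Finset.mul_sum, hsum]
  · simp [add_smul, sub_smul, mul_smul, Finset.sum_add_distrib, Finset.sum_sub_distrib,
      ← Finset.smul_sum, hmom]

theorem exists_isOptimal (e : ι → E) (ω : ι → ℝ) {w₀ : ι → ℝ} (hw₀ : ∀ i, 0 ≤ w₀ i) :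
    ∃ (w : ι → ℝ) (A : Finset ι), IsOptimal e ω A ∧ (∀ i, 0 ≤ w i) ∧ (∀ i, i ∉ A → w i = 0) ∧
      ∑ i, w i = ∑ i, w₀ i ∧ ∑ i, w i • e i = ∑ i, w₀ i • e i := by
  classical
  let C : Set (ι → ℝ) := {w | (∀ i, 0 ≤ w i) ∧ ∑ i, w i = ∑ i, w₀ i ∧
    ∑ i, w i • e i = ∑ i, w₀ i • e i}
  have hclosed : IsClosed C := by
    refine IsClosed.inter (s₁ := {w : ι → ℝ | ∀ i, 0 ≤ w i}) ?_ (IsClosed.inter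
      (s₁ := {w : ι → ℝ | ∑ i, w i = ∑ i, w₀ i})
      (s₂ := {w : ι → ℝ | ∑ i, w i • e i = ∑ i, w₀ i • e i}) ?_ ?_)
    · rw [Set.ofPred_forall]
      exact isClosed_iInter fun i => isClosed_le continuous_const (continuous_apply i)
    · exact isClosed_eq (by fun_prop) continuous_const
    · exact isClosed_eq (by fun_prop) continuous_const
  have hsub : C ⊆ Set.Icc 0 (fun _ => ∑ i, w₀ i) := by
    rintro w ⟨h0, h1, -⟩
    refine ⟨h0, fun i => ?_⟩
    rw [← h1]
    exact Finset.single_le_sum (fun j _ => h0 j) (Finset.mem_univ i)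
  have hcomp : IsCompact C := isCompact_Icc.of_isClosed_subset hclosed hsub
  obtain ⟨w, ⟨hw, hs, hm⟩, hmin⟩ := hcomp.exists_isMinOn ⟨w₀, hw₀, rfl, rfl⟩
    (f := fun w => ∑ i, w i * ω i) (by fun_prop)
  refine ⟨w, _, isOptimal_support hw fun μ hμ h1 h2 => hmin ⟨hμ, h1.trans hs, h2.trans hm⟩,
    hw, fun i hi => by simpa using hi, hs, hm⟩

theorem IsOptimal.unique {e : ι → E} {ω : ι → ℝ} {A A' : Finset ι} (hA : IsOptimal e ω A)
    (hA' : IsOptimal e ω A') (indep : ∀ B, IsOptimal e ω B → AffIndepOn e B) {w w' : ι → ℝ} {x : E}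
    (hw : IsConvComb e A w x) (hw' : IsConvComb e A' w' x) : w = w' := by
  classical
  have hopt := isOptimal_support (e := e) (ω := ω) (w := w + w')
    (fun i => add_nonneg (hw.nonneg i) (hw'.nonneg i)) (fun μ hμ h1 h2 => by
      simp only [Pi.add_apply, Finset.sum_add_distrib, add_smul, hw.sum_eq, hw'.sum_eq, hw.comb,
        hw'.comb] at h1 h2
      have hh : ∀ B v, IsOptimal e ω B → IsConvComb e B v x →
          ∑ i, v i * ω i ≤ (1 / 2) * ∑ i, μ i * ω i := by
        intro B v hB hv
        have := hB v (fun i => (1 / 2) * μ i) hv.nonneg hv.supp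
          (fun i => mul_nonneg (by norm_num) (hμ i))
          (by rw [← Finset.mul_sum, h1, hv.sum_eq]; norm_num)
          (by simp only [mul_smul]; rw [← Finset.smul_sum, h2, hv.comb, ← two_smul ℝ x, smul_smul]
              norm_num)
        simpa only [Finset.mul_sum, mul_assoc] using this
      have k1 := hh A w hA hw
      have k2 := hh A' w' hA' hw'
      simp only [Pi.add_apply, add_mul, Finset.sum_add_distrib]
      linarith)
  refine sub_eq_zero.1 (indep _ hopt (w - w') (fun i hi => ?_) ?_ ?_)
  · have h0 : w i + w' i = 0 := by simpa using hi
    have h1 := hw.nonneg i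
    have h2 := hw'.nonneg i
    rw [Pi.sub_apply]
    linarith
  · simp [hw.sum_eq, hw'.sum_eq]
  · simp [sub_smul, hw.comb, hw'.comb]

end Optimal

section LatticePoints

/-- The lattice points `(t, s)` of a weighted simplex: `t ≥ 0` and `0 = s₀ ≤ s₁ ≤ ⋯`, where the
last entry of `s` is `N - h t`. -/
def weightedPts (d h N : ℕ) : Set (ℤ × (Fin (d + 2) → ℤ)) :=
  {p | 0 ≤ p.1 ∧ p.2 0 = 0 ∧ Monotone p.2 ∧ p.2 (Fin.last _) + h * p.1 = N}

theorem weightedPts_finite {d h N : ℕ} (hh : 0 < h) : (weightedPts d h N).Finite := by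
  classical
  refine (Set.finite_Icc ((0 : ℤ), (0 : Fin (d + 2) → ℤ)) ((N : ℤ), fun _ => (N : ℤ))).subset ?_
  rintro ⟨t, s⟩ ⟨ht, h0, hm, hl⟩
  simp only at ht h0 hm hl
  have hpos : ∀ j, 0 ≤ s j := fun j => h0 ▸ hm (Fin.zero_le j)
  have hh' : (1 : ℤ) ≤ h := by exact_mod_cast hh
  refine ⟨⟨ht, hpos⟩, ?_, fun j => (hm (Fin.le_last j)).trans ?_⟩
  · have := hpos (Fin.last _)
    change t ≤ N
    nlinarith
  · change _ ≤ (N : ℤ)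
    nlinarith

/-- The embedding of the lattice points into a real vector space. -/
def realPt {d : ℕ} (p : ℤ × (Fin (d + 2) → ℤ)) : ℝ × (Fin (d + 2) → ℝ) :=
  (p.1, fun j => p.2 j)

theorem realPt_add {d : ℕ} (p q : ℤ × (Fin (d + 2) → ℤ)) :
    realPt (p + q) = realPt p + realPt q := by
  ext <;> simp [realPt]

theorem exists_levels_closer {d h N : ℕ} {a b : ℤ × (Fin (d + 2) → ℤ)}
    (ha : a ∈ weightedPts d h N) (hb : b ∈ weightedPts d h N) (hab : a.1 + 2 ≤ b.1) :
    ∃ a' ∈ weightedPts d h N, ∃ b' ∈ weightedPts d h N, a' + b' = a + b ∧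
      a'.1 = a.1 + 1 ∧ b'.1 = b.1 - 1 := by
  obtain ⟨ha0, haz, ham, hal⟩ := ha
  obtain ⟨hb0, hbz, hbm, hbl⟩ := hb
  have hbpos : 0 ≤ b.2 (Fin.last _) := hbz ▸ hbm (Fin.zero_le _)
  set c : ℤ := a.2 (Fin.last _) - h with hc
  have hc0 : 0 ≤ c := by nlinarith
  refine ⟨(a.1 + 1, fun j => min (a.2 j) c), ⟨by simp; omega, by simp [haz, hc0], ?_, ?_⟩,
    (b.1 - 1, fun j => b.2 j + max (a.2 j - c) 0), ⟨by simp; omega, by simp [hbz, haz, hc0], ?_, ?_⟩,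
    ?_, rfl, rfl⟩
  · intro i j hij
    have := ham hij
    dsimp only
    omega
  · have : min (a.2 (Fin.last _)) c = a.2 (Fin.last _) - h := by omega
    dsimp only
    rw [this]
    linarith
  · intro i j hij
    have := ham hij
    have := hbm hij
    dsimp only
    omega
  · have : max (a.2 (Fin.last _) - c) 0 = h := by omega
    dsimp only
    rw [this]
    linarith
  · ext j
    · simp
    · simp
      omega

/-- The second component of the second summand in the balanced decomposition of `a + b`. -/
def balanced {d : ℕ} (a b : ℤ × (Fin (d + 2) → ℤ)) : Fin (d + 2) → ℤ :=
  fun j => min (b.2 (Fin.last _)) ((a.2 j + b.2 j + 1) / 2)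

theorem balanced_mem {d h N : ℕ} {a b : ℤ × (Fin (d + 2) → ℤ)}
    (ha : a ∈ weightedPts d h N) (hb : b ∈ weightedPts d h N) (hab : a.1 ≤ b.1) :
    (a.1, a.2 + b.2 - balanced a b) ∈ weightedPts d h N ∧
      (b.1, balanced a b) ∈ weightedPts d h N := by
  obtain ⟨ha0, haz, ham, hal⟩ := ha
  obtain ⟨hb0, hbz, hbm, hbl⟩ := hb
  have hbpos : 0 ≤ b.2 (Fin.last _) := hbz ▸ hbm (Fin.zero_le _)
  have hle : b.2 (Fin.last _) ≤ a.2 (Fin.last _) := by nlinarith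
  have hlast : balanced a b (Fin.last _) = b.2 (Fin.last _) := by
    simp only [balanced]; omega
  have hzero : balanced a b 0 = 0 := by
    simp only [balanced, haz, hbz]; omega
  refine ⟨⟨ha0, by simp [haz, hbz, hzero], ?_, ?_⟩, ⟨hb0, hzero, ?_, ?_⟩⟩
  · intro i j hij
    have := ham hij
    have := hbm hij
    simp only [Pi.sub_apply, Pi.add_apply, balanced]
    omega
  · simp [hlast, hal]
  · intro i j hij
    have := ham hij
    have := hbm hij
    simp only [balanced]
    omega
  · simp [hlast, hbl]

theorem exists_lex_weight {ι : Type*} [Finite ι] (p₁ p₂ p₃ : ι → ℤ) :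
    ∃ ω : ι → ℝ, ∀ a b a' b', ω a + ω b ≤ ω a' + ω b' →
      p₁ a + p₁ b ≤ p₁ a' + p₁ b' ∧
      (p₁ a + p₁ b = p₁ a' + p₁ b' → p₂ a + p₂ b ≤ p₂ a' + p₂ b' ∧
        (p₂ a + p₂ b = p₂ a' + p₂ b' → p₃ a + p₃ b ≤ p₃ a' + p₃ b')) := by
  obtain ⟨D₂, hD₂⟩ := (Set.finite_range fun i => |p₂ i|).bddAbove
  obtain ⟨D₃, hD₃⟩ := (Set.finite_range fun i => |p₃ i|).bddAbove
  set D := max D₂ D₃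
  have h₂ : ∀ i, |p₂ i| ≤ D := fun i => (hD₂ ⟨i, rfl⟩).trans (le_max_left _ _)
  have h₃ : ∀ i, |p₃ i| ≤ D := fun i => (hD₃ ⟨i, rfl⟩).trans (le_max_right _ _)
  set M := 4 * D + 2 with hM
  refine ⟨fun i => ((M ^ 2 * p₁ i + M * p₂ i + p₃ i : ℤ) : ℝ), fun a b a' b' h => ?_⟩
  beta_reduce at h
  have h : (M ^ 2 * p₁ a + M * p₂ a + p₃ a) + (M ^ 2 * p₁ b + M * p₂ b + p₃ b) ≤
      (M ^ 2 * p₁ a' + M * p₂ a' + p₃ a') + (M ^ 2 * p₁ b' + M * p₂ b' + p₃ b') := by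
    exact_mod_cast h
  have a2 := abs_le.1 (h₂ a); have b2 := abs_le.1 (h₂ b)
  have a2' := abs_le.1 (h₂ a'); have b2' := abs_le.1 (h₂ b')
  have a3 := abs_le.1 (h₃ a); have b3 := abs_le.1 (h₃ b)
  have a3' := abs_le.1 (h₃ a'); have b3' := abs_le.1 (h₃ b')
  have hD : 0 ≤ D := (abs_nonneg _).trans (h₂ a)
  set u₁ := p₁ a + p₁ b - (p₁ a' + p₁ b') with hu₁
  set u₂ := p₂ a + p₂ b - (p₂ a' + p₂ b') with hu₂
  set u₃ := p₃ a + p₃ b - (p₃ a' + p₃ b') with hu₃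
  have hu : M ^ 2 * u₁ + M * u₂ + u₃ ≤ 0 := by rw [hu₁, hu₂, hu₃]; linarith
  have l2 : -(4 * D) ≤ u₂ := by rw [hu₂]; linarith
  have l3 : -(4 * D) ≤ u₃ := by rw [hu₃]; linarith
  have hM0 : 0 < M := by linarith
  have c1 : u₁ ≤ 0 := by
    by_contra hpos
    have hpos : 1 ≤ u₁ := by omega
    nlinarith [mul_le_mul_of_nonneg_left hpos (sq_nonneg M), mul_le_mul_of_nonneg_left l2 hM0.le]
  refine ⟨by linarith, fun e1 => ?_⟩
  have e1 : u₁ = 0 := by rw [hu₁]; linarith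
  have c2 : u₂ ≤ 0 := by
    by_contra hpos
    have hpos : 1 ≤ u₂ := by omega
    rw [e1] at hu
    nlinarith
  refine ⟨by linarith, fun e2 => ?_⟩
  have e2 : u₂ = 0 := by rw [hu₂]; linarith
  rw [e1, e2] at hu
  linarith

/-- Compatibility conditions satisfied by the vertices of a single simplex. -/
structure IsAlcoveChain {d : ℕ} (A : Set (ℤ × (Fin (d + 2) → ℤ))) : Prop where
  level : ∀ a ∈ A, ∀ b ∈ A, b.1 ≤ a.1 + 1
  same : ∀ a ∈ A, ∀ b ∈ A, a.1 = b.1 →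
    (∀ j, a.2 j ≤ b.2 j ∧ b.2 j ≤ a.2 j + 1) ∨ (∀ j, b.2 j ≤ a.2 j ∧ a.2 j ≤ b.2 j + 1)
  cross : ∀ a ∈ A, ∀ b ∈ A, b.1 = a.1 + 1 → ∀ j,
    (a.2 j ≤ b.2 j ∧ b.2 j ≤ a.2 j + 1) ∨
      (b.2 j = b.2 (Fin.last _) ∧ b.2 (Fin.last _) ≤ a.2 j)

/-- The quadratic component of the lexicographic weight. -/
def quadWeight {d : ℕ} (p : ℤ × (Fin (d + 2) → ℤ)) : ℤ := ∑ j, (2 * p.2 j ^ 2 - p.1 * p.2 j)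

theorem quadWeight_term {a b n t : ℤ} (hb : b ≤ n) (ε : ℤ) (hε : ε = 0 ∨ ε = 1) :
    let b' := min n ((a + b + 1) / 2)
    2 * (a + b - b') ^ 2 - t * (a + b - b') + (2 * b' ^ 2 - (t + ε) * b') ≤
      2 * a ^ 2 - t * a + (2 * b ^ 2 - (t + ε) * b) ∧
    (2 * (a + b - b') ^ 2 - t * (a + b - b') + (2 * b' ^ 2 - (t + ε) * b') =
      2 * a ^ 2 - t * a + (2 * b ^ 2 - (t + ε) * b) → b = b' ∨ (ε = 0 ∧ a = b')) := by
  intro b'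
  have key : 2 * a ^ 2 - t * a + (2 * b ^ 2 - (t + ε) * b) -
      (2 * (a + b - b') ^ 2 - t * (a + b - b') + (2 * b' ^ 2 - (t + ε) * b')) =
      (b - b') * (4 * (b' - a) - ε) := by ring
  rcases lt_trichotomy b b' with h | h | h
  · have h1 : b' ≤ a := by omega
    rcases hε with rfl | rfl
    · refine ⟨by nlinarith, fun e => Or.inr ⟨rfl, ?_⟩⟩
      have : (b - b') * (4 * (b' - a) - 0) = 0 := by rw [← key, e, sub_self]
      rcases mul_eq_zero.1 this with h' | h' <;> omega
    · refine ⟨by nlinarith, fun e => Or.inl ?_⟩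
      have : (b - b') * (4 * (b' - a) - 1) = 0 := by rw [← key, e, sub_self]
      rcases mul_eq_zero.1 this with h' | h' <;> omega
  · exact ⟨by rw [← h]; ring_nf; rfl, fun _ => Or.inl h⟩
  · have h1 : a + 1 ≤ b' := by omega
    refine ⟨by rcases hε with rfl | rfl <;> nlinarith, fun e => Or.inl ?_⟩
    have : (b - b') * (4 * (b' - a) - ε) = 0 := by rw [← key, e, sub_self]
    rcases mul_eq_zero.1 this with h' | h' <;> omega

/-- The weight whose optimal sets are alcove chains. -/
theorem exists_chain_weight (d h N : ℕ) [Fintype (weightedPts d h N)] :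
    ∃ ω : weightedPts d h N → ℝ, ∀ A : Finset (weightedPts d h N),
      IsOptimal (fun p : weightedPts d h N => realPt (p : ℤ × (Fin (d + 2) → ℤ))) ω A →
      IsAlcoveChain (Subtype.val '' (A : Set (weightedPts d h N))) := by
  obtain ⟨ω, hω⟩ := exists_lex_weight (fun p : weightedPts d h N => p.1.1 ^ 2)
    (fun p => quadWeight p.1) (fun p => -(∑ j, p.1.2 j) ^ 2)
  refine ⟨ω, fun A hA => ?_⟩
  have exch : ∀ a b a' b' : weightedPts d h N, a ∈ A → b ∈ A →
      a'.1 + b'.1 = a.1 + b.1 → ω a + ω b ≤ ω a' + ω b' := by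
    intro a b a' b' ha hb hab
    exact hA.exchange ha hb (by rw [← realPt_add, ← realPt_add, hab])
  have bal : ∀ a b : weightedPts d h N, a ∈ A → b ∈ A → ∀ ε : ℤ, (ε = 0 ∨ ε = 1) →
      b.1.1 = a.1.1 + ε →
      (∀ j, b.1.2 j = balanced a.1 b.1 j ∨ (ε = 0 ∧ a.1.2 j = balanced a.1 b.1 j)) ∧
      -(∑ j, a.1.2 j) ^ 2 + -(∑ j, b.1.2 j) ^ 2 ≤
        -(∑ j, (a.1.2 j + b.1.2 j - balanced a.1 b.1 j)) ^ 2 +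
          -(∑ j, balanced a.1 b.1 j) ^ 2 := by
    intro a b ha hb ε hε hab
    obtain ⟨h1, h2⟩ := balanced_mem a.2 b.2 (by rcases hε with rfl | rfl <;> omega)
    obtain ⟨-, k⟩ := hω _ _ _ _ (exch a b ⟨_, h1⟩ ⟨_, h2⟩ ha hb
      (Prod.ext rfl (by ext j; simp)))
    obtain ⟨k2, k3⟩ := k rfl
    have term := fun j => quadWeight_term (t := a.1.1) (a := a.1.2 j)
      (b.2.2.2.1 (Fin.le_last j)) ε hε
    have hterm : ∀ j ∈ (Finset.univ : Finset (Fin (d + 2))),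
        2 * (a.1.2 + b.1.2 - balanced a.1 b.1) j ^ 2 -
            a.1.1 * (a.1.2 + b.1.2 - balanced a.1 b.1) j +
          (2 * balanced a.1 b.1 j ^ 2 - b.1.1 * balanced a.1 b.1 j) ≤
        2 * a.1.2 j ^ 2 - a.1.1 * a.1.2 j + (2 * b.1.2 j ^ 2 - b.1.1 * b.1.2 j) := by
      intro j _
      rw [hab]
      exact (term j).1
    have hsum := Finset.sum_le_sum hterm
    simp only [quadWeight, ← Finset.sum_add_distrib] at k2 k3
    have heq := le_antisymm hsum k2
    refine ⟨fun j => ?_, k3 heq.symm⟩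
    have := (Finset.sum_eq_sum_iff_of_le hterm).1 heq j (Finset.mem_univ _)
    rw [hab] at this
    exact (term j).2 this
  refine ⟨?_, ?_, ?_⟩
  · rintro _ ⟨a, ha, rfl⟩ _ ⟨b, hb, rfl⟩
    by_contra hlt
    obtain ⟨a', ha', b', hb', hsum, e1, e2⟩ := exists_levels_closer a.2 b.2 (by omega)
    obtain ⟨k, -⟩ := hω _ _ _ _ (exch a b ⟨a', ha'⟩ ⟨b', hb'⟩ ha hb hsum)
    simp only [e1, e2] at k
    nlinarith
  · rintro _ ⟨a, ha, rfl⟩ _ ⟨b, hb, rfl⟩ hab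
    obtain ⟨h1, h2⟩ := bal a b ha hb 0 (Or.inl rfl) (by omega)
    have hlast : b.1.2 (Fin.last _) = a.1.2 (Fin.last _) := by
      have := a.2.2.2.2; have := b.2.2.2.2
      rw [hab] at *
      linarith
    have hc : ∀ j, balanced a.1 b.1 j = (a.1.2 j + b.1.2 j + 1) / 2 := by
      intro j
      have := b.2.2.2.1 (Fin.le_last j)
      have := a.2.2.2.1 (Fin.le_last j)
      simp only [balanced]
      omega
    have h3 : ∀ j, (b.1.2 j = balanced a.1 b.1 j ∨ a.1.2 j = balanced a.1 b.1 j) ∧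
        0 ≤ 2 * balanced a.1 b.1 j - a.1.2 j - b.1.2 j ∧
        2 * balanced a.1 b.1 j - a.1.2 j - b.1.2 j ≤ 1 := by
      intro j
      have := hc j
      refine ⟨(h1 j).imp_right And.right, by omega, by omega⟩
    set X := ∑ j, (b.1.2 j - a.1.2 j) with hX
    set Y := ∑ j, (2 * balanced a.1 b.1 j - a.1.2 j - b.1.2 j) with hY
    have hXY : Y ^ 2 ≤ X ^ 2 := by
      simp only [Finset.sum_sub_distrib, Finset.sum_add_distrib, ← Finset.mul_sum] at hX hY h2
      rw [hX, hY]
      nlinarith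
    have le1 : ∀ j ∈ (Finset.univ : Finset (Fin (d + 2))),
        b.1.2 j - a.1.2 j ≤ 2 * balanced a.1 b.1 j - a.1.2 j - b.1.2 j := by
      intro j _
      have := h3 j
      omega
    have le2 : ∀ j ∈ (Finset.univ : Finset (Fin (d + 2))),
        -(b.1.2 j - a.1.2 j) ≤ 2 * balanced a.1 b.1 j - a.1.2 j - b.1.2 j := by
      intro j _
      have := h3 j
      omega
    have s1 : X ≤ Y := Finset.sum_le_sum le1
    have s2 : -X ≤ Y := by
      rw [hX, ← Finset.sum_neg_distrib]
      exact Finset.sum_le_sum le2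
    have : X = Y ∨ -X = Y := by
      rcases le_total 0 X with h0 | h0
      · left; nlinarith
      · right; nlinarith
    rcases this with e | e
    · left
      intro j
      have := (Finset.sum_eq_sum_iff_of_le le1).1 e j (Finset.mem_univ _)
      have := h3 j
      omega
    · right
      intro j
      rw [hX, ← Finset.sum_neg_distrib] at e
      have := (Finset.sum_eq_sum_iff_of_le le2).1 e j (Finset.mem_univ _)
      have := h3 j
      omega
  · rintro _ ⟨a, ha, rfl⟩ _ ⟨b, hb, rfl⟩ hab j
    obtain ⟨h1, -⟩ := bal a b ha hb 1 (Or.inr rfl) hab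
    have h2 := (h1 j).resolve_right (by simp)
    simp only [balanced] at h2
    omega

theorem IsAlcoveChain.mono {d : ℕ} {A B : Set (ℤ × (Fin (d + 2) → ℤ))} (h : IsAlcoveChain A)
    (hBA : B ⊆ A) : IsAlcoveChain B :=
  ⟨fun a ha b hb => h.level a (hBA ha) b (hBA hb), fun a ha b hb => h.same a (hBA ha) b (hBA hb),
    fun a ha b hb => h.cross a (hBA ha) b (hBA hb)⟩

/-- Some integral coordinate separates a vertex of an alcove chain from all other vertices by
exactly one. -/
theorem IsAlcoveChain.exists_peel {d h N : ℕ} {A : Finset (ℤ × (Fin (d + 2) → ℤ))}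
    (hA : IsAlcoveChain (A : Set (ℤ × (Fin (d + 2) → ℤ)))) (hne : A.Nonempty)
    (hmem : ∀ a ∈ A, a ∈ weightedPts d h N) :
    ∃ z ∈ A, (∀ a ∈ A, a ≠ z → z.1 = a.1 + 1) ∨ ∃ j, ∀ a ∈ A, a ≠ z → z.2 j = a.2 j + 1 := by
  classical
  have hcmp : ∀ a ∈ A, ∀ b ∈ A, a.1 = b.1 → ∑ j, a.2 j ≤ ∑ j, b.2 j →
      ∀ j, a.2 j ≤ b.2 j ∧ b.2 j ≤ a.2 j + 1 := by
    intro a ha b hb hab hs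
    rcases hA.same a ha b hb hab with h1 | h1
    · exact h1
    · intro j
      have e := (Finset.sum_eq_sum_iff_of_le fun j _ => (h1 j).1).1
        (le_antisymm (Finset.sum_le_sum fun j _ => (h1 j).1) hs) j (Finset.mem_univ _)
      omega
  obtain ⟨z, hz, hzmax⟩ := A.exists_max_image (fun a => toLex (a.1, ∑ j, a.2 j)) hne
  have hztop : ∀ a ∈ A, a.1 < z.1 ∨ a.1 = z.1 ∧ ∑ j, a.2 j ≤ ∑ j, z.2 j := by
    intro a ha
    simpa [Prod.Lex.le_iff] using hzmax a ha
  refine ⟨z, hz, ?_⟩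
  by_cases hB : ((A.erase z).filter fun a => a.1 = z.1).Nonempty
  · right
    obtain ⟨p, hp, hpmax⟩ := Finset.exists_max_image _ (fun a => ∑ j, a.2 j) hB
    simp only [Finset.mem_filter, Finset.mem_erase] at hp hpmax
    obtain ⟨⟨hpz, hpA⟩, hp1⟩ := hp
    have hpz' := hcmp p hpA z hz hp1 (by rcases hztop p hpA with h' | h'; omega; exact h'.2)
    obtain ⟨j, hj⟩ : ∃ j, z.2 j = p.2 j + 1 := by
      by_contra! hcon
      refine hpz (Prod.ext hp1 (funext fun j => ?_))
      have := hpz' j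
      have := hcon j
      omega
    refine ⟨j, fun a ha haz => ?_⟩
    rcases hztop a ha with hlt | ⟨ha1, has⟩
    · have hlev := hA.level a ha z hz
      have c1 := hA.cross a ha z hz (by omega) j
      have c2 := hA.cross a ha p hpA (by omega) j
      have m1 := (hmem z hz).2.2.1 (Fin.le_last j)
      have m2 := (hmem p hpA).2.2.1 (Fin.le_last j)
      have l1 := (hmem z hz).2.2.2
      have l2 := (hmem p hpA).2.2.2
      rw [hp1] at l2
      omega
    · have c1 := hcmp a ha z hz ha1 has j
      have c2 := hcmp a ha p hpA (by omega) (hpmax a ⟨⟨haz, ha⟩, ha1⟩) j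
      omega
  · left
    intro a ha haz
    rcases hztop a ha with hlt | ⟨ha1, -⟩
    · have := hA.level a ha z hz
      omega
    · exact absurd ⟨a, by simp [ha, haz, ha1]⟩ hB

end LatticePoints

section Unimodular

variable {d h N : ℕ} [Fintype (weightedPts d h N)]

/-- Alcove chains are unimodular: coefficients supported on an alcove chain are integral as soon as
the moments are. -/
theorem IsAlcoveChain.coeff_mem (A : Finset (weightedPts d h N)) :
    IsAlcoveChain (Subtype.val '' (A : Set (weightedPts d h N))) →
    ∀ c : weightedPts d h N → ℝ, (∀ p, p ∉ A → c p = 0) →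
    ∑ p, c p ∈ (Int.castRingHom ℝ).range →
    ∑ p, c p * (p.1.1 : ℝ) ∈ (Int.castRingHom ℝ).range →
    (∀ j, ∑ p, c p * (p.1.2 j : ℝ) ∈ (Int.castRingHom ℝ).range) →
    ∀ p, c p ∈ (Int.castRingHom ℝ).range := by
  classical
  induction A using Finset.strongInduction with
  | H A ih =>
    intro hA c hc h0 h1 h2 p
    rcases A.eq_empty_or_nonempty with rfl | hne
    · rw [hc p (by simp)]
      exact zero_mem _
    have hA' : IsAlcoveChain ((A.map (Function.Embedding.subtype _) :
        Finset (ℤ × (Fin (d + 2) → ℤ))) : Set (ℤ × (Fin (d + 2) → ℤ))) := by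
      simpa using hA
    obtain ⟨z, hz, hsep⟩ := hA'.exists_peel (h := h) (N := N) (by simpa using hne) (by
      intro a ha
      obtain ⟨q, -, rfl⟩ := Finset.mem_map.1 ha
      exact q.2)
    obtain ⟨z, hzA, rfl⟩ := Finset.mem_map.1 hz
    have hcast : ∀ n : ℤ, (n : ℝ) ∈ (Int.castRingHom ℝ).range := fun n => ⟨n, rfl⟩
    have hcoord : ∀ f : weightedPts d h N → ℤ, ∑ p, c p * (f p : ℝ) ∈ (Int.castRingHom ℝ).range →
        (∀ a ∈ A, a ≠ z → f z = f a + 1) → c z ∈ (Int.castRingHom ℝ).range := by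
      intro f hf hfz
      have e : c z = ∑ p, c p * (f p : ℝ) - (∑ p, c p) * ((f z - 1 : ℤ) : ℝ) := by
        rw [Finset.sum_mul, ← Finset.sum_sub_distrib, Finset.sum_eq_single z]
        · push_cast; ring
        · intro a _ haz
          by_cases haA : a ∈ A
          · rw [hfz a haA haz]; push_cast; ring
          · simp [hc a haA]
        · simp
      rw [e]
      exact sub_mem hf (mul_mem h0 (hcast _))
    have hcz : c z ∈ (Int.castRingHom ℝ).range := by
      rcases hsep with hs | ⟨j, hs⟩
      · refine hcoord (fun p => p.1.1) h1 fun a ha haz => hs a.1 (Finset.mem_map_of_mem _ ha) ?_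
        exact fun e => haz (Subtype.ext e)
      · refine hcoord (fun p => p.1.2 j) (h2 j) fun a ha haz =>
          hs a.1 (Finset.mem_map_of_mem _ ha) ?_
        exact fun e => haz (Subtype.ext e)
    have key := ih (A.erase z) (Finset.erase_ssubset hzA)
      (hA.mono (Set.image_mono (by simp))) (c - Pi.single z (c z)) ?_ ?_ ?_ ?_ p
    · by_cases hpz : p = z
      · rwa [hpz]
      · simpa [hpz] using key
    · intro q hq
      by_cases hqz : q = z
      · simp [hqz]
      · simpa [hqz] using hc q (fun hqA => hq (by simp [hqA, hqz]))
    · simpa [Finset.sum_sub_distrib] using sub_mem h0 hcz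
    · simpa [sub_mul, Finset.sum_sub_distrib, Pi.single_apply] using
        sub_mem h1 (mul_mem hcz (hcast z.1.1))
    · intro j
      simpa [sub_mul, Finset.sum_sub_distrib, Pi.single_apply] using
        sub_mem (h2 j) (mul_mem hcz (hcast (z.1.2 j)))

theorem sum_smul_realPt (c : weightedPts d h N → ℝ) :
    ∑ p, c p • realPt p.1 = (∑ p, c p * (p.1.1 : ℝ), fun j => ∑ p, c p * (p.1.2 j : ℝ)) := by
  ext
  · simp [Prod.fst_sum, realPt]
  · simp [Prod.snd_sum, realPt]

theorem IsAlcoveChain.affIndepOn {A : Finset (weightedPts d h N)}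
    (hA : IsAlcoveChain (Subtype.val '' (A : Set (weightedPts d h N)))) :
    AffIndepOn (fun p : weightedPts d h N => realPt (p : ℤ × (Fin (d + 2) → ℤ))) A := by
  intro c hc h0 h1
  rw [sum_smul_realPt, Prod.mk_eq_zero] at h1
  by_contra hne
  obtain ⟨p, hp⟩ := Function.ne_iff.1 hne
  have hp' : c p ≠ 0 := hp
  have key := coeff_mem A hA ((2 * c p)⁻¹ • c) (fun q hq => by simp [hc q hq]) ?_ ?_ ?_ p
  · obtain ⟨n, hn⟩ := key
    have : (2 * n : ℝ) = 1 := by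
      have h2 : (n : ℝ) = (2 * c p)⁻¹ * c p := by simpa using hn
      rw [h2]; field_simp
    have : 2 * n = 1 := by exact_mod_cast this
    omega
  · simp [← Finset.mul_sum, h0, zero_mem]
  · simp [mul_assoc, ← Finset.mul_sum, h1.1, zero_mem]
  · intro j
    have := congrFun h1.2 j
    simp only [Pi.zero_apply] at this
    simp [mul_assoc, ← Finset.mul_sum, this, zero_mem]

end Unimodular

section VertexLattice

variable {ι : Type*} [Fintype ι] {d : ℕ} {φ : ι → Fin d → ℝ} {A : Finset ι}

theorem AffIndepOn.vertexDiffs_eq (h : AffIndepOn φ A) :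
    vertexDiffs (convexHull ℝ (φ '' (A : Set ι))) = {x | ∃ p ∈ A, ∃ q ∈ A, x = φ p - φ q} := by
  ext x
  simp [vertexDiffs, h.extremePoints]

theorem AffIndepOn.exists_of_mem_span (h : AffIndepOn φ A) {x : Fin d → ℝ}
    (hx : x ∈ Submodule.span ℝ (vertexDiffs (convexHull ℝ (φ '' (A : Set ι))))) :
    ∃ c : ι → ℝ, (∀ i, i ∉ A → c i = 0) ∧ ∑ i, c i = 0 ∧ ∑ i, c i • φ i = x := by
  classical
  rw [h.vertexDiffs_eq] at hx
  induction hx using Submodule.span_induction with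
  | mem x hx =>
    obtain ⟨p, hp, q, hq, rfl⟩ := hx
    refine ⟨Pi.single p 1 - Pi.single q 1, fun i hi => ?_, by simp, ?_⟩
    · have h1 : i ≠ p := by rintro rfl; exact hi hp
      have h2 : i ≠ q := by rintro rfl; exact hi hq
      simp [h1, h2]
    · simp [sub_smul, Finset.sum_sub_distrib, Pi.single_apply]
  | zero => exact ⟨0, by simp⟩
  | add x y _ _ hx hy =>
    obtain ⟨c, h1, h2, rfl⟩ := hx
    obtain ⟨c', h1', h2', rfl⟩ := hy
    refine ⟨c + c', fun i hi => by simp [h1 i hi, h1' i hi], ?_, ?_⟩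
    · simp [Finset.sum_add_distrib, h2, h2']
    · simp [add_smul, Finset.sum_add_distrib]
  | smul a x _ hx =>
    obtain ⟨c, h1, h2, rfl⟩ := hx
    refine ⟨a • c, fun i hi => by simp [h1 i hi], ?_, ?_⟩
    · simp [← Finset.mul_sum, h2]
    · simp [mul_smul, Finset.smul_sum]

theorem AffIndepOn.mem_latL_iff (h : AffIndepOn φ A) {x : Fin d → ℝ} :
    x ∈ latL (convexHull ℝ (φ '' (A : Set ι))) ↔
      ∃ c : ι → ℝ, (∀ i, c i ∈ (Int.castRingHom ℝ).range) ∧ (∀ i, i ∉ A → c i = 0) ∧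
        ∑ i, c i = 0 ∧ ∑ i, c i • φ i = x := by
  classical
  rw [latL, h.vertexDiffs_eq]
  constructor
  · intro hx
    induction hx using AddSubgroup.closure_induction with
    | mem x hx =>
      obtain ⟨p, hp, q, hq, rfl⟩ := hx
      refine ⟨Pi.single p 1 - Pi.single q 1, fun i => sub_mem ?_ ?_, fun i hi => ?_, by simp, ?_⟩
      · by_cases hi : i = p <;> simp [hi, one_mem, zero_mem]
      · by_cases hi : i = q <;> simp [hi, one_mem, zero_mem]
      · have h1 : i ≠ p := by rintro rfl; exact hi hp
        have h2 : i ≠ q := by rintro rfl; exact hi hq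
        simp [h1, h2]
      · simp [sub_smul, Finset.sum_sub_distrib, Pi.single_apply]
    | zero => exact ⟨0, by simp [zero_mem]⟩
    | add x y _ _ hx hy =>
      obtain ⟨c, h0, h1, h2, rfl⟩ := hx
      obtain ⟨c', h0', h1', h2', rfl⟩ := hy
      refine ⟨c + c', fun i => add_mem (h0 i) (h0' i),
        fun i hi => by simp [h1 i hi, h1' i hi], ?_, ?_⟩
      · simp [Finset.sum_add_distrib, h2, h2']
      · simp [add_smul, Finset.sum_add_distrib]
    | neg x _ hx =>
      obtain ⟨c, h0, h1, h2, rfl⟩ := hx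
      exact ⟨-c, fun i => neg_mem (h0 i), fun i hi => by simp [h1 i hi], by simp [h2], by simp⟩
  · rintro ⟨c, h0, h1, h2, rfl⟩
    rcases A.eq_empty_or_nonempty with rfl | ⟨a, ha⟩
    · rw [Finset.sum_eq_zero fun i _ => by simp [h1 i (by simp)]]
      exact zero_mem _
    · have e : ∑ i, c i • φ i = ∑ i, c i • (φ i - φ a) := by
        simp [smul_sub, Finset.sum_sub_distrib, ← Finset.sum_smul, h2]
      rw [e]
      refine sum_mem fun i _ => ?_
      by_cases hi : i ∈ A
      · obtain ⟨n, hn⟩ := h0 i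
        rw [← hn, eq_intCast, Int.cast_smul_eq_zsmul]
        refine zsmul_mem (AddSubgroup.subset_closure ?_) n
        exact ⟨i, hi, a, ha, rfl⟩
      · simp [h1 i hi, zero_mem]

end VertexLattice

section Index

theorem AddSubgroup.relIndex_dvd_of_cyclic {M : Type*} [AddCommGroup M] {G G' : AddSubgroup M}
    {x : M} (hx : x ∈ G') (hgen : ∀ g ∈ G', ∃ k : ℤ, g - k • x ∈ G) {q : ℕ} (hq : q • x ∈ G) :
    G.relIndex G' ∣ q := by
  set y : G' ⧸ G.addSubgroupOf G' := QuotientAddGroup.mk (⟨x, hx⟩ : G') with hy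
  have htop : AddSubgroup.zmultiples y = ⊤ := by
    refine eq_top_iff.2 fun z _ => ?_
    induction z using QuotientAddGroup.induction_on with
    | H g =>
      obtain ⟨k, hk⟩ := hgen g g.2
      refine AddSubgroup.mem_zmultiples_iff.2 ⟨k, ?_⟩
      rw [hy, ← QuotientAddGroup.mk_zsmul, QuotientAddGroup.eq, AddSubgroup.mem_addSubgroupOf]
      simpa [sub_eq_neg_add] using hk
  have hcard : G.relIndex G' = addOrderOf y := by
    rw [← Nat.card_zmultiples, htop, AddSubgroup.card_top]
    rfl
  rw [hcard]
  refine addOrderOf_dvd_of_nsmul_eq_zero ?_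
  rw [hy, ← QuotientAddGroup.mk_nsmul, QuotientAddGroup.eq_zero_iff, AddSubgroup.mem_addSubgroupOf]
  simpa using hq

theorem AddSubgroup.relIndex_nsmul_mem {M : Type*} [AddCommGroup M] {G G' : AddSubgroup M}
    {x : M} (hx : x ∈ G') : G.relIndex G' • x ∈ G := by
  have := (G.addSubgroupOf G').nsmul_index_mem ⟨x, hx⟩
  simpa [AddSubgroup.mem_addSubgroupOf, AddSubgroup.relIndex] using this

variable {d : ℕ}

/-- The lattice generated over the degree zero part by the vertices `v` and the point with
barycentric coordinates `b`, with the vertices in `I` left out. -/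
def cellLattice (v : Fin (d + 1) → Fin d → ℝ) (b : Fin (d + 1) → ℝ) (I : Set (Fin (d + 1))) :
    AddSubgroup (Fin d → ℝ) where
  carrier := {x | ∃ (t : ℝ) (c : Fin (d + 1) → ℝ), t ∈ (Int.castRingHom ℝ).range ∧
    (∀ j, c j ∈ (Int.castRingHom ℝ).range) ∧ (∀ i ∈ I, c i = 0) ∧ ∑ j, (t * b j + c j) = 0 ∧
    ∑ j, (t * b j + c j) • v j = x}
  zero_mem' := ⟨0, 0, by simp [zero_mem]⟩
  add_mem' := by
    rintro _ _ ⟨t, c, ht, hc, hI, h0, rfl⟩ ⟨t', c', ht', hc', hI', h0', rfl⟩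
    refine ⟨t + t', c + c', add_mem ht ht', fun j => add_mem (hc j) (hc' j),
      fun i hi => by simp [hI i hi, hI' i hi], ?_, ?_⟩
    · rw [← add_zero (0 : ℝ)]
      nth_rewrite 1 [← h0]
      rw [← h0', ← Finset.sum_add_distrib]
      refine Finset.sum_congr rfl fun j _ => ?_
      simp only [Pi.add_apply]
      ring
    · rw [← Finset.sum_add_distrib]
      refine Finset.sum_congr rfl fun j _ => ?_
      rw [← add_smul]
      congr 1
      simp only [Pi.add_apply]
      ring
  neg_mem' := by
    rintro _ ⟨t, c, ht, hc, hI, h0, rfl⟩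
    refine ⟨-t, -c, neg_mem ht, fun j => neg_mem (hc j), fun i hi => by simp [hI i hi], ?_, ?_⟩
    · rw [← neg_zero, ← h0, ← Finset.sum_neg_distrib]
      refine Finset.sum_congr rfl fun j _ => ?_
      simp only [Pi.neg_apply]
      ring
    · rw [← Finset.sum_neg_distrib]
      refine Finset.sum_congr rfl fun j _ => ?_
      rw [← neg_smul]
      congr 1
      simp only [Pi.neg_apply]
      ring

theorem cellLattice_mono {v : Fin (d + 1) → Fin d → ℝ} {b : Fin (d + 1) → ℝ}
    {I J : Set (Fin (d + 1))} (h : I ⊆ J) : cellLattice v b J ≤ cellLattice v b I :=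
  fun _ ⟨t, c, ht, hc, hI, hx⟩ => ⟨t, c, ht, hc, fun i hi => hI i (h hi), hx⟩

theorem AffIndepOn.coords_eq {v : Fin (d + 1) → Fin d → ℝ} (hv : AffIndepOn v Finset.univ)
    {c c' : Fin (d + 1) → ℝ} (h0 : ∑ j, c j = ∑ j, c' j)
    (h1 : ∑ j, c j • v j = ∑ j, c' j • v j) (j : Fin (d + 1)) : c j = c' j :=
  sub_eq_zero.1 (congrFun (hv (c - c') (by simp) (by simp [h0])
    (by simp [sub_smul, h1])) j)

theorem cellLattice_le_intLattice {v : Fin (d + 1) → Fin d → ℝ} {b : Fin (d + 1) → ℝ}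
    (hvZ : ∀ j, v j ∈ intLattice d) (hu : ∑ j, b j • v j ∈ intLattice d)
    (I : Set (Fin (d + 1))) : cellLattice v b I ≤ intLattice d := by
  rintro _ ⟨_, c, ⟨t, rfl⟩, hc, -, -, rfl⟩
  have e : ∑ j, ((Int.castRingHom ℝ) t * b j + c j) • v j =
      t • ∑ j, b j • v j + ∑ j, c j • v j := by
    rw [← Int.cast_smul_eq_zsmul ℝ]
    simp [add_smul, mul_smul, Finset.sum_add_distrib, ← Finset.smul_sum]
  rw [e]
  refine add_mem (zsmul_mem hu t) (sum_mem fun j _ => ?_)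
  obtain ⟨n, hn⟩ := hc j
  rw [← hn, eq_intCast, Int.cast_smul_eq_zsmul]
  exact zsmul_mem (hvZ j) n

theorem cellLattice_relIndex_lt (hd : 0 < d) {v : Fin (d + 1) → Fin d → ℝ}
    {b : Fin (d + 1) → ℝ} {h : ℕ} (hv : AffIndepOn v Finset.univ)
    (hvZ : ∀ j, v j ∈ intLattice d) (hu : ∑ j, b j • v j ∈ intLattice d) (hb : ∑ j, b j = h)
    (hfin : (latL (convexHull ℝ (v '' ((Finset.univ : Finset (Fin (d + 1))) : Set _)))).relIndex
      (intLattice d) ≠ 0) {i : Fin (d + 1)} (hi : 0 < b i) (hi1 : b i < 1) :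
    (cellLattice v b {i}).relIndex (intLattice d) ≠ 0 ∧
      (cellLattice v b {i}).relIndex (intLattice d) <
      (latL (convexHull ℝ (v '' ((Finset.univ : Finset (Fin (d + 1))) : Set _)))).relIndex
        (intLattice d) := by
  classical
  set L := latL (convexHull ℝ (v '' ((Finset.univ : Finset (Fin (d + 1))) : Set _))) with hL
  set G := cellLattice v b ∅ with hG
  have hGZ : G ≤ intLattice d := cellLattice_le_intLattice hvZ hu ∅
  have hLG : L ≤ G := by
    intro x hx
    obtain ⟨c, hc, -, h0, rfl⟩ := hv.mem_latL_iff.1 hx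
    exact ⟨0, c, zero_mem _, hc, by simp, by simpa using h0, by simp⟩
  have hmul := AddSubgroup.relIndex_mul_relIndex L G (intLattice d) hLG hGZ
  have hmul' := AddSubgroup.relIndex_mul_relIndex (cellLattice v b {i}) G (intLattice d)
    (cellLattice_mono (Set.empty_subset _)) hGZ
  set r := L.relIndex G with hr
  have hr0 : r ≠ 0 := fun e => hfin (by rw [← hmul, e, zero_mul])
  have hGZ0 : G.relIndex (intLattice d) ≠ 0 := fun e => hfin (by rw [← hmul, e, mul_zero])
  have hcast : ∀ n : ℤ, (n : ℝ) ∈ (Int.castRingHom ℝ).range := fun n => ⟨n, rfl⟩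
  have hncast : ∀ n : ℕ, (n : ℝ) ∈ (Int.castRingHom ℝ).range := fun n => ⟨n, by simp⟩
  have hsingle : ∀ (a : ℝ) (k j : Fin (d + 1)), a ∈ (Int.castRingHom ℝ).range →
      (Pi.single k a : Fin (d + 1) → ℝ) j ∈ (Int.castRingHom ℝ).range := by
    intro a k j ha
    by_cases hj : j = k
    · subst hj; simpa using ha
    · simp [hj, zero_mem]
  -- `r` clears the denominators of `b`
  have hrb : ∀ j, r * b j ∈ (Int.castRingHom ℝ).range := by
    have hx : ∑ j, (1 * b j + (Pi.single 0 (-(h : ℝ)) : Fin (d + 1) → ℝ) j) • v j ∈ G :=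
      ⟨1, Pi.single 0 (-(h : ℝ)), one_mem _, fun j => hsingle _ _ _ (neg_mem (hncast h)), by simp,
        by simp [Finset.sum_add_distrib, hb], rfl⟩
    obtain ⟨c, hc, -, h0, hcv⟩ := hv.mem_latL_iff.1 (AddSubgroup.relIndex_nsmul_mem (G := L) hx)
    rw [← hr] at hcv
    intro j
    have e := hv.coords_eq (c := c)
      (c' := fun j => r * (1 * b j + (Pi.single 0 (-(h : ℝ)) : Fin (d + 1) → ℝ) j)) ?_ ?_ j
    · have : r * b j = c j - r * (Pi.single 0 (-(h : ℝ)) : Fin (d + 1) → ℝ) j := by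
        rw [e]; ring
      rw [this]
      exact sub_mem (hc j) (mul_mem (hncast r) (hsingle _ _ _ (neg_mem (hncast h))))
    · rw [h0, ← Finset.mul_sum]
      simp [Finset.sum_add_distrib, hb]
    · rw [hcv, Finset.smul_sum]
      simp [mul_smul, ← Nat.cast_smul_eq_nsmul ℝ]
  obtain ⟨k, hk⟩ := hrb i
  have hrpos : (0 : ℝ) < r := by positivity
  have hk0 : 0 < k := by
    have : (0 : ℝ) < k := by rw [← eq_intCast (Int.castRingHom ℝ) k, hk]; positivity
    exact_mod_cast this
  lift k to ℕ using hk0.le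
  have hk' : (k : ℝ) = r * b i := by simpa using hk
  have hkr : k < r := by
    have : (k : ℝ) < r := by rw [hk']; nlinarith
    exact_mod_cast this
  have : Nontrivial (Fin (d + 1)) := Fin.nontrivial_iff_two_le.2 (by omega)
  obtain ⟨j₀, hj₀⟩ := exists_ne i
  have hvsub : ∀ a : ℝ, a • (v i - v j₀) = ∑ j, ((Pi.single i a : Fin (d + 1) → ℝ) j -
      (Pi.single j₀ a : Fin (d + 1) → ℝ) j) • v j := by
    intro a
    simp [sub_smul, smul_sub, Finset.sum_sub_distrib, Pi.single_apply]
  have hdvd : (cellLattice v b {i}).relIndex G ∣ k := by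
    refine AddSubgroup.relIndex_dvd_of_cyclic (x := v i - v j₀) ?_ ?_ ?_
    · refine ⟨0, fun j => (Pi.single i 1 : Fin (d + 1) → ℝ) j -
        (Pi.single j₀ 1 : Fin (d + 1) → ℝ) j, zero_mem _, fun j => sub_mem
        (hsingle _ _ _ (one_mem _)) (hsingle _ _ _ (one_mem _)), by simp, by simp, ?_⟩
      simpa using (hvsub 1).symm
    · rintro _ ⟨t, c, ht, hc, -, h0, rfl⟩
      obtain ⟨n, hn⟩ := hc i
      have hn' : (n : ℝ) = c i := by simpa using hn
      refine ⟨n, t, fun j => c j - ((Pi.single i (c i) : Fin (d + 1) → ℝ) j -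
        (Pi.single j₀ (c i) : Fin (d + 1) → ℝ) j), ht, fun j => sub_mem (hc j)
        (sub_mem (hsingle _ _ _ (hc i)) (hsingle _ _ _ (hc i))), ?_, ?_, ?_⟩
      · simp [hj₀.symm]
      · simp only [← add_sub_assoc, Finset.sum_sub_distrib, h0]
        simp
      · rw [← Int.cast_smul_eq_zsmul ℝ, hn', hvsub, ← Finset.sum_sub_distrib]
        refine Finset.sum_congr rfl fun j _ => ?_
        rw [← sub_smul]
        congr 1
        ring
    · refine ⟨r, fun j => ((Pi.single i (k : ℝ) : Fin (d + 1) → ℝ) j -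
        (Pi.single j₀ (k : ℝ) : Fin (d + 1) → ℝ) j) - r * b j, hncast r, fun j => sub_mem
        (sub_mem (hsingle _ _ _ (hncast k)) (hsingle _ _ _ (hncast k))) (hrb j), ?_, ?_, ?_⟩
      · simp [hj₀.symm, hk']
      · simp
      · rw [← Nat.cast_smul_eq_nsmul ℝ, hvsub]
        refine Finset.sum_congr rfl fun j _ => ?_
        congr 1
        ring
  have hk0' : 0 < k := by exact_mod_cast hk0
  have hle := Nat.le_of_dvd hk0' hdvd
  have hpos := Nat.pos_of_dvd_of_pos hdvd hk0'
  rw [← hmul, ← hmul']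
  exact ⟨by positivity, Nat.mul_lt_mul_of_pos_right (by omega) (Nat.pos_of_ne_zero hGZ0)⟩

end Index

section Cells

variable {d h N : ℕ}

/-- The successive differences of the second component of a lattice point. -/
def gap (p : ℤ × (Fin (d + 2) → ℤ)) (j : Fin (d + 1)) : ℤ := p.2 j.succ - p.2 j.castSucc

theorem sum_gap (p : ℤ × (Fin (d + 2) → ℤ)) : ∑ j, gap p j = p.2 (Fin.last _) - p.2 0 := by
  have h1 := Fin.sum_univ_succ p.2
  have h2 := Fin.sum_univ_castSucc p.2
  simp only [gap, Finset.sum_sub_distrib]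
  linarith

theorem gap_nonneg (p : weightedPts d h N) (j : Fin (d + 1)) : 0 ≤ gap p.1 j :=
  sub_nonneg.2 (p.2.2.2.1 (Fin.castSucc_lt_succ).le)

/-- The point of `ℝ^d` represented by a lattice point `(t, s)`: the combination of the point with
barycentric coordinates `b`, taken `t` times, and the vertices `v j`, taken `gap j` times. -/
def cellPt (v : Fin (d + 1) → Fin d → ℝ) (b : Fin (d + 1) → ℝ) (p : weightedPts d h N) :
    Fin d → ℝ :=
  ∑ j, ((p.1.1 : ℝ) * b j + gap p.1 j) • v j

theorem isLatticePt_cellPt {v : Fin (d + 1) → Fin d → ℝ} {b : Fin (d + 1) → ℝ}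
    (hvZ : ∀ j, v j ∈ intLattice d) (hu : ∑ j, b j • v j ∈ intLattice d) (p : weightedPts d h N) :
    IsLatticePt (cellPt v b p) := by
  have e : cellPt v b p = p.1.1 • ∑ j, b j • v j + ∑ j, gap p.1 j • v j := by
    simp only [← Int.cast_smul_eq_zsmul ℝ]
    simp [cellPt, add_smul, mul_smul, Finset.sum_add_distrib, ← Finset.smul_sum]
  rw [e]
  exact add_mem (zsmul_mem hu _) (sum_mem fun j _ => zsmul_mem (hvZ j) _)

variable [Fintype (weightedPts d h N)] {v : Fin (d + 1) → Fin d → ℝ} {b : Fin (d + 1) → ℝ}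

theorem sum_smul_cellPt (c : weightedPts d h N → ℝ) :
    ∑ p, c p • cellPt v b p =
      ∑ j, ((∑ p, c p * (p.1.1 : ℝ)) * b j + ∑ p, c p * (gap p.1 j : ℝ)) • v j := by
  simp only [cellPt, Finset.smul_sum, smul_smul]
  rw [Finset.sum_comm]
  refine Finset.sum_congr rfl fun j _ => ?_
  rw [← Finset.sum_smul, Finset.sum_mul, ← Finset.sum_add_distrib]
  congr 1
  refine Finset.sum_congr rfl fun p _ => ?_
  ring

theorem sum_moment (hb : ∑ j, b j = h) (c : weightedPts d h N → ℝ) :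
    ∑ j, ((∑ p, c p * (p.1.1 : ℝ)) * b j + ∑ p, c p * (gap p.1 j : ℝ)) = (∑ p, c p) * N := by
  rw [Finset.sum_add_distrib, ← Finset.mul_sum, hb, Finset.sum_comm, Finset.sum_mul,
    Finset.sum_mul, ← Finset.sum_add_distrib]
  refine Finset.sum_congr rfl fun p _ => ?_
  have e : (p.1.2 (Fin.last _) : ℝ) + h * p.1.1 = N := by exact_mod_cast p.2.2.2.2
  rw [← Finset.mul_sum, ← Int.cast_sum, sum_gap, p.2.2.1, ← e]
  push_cast
  ring

theorem moment_coords (hv : AffIndepOn v Finset.univ) (hb : ∑ j, b j = h)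
    {c c' : weightedPts d h N → ℝ} (h0 : ∑ p, c p = ∑ p, c' p)
    (h1 : ∑ p, c p • cellPt v b p = ∑ p, c' p • cellPt v b p) (j : Fin (d + 1)) :
    (∑ p, c p * (p.1.1 : ℝ)) * b j + ∑ p, c p * (gap p.1 j : ℝ) =
      (∑ p, c' p * (p.1.1 : ℝ)) * b j + ∑ p, c' p * (gap p.1 j : ℝ) := by
  rw [sum_smul_cellPt, sum_smul_cellPt] at h1
  exact hv.coords_eq (by rw [sum_moment hb, sum_moment hb, h0]) h1 j

theorem sum_mul_mem_of_gap (H : AddSubgroup ℝ) (c : weightedPts d h N → ℝ)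
    (hc : ∀ j, ∑ p, c p * (gap p.1 j : ℝ) ∈ H) (j : Fin (d + 2)) :
    ∑ p, c p * (p.1.2 j : ℝ) ∈ H := by
  induction j using Fin.induction with
  | zero => simp [fun p : weightedPts d h N => p.2.2.1, zero_mem]
  | succ j ih =>
    have := add_mem (hc j) ih
    rw [← Finset.sum_add_distrib] at this
    convert this using 2 with p
    simp only [gap]
    push_cast
    ring

theorem sum_smul_realPt_eq {c c' : weightedPts d h N → ℝ}
    (h1 : ∑ p, c p * (p.1.1 : ℝ) = ∑ p, c' p * (p.1.1 : ℝ))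
    (h2 : ∀ j, ∑ p, c p * (gap p.1 j : ℝ) = ∑ p, c' p * (gap p.1 j : ℝ)) :
    ∑ p, c p • realPt p.1 = ∑ p, c' p • realPt p.1 := by
  rw [sum_smul_realPt, sum_smul_realPt, h1]
  congr 1
  funext j
  have := sum_mul_mem_of_gap ⊥ (c - c')
    (fun j => by simp [sub_mul, Finset.sum_sub_distrib, h2 j]) j
  simpa [sub_mul, Finset.sum_sub_distrib, sub_eq_zero] using this

/-- The complex of cells: those in the regular triangulation of the weighted simplex that miss some
vertex `v i` in the support of `b`. -/
def cellComplex (b : Fin (d + 1) → ℝ) (ω : weightedPts d h N → ℝ) :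
    Set (Finset (weightedPts d h N)) :=
  {A | IsOptimal (fun p : weightedPts d h N => realPt (p : ℤ × (Fin (d + 2) → ℤ))) ω A ∧
    ∃ i, 0 < b i ∧ ∀ a ∈ A, gap a.1 i = 0}

theorem sum_mul_gap_eq_zero {A : Finset (weightedPts d h N)} {i : Fin (d + 1)}
    (hA : ∀ a ∈ A, gap a.1 i = 0) {c : weightedPts d h N → ℝ} (hc : ∀ p, p ∉ A → c p = 0) :
    ∑ p, c p * (gap p.1 i : ℝ) = 0 := by
  refine Finset.sum_eq_zero fun p _ => ?_
  by_cases hp : p ∈ A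
  · simp [hA p hp]
  · simp [hc p hp]

theorem affIndepOn_cellPt (hv : AffIndepOn v Finset.univ) (hb : ∑ j, b j = h)
    {A : Finset (weightedPts d h N)} (hA : AffIndepOn
      (fun p : weightedPts d h N => realPt (p : ℤ × (Fin (d + 2) → ℤ))) A)
    {i : Fin (d + 1)} (hi : 0 < b i) (hAi : ∀ a ∈ A, gap a.1 i = 0) :
    AffIndepOn (cellPt v b) A := by
  intro c hc h0 h1
  have key := moment_coords hv hb (c := c) (c' := 0) (by simpa using h0) (by simpa using h1)
  have hT : ∑ p, c p * (p.1.1 : ℝ) = 0 := by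
    have := key i
    rw [sum_mul_gap_eq_zero hAi hc] at this
    simpa [hi.ne'] using this
  refine hA c hc h0 ?_
  rw [sum_smul_realPt_eq (c' := 0) (by simpa using hT) fun j => by simpa [hT] using key j]
  simp

theorem cellComplex_unique (hv : AffIndepOn v Finset.univ) (hb : ∑ j, b j = h)
    {ω : weightedPts d h N → ℝ}
    (hω : ∀ A : Finset (weightedPts d h N),
      IsOptimal (fun p : weightedPts d h N => realPt (p : ℤ × (Fin (d + 2) → ℤ))) ω A →
      IsAlcoveChain (Subtype.val '' (A : Set (weightedPts d h N))))
    {A A' : Finset (weightedPts d h N)} (hA : A ∈ cellComplex b ω) (hA' : A' ∈ cellComplex b ω)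
    {w w' : weightedPts d h N → ℝ} {x : Fin d → ℝ} (hw : IsConvComb (cellPt v b) A w x)
    (hw' : IsConvComb (cellPt v b) A' w' x) : w = w' := by
  obtain ⟨hopt, i, hi, hAi⟩ := hA
  obtain ⟨hopt', i', hi', hAi'⟩ := hA'
  have key := moment_coords hv hb (hw.sum_eq.trans hw'.sum_eq.symm) (hw.comb.trans hw'.comb.symm)
  have hnonneg : ∀ w : weightedPts d h N → ℝ, (∀ p, 0 ≤ w p) → ∀ j,
      0 ≤ ∑ p, w p * (gap p.1 j : ℝ) := fun w hw j =>
    Finset.sum_nonneg fun p _ => mul_nonneg (hw p) (by exact_mod_cast gap_nonneg p j)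
  have hT : ∑ p, w p * (p.1.1 : ℝ) = ∑ p, w' p * (p.1.1 : ℝ) := by
    refine le_antisymm ?_ ?_
    · have := key i'
      rw [sum_mul_gap_eq_zero hAi' hw'.supp] at this
      have := hnonneg w hw.nonneg i'
      exact le_of_mul_le_mul_right (by linarith) hi'
    · have := key i
      rw [sum_mul_gap_eq_zero hAi hw.supp] at this
      have := hnonneg w' hw'.nonneg i
      exact le_of_mul_le_mul_right (by linarith) hi
  refine hopt.unique hopt' (fun B hB => (hω B hB).affIndepOn)
    (x := ∑ p, w p • realPt p.1) ⟨hw.nonneg, hw.supp, hw.sum_eq, rfl⟩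
    ⟨hw'.nonneg, hw'.supp, hw'.sum_eq, ?_⟩
  exact (sum_smul_realPt_eq hT fun j => by simpa [hT] using key j).symm

theorem exists_isConvComb_cellPt (hb0 : ∀ j, 0 ≤ b j) (hb : ∑ j, b j = h) (hh : 0 < h)
    (hN : 0 < N) (hdvd : h ∣ N) (ω : weightedPts d h N → ℝ) {X : Fin (d + 1) → ℝ}
    (hX0 : ∀ j, 0 ≤ X j) (hX : ∑ j, X j = N) :
    ∃ A ∈ cellComplex b ω, ∃ w, IsConvComb (cellPt v b) A w (∑ j, X j • v j) := by
  classical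
  have hhR : (0 : ℝ) < h := by exact_mod_cast hh
  have hNR : (0 : ℝ) < N := by exact_mod_cast hN
  obtain ⟨i, hi, hmin⟩ : ∃ i, 0 < b i ∧ ∀ j, 0 < b j → X i / b i ≤ X j / b j := by
    have hne : (Finset.univ.filter fun j => 0 < b j).Nonempty := by
      by_contra hcon
      rw [Finset.not_nonempty_iff_eq_empty, Finset.filter_eq_empty_iff] at hcon
      have : ∑ j, b j ≤ 0 := Finset.sum_nonpos fun j hj => not_lt.1 (hcon hj)
      linarith
    obtain ⟨i, hi, hmin⟩ := Finset.exists_min_image _ (fun j => X j / b j) hne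
    simp only [Finset.mem_filter, Finset.mem_univ, true_and] at hi hmin
    exact ⟨i, hi, hmin⟩
  set t := X i / b i with ht
  have ht0 : 0 ≤ t := div_nonneg (hX0 i) hi.le
  have hy : ∀ j, 0 ≤ X j - t * b j := by
    intro j
    rcases (hb0 j).eq_or_lt with h0 | h0
    · simpa [← h0] using hX0 j
    · have := (le_div_iff₀ h0).1 (hmin j h0)
      linarith
  have hyi : X i - t * b i = 0 := by rw [ht]; field_simp; ring
  obtain ⟨n, rfl⟩ := hdvd
  have hn : 0 < n := Nat.pos_of_mul_pos_left hN
  have hnR : (0 : ℝ) < n := by exact_mod_cast hn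
  -- the vertices of the weighted simplex
  let apex : weightedPts d h (h * n) := ⟨(n, 0), by simp, by simp, fun _ _ _ => by simp, by simp⟩
  let corner : Fin (d + 1) → weightedPts d h (h * n) := fun j =>
    ⟨(0, fun k => if j.castSucc < k then ((h * n : ℕ) : ℤ) else 0), by simp, by simp, by
      intro k l hkl
      dsimp only
      split_ifs with h1 h2
      · exact le_rfl
      · exact absurd (h1.trans_le hkl) h2
      · positivity
      · exact le_rfl, by simp [Fin.castSucc_lt_last]⟩
  have gap_apex : ∀ j, gap apex.1 j = 0 := fun j => by simp [gap, apex]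
  have gap_corner : ∀ k j, gap (corner k).1 j = if k = j then ((h * n : ℕ) : ℤ) else 0 := by
    intro k j
    simp only [gap, corner, Fin.lt_def, Fin.val_castSucc, Fin.val_succ, Fin.ext_iff]
    split_ifs <;> omega
  let w₀ : weightedPts d h (h * n) → ℝ := Pi.single apex (t / n) +
    ∑ j, Pi.single (corner j) ((X j - t * b j) / (h * n))
  have hw₀sum : ∀ f : weightedPts d h (h * n) → ℝ, ∑ p, w₀ p * f p =
      t / n * f apex + ∑ j, (X j - t * b j) / (h * n) * f (corner j) := by
    intro f
    simp only [w₀, Pi.add_apply, Finset.sum_apply, add_mul, Finset.sum_add_distrib, Finset.sum_mul]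
    rw [Finset.sum_comm]
    simp [Pi.single_apply]
  have hw₀nonneg : ∀ p, 0 ≤ w₀ p := by
    intro p
    have hs : ∀ (q : weightedPts d h (h * n)) (a : ℝ), 0 ≤ a →
        0 ≤ (Pi.single q a : weightedPts d h (h * n) → ℝ) p := by
      intro q a ha
      by_cases hq : p = q
      · subst hq; simpa using ha
      · simp [hq]
    simp only [w₀, Pi.add_apply, Finset.sum_apply]
    exact add_nonneg (hs _ _ (by positivity))
      (Finset.sum_nonneg fun j _ => hs _ _ (div_nonneg (hy j) (by positivity)))
  have hw₀one : ∑ p, w₀ p = 1 := by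
    have := hw₀sum fun _ => 1
    simp only [mul_one] at this
    rw [this, ← Finset.sum_div, Finset.sum_sub_distrib, ← Finset.mul_sum, hX, hb]
    push_cast
    field_simp
    ring
  have hw₀t : ∑ p, w₀ p * (p.1.1 : ℝ) = t := by
    rw [hw₀sum fun p => (p.1.1 : ℝ)]
    simp [apex, corner]
    field_simp
  have hw₀y : ∀ j, ∑ p, w₀ p * (gap p.1 j : ℝ) = X j - t * b j := by
    intro j
    rw [hw₀sum fun p => (gap p.1 j : ℝ)]
    simp only [gap_apex, gap_corner]
    simp
    field_simp
  obtain ⟨w, A, hA, hw0, hws, hwsum, hwmom⟩ := exists_isOptimal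
    (fun p : weightedPts d h (h * n) => realPt (p : ℤ × (Fin (d + 2) → ℤ))) ω hw₀nonneg
  rw [sum_smul_realPt, sum_smul_realPt, Prod.mk.injEq] at hwmom
  have hwt : ∑ p, w p * (p.1.1 : ℝ) = t := hwmom.1.trans hw₀t
  have hwy : ∀ j, ∑ p, w p * (gap p.1 j : ℝ) = X j - t * b j := by
    intro j
    rw [← hw₀y j]
    have h1 := congrFun hwmom.2 j.succ
    have h2 := congrFun hwmom.2 j.castSucc
    simp only [gap, Int.cast_sub, mul_sub, Finset.sum_sub_distrib, h1, h2]
  have hgap : ∀ p, w p ≠ 0 → gap p.1 i = 0 := by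
    have h0 := hwy i
    rw [hyi, Finset.sum_eq_zero_iff_of_nonneg fun p _ => mul_nonneg (hw0 p)
      (by exact_mod_cast gap_nonneg p i)] at h0
    intro p hp
    simpa [hp] using h0 p (Finset.mem_univ p)
  refine ⟨A.filter fun p => w p ≠ 0, ⟨hA.mono (Finset.filter_subset _ _), i, hi, fun p hp =>
    hgap p (Finset.mem_filter.1 hp).2⟩, w, hw0, fun p hp => ?_, hwsum.trans hw₀one, ?_⟩
  · by_contra hne
    exact hp (Finset.mem_filter.2 ⟨by_contra fun hpA => hne (hws p hpA), hne⟩)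
  · rw [sum_smul_cellPt]
    refine Finset.sum_congr rfl fun j _ => ?_
    rw [hwt, hwy j]
    congr 1
    ring

theorem polyIndex_le_cellLattice (hv : AffIndepOn v Finset.univ) (hb : ∑ j, b j = h)
    {A : Finset (weightedPts d h N)}
    (hA : IsAlcoveChain (Subtype.val '' (A : Set (weightedPts d h N))))
    {i : Fin (d + 1)} (hi : 0 < b i) (hAi : ∀ a ∈ A, gap a.1 i = 0)
    (hfin : (cellLattice v b {i}).relIndex (intLattice d) ≠ 0) :
    polyIndex (convexHull ℝ (cellPt v b '' (A : Set (weightedPts d h N)))) ≤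
      (cellLattice v b {i}).relIndex (intLattice d) := by
  have hind := affIndepOn_cellPt hv hb hA.affIndepOn hi hAi
  set P := convexHull ℝ (cellPt v b '' (A : Set (weightedPts d h N))) with hP
  have hle : cellLattice v b {i} ⊓ latN P ≤ latL P := by
    rintro x ⟨⟨t, c', ht, hc', hI, h0, rfl⟩, hx, -⟩
    obtain ⟨c, hcA, hc0, hcx⟩ := hind.exists_of_mem_span hx
    rw [sum_smul_cellPt] at hcx
    have key := hv.coords_eq (by rw [sum_moment hb, hc0, h0, zero_mul]) hcx
    have hT : ∑ p, c p * (p.1.1 : ℝ) = t := by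
      have := key i
      rw [sum_mul_gap_eq_zero hAi hcA, hI i rfl, add_zero, add_zero] at this
      exact mul_right_cancel₀ hi.ne' this
    refine hind.mem_latL_iff.2 ⟨c, hA.coeff_mem A c hcA (by rw [hc0]; exact zero_mem _)
      (hT ▸ ht) ?_, hcA, hc0, by rw [sum_smul_cellPt, hcx]⟩
    refine sum_mul_mem_of_gap (Int.castRingHom ℝ).range.toAddSubgroup c fun j => ?_
    have := key j
    rw [hT, add_right_inj] at this
    rw [this]
    exact hc' j
  have hNZ : latN P ≤ intLattice d := inf_le_right
  have h1 : (cellLattice v b {i}).relIndex (latN P) ≠ 0 := fun e =>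
    hfin (AddSubgroup.relIndex_eq_zero_of_le_right hNZ e)
  calc polyIndex P = (latL P).relIndex (latN P) := rfl
    _ ≤ (cellLattice v b {i} ⊓ latN P).relIndex (latN P) :=
      AddSubgroup.relIndex_le_of_le_left hle (by rwa [AddSubgroup.inf_relIndex_right])
    _ = (cellLattice v b {i}).relIndex (latN P) := AddSubgroup.inf_relIndex_right _ _
    _ ≤ _ := AddSubgroup.relIndex_le_of_le_right hNZ hfin

end Cells

section Main

variable {d : ℕ}

theorem IsIntegralSimplex.exists_vertices {S : Set (Fin d → ℝ)} (hS : IsIntegralSimplex S)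
    (hdim : affineSpan ℝ S = ⊤) :
    ∃ v : Fin (d + 1) → Fin d → ℝ, (∀ j, v j ∈ intLattice d) ∧ AffIndepOn v Finset.univ ∧
      S = convexHull ℝ (v '' ((Finset.univ : Finset (Fin (d + 1))) : Set (Fin (d + 1)))) := by
  classical
  obtain ⟨V, hne, hVZ, hind, rfl⟩ := hS
  rw [affineSpan_convexHull] at hdim
  have hcard : Fintype.card ↥(V : Set (Fin d → ℝ)) = d + 1 := by
    have := hind.affineSpan_eq_top_iff_card_eq_finrank_add_one
    rw [Subtype.range_coe] at this
    simpa using this.1 hdim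
  let e : Fin (d + 1) ≃ ↥(V : Set (Fin d → ℝ)) := (Fintype.equivFinOfCardEq hcard).symm
  have hv : AffineIndependent ℝ fun j => (e j : Fin d → ℝ) := hind.comp_embedding e.toEmbedding
  refine ⟨fun j => e j, fun j => hVZ _ (e j).2, fun c _ h0 h1 => ?_, ?_⟩
  · rw [affineIndependent_iff] at hv
    funext j
    exact hv Finset.univ c h0 h1 j (Finset.mem_univ j)
  · congr 1
    rw [Finset.coe_univ, Set.image_univ]
    change _ = Set.range (Subtype.val ∘ e)
    rw [e.surjective.range_comp, Subtype.range_coe]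

theorem span_vertexDiffs_eq_top {v : Fin (d + 1) → Fin d → ℝ} (hv : AffIndepOn v Finset.univ)
    (hdim : affineSpan ℝ (convexHull ℝ (v '' ((Finset.univ : Finset (Fin (d + 1))) :
      Set (Fin (d + 1))))) = ⊤) :
    Submodule.span ℝ (vertexDiffs (convexHull ℝ (v '' ((Finset.univ : Finset (Fin (d + 1))) :
      Set (Fin (d + 1)))))) = ⊤ := by
  rw [affineSpan_convexHull] at hdim
  have h := congrArg AffineSubspace.direction hdim
  rw [direction_affineSpan, AffineSubspace.direction_top, vectorSpan_def] at h
  rw [eq_top_iff, ← h]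
  refine Submodule.span_mono ?_
  rintro _ ⟨_, ⟨i, -, rfl⟩, _, ⟨j, -, rfl⟩, rfl⟩
  rw [hv.vertexDiffs_eq]
  exact ⟨i, Finset.mem_univ i, j, Finset.mem_univ j, rfl⟩

/-- A full-dimensional lattice simplex of index greater than one has a lattice point which is a
combination of the vertices with coefficients in `[0, 1)`, not all zero. -/
theorem exists_box_point {v : Fin (d + 1) → Fin d → ℝ} (hvZ : ∀ j, v j ∈ intLattice d)
    (hv : AffIndepOn v Finset.univ) (hspan : Submodule.span ℝ (vertexDiffs (convexHull ℝ
      (v '' ((Finset.univ : Finset (Fin (d + 1))) : Set (Fin (d + 1)))))) = ⊤)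
    (hind : (latL (convexHull ℝ (v '' ((Finset.univ : Finset (Fin (d + 1))) :
      Set (Fin (d + 1)))))).relIndex (intLattice d) ≠ 1) :
    ∃ (b : Fin (d + 1) → ℝ) (h : ℕ), (∀ j, 0 ≤ b j) ∧ (∀ j, b j < 1) ∧ ∑ j, b j = h ∧ 0 < h ∧
      h ≤ d ∧ ∑ j, b j • v j ∈ intLattice d := by
  obtain ⟨x, hxZ, hxL⟩ := SetLike.not_le_iff_exists.1 (mt AddSubgroup.relIndex_eq_one.2 hind)
  obtain ⟨β, -, hβ0, rfl⟩ := hv.exists_of_mem_span (x := x) (by rw [hspan]; trivial)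
  have hsum : ∑ j, Int.fract (β j) = ((-∑ j, ⌊β j⌋ : ℤ) : ℝ) := by
    simp only [← Int.self_sub_floor, Finset.sum_sub_distrib, hβ0]
    simp
  have hsum0 : (0 : ℝ) ≤ ∑ j, Int.fract (β j) := Finset.sum_nonneg fun j _ => Int.fract_nonneg _
  obtain ⟨h, hh⟩ : ∃ h : ℕ, -∑ j, ⌊β j⌋ = h :=
    Int.eq_ofNat_of_zero_le (by rw [hsum] at hsum0; exact_mod_cast hsum0)
  have hsum' : ∑ j, Int.fract (β j) = h := by rw [hsum, hh]; simp
  refine ⟨fun j => Int.fract (β j), h, fun j => Int.fract_nonneg _, fun j => Int.fract_lt_one _,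
    hsum', Nat.pos_of_ne_zero fun h0 => hxL ?_, ?_, ?_⟩
  · rw [h0, Nat.cast_zero, Finset.sum_eq_zero_iff_of_nonneg fun j _ => Int.fract_nonneg _] at hsum'
    refine hv.mem_latL_iff.2 ⟨β, fun j => ?_, by simp, hβ0, rfl⟩
    obtain ⟨n, hn⟩ := Int.fract_eq_zero_iff.1 (hsum' j (Finset.mem_univ j))
    exact ⟨n, by simpa using hn⟩
  · have : (h : ℝ) < (d + 1 : ℕ) := by
      rw [← hsum']
      refine (Finset.sum_lt_sum_of_nonempty Finset.univ_nonempty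
        fun j _ => Int.fract_lt_one (β j)).trans_eq (by simp)
    exact Nat.lt_succ_iff.1 (by exact_mod_cast this)
  · have e : ∑ j, Int.fract (β j) • v j = ∑ j, β j • v j - ∑ j, ⌊β j⌋ • v j := by
      simp only [← Int.cast_smul_eq_zsmul ℝ]
      simp only [← Int.self_sub_floor, sub_smul, Finset.sum_sub_distrib]
    rw [e]
    exact sub_mem hxZ (sum_mem fun j _ => zsmul_mem (hvZ j) _)

theorem mem_smul_simplex_iff {N : ℕ} (hN : 0 < N) (v : Fin (d + 1) → Fin d → ℝ)
    (x : Fin d → ℝ) :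
    x ∈ (N : ℝ) • convexHull ℝ (v '' ((Finset.univ : Finset (Fin (d + 1))) : Set (Fin (d + 1)))) ↔
      ∃ X : Fin (d + 1) → ℝ, (∀ j, 0 ≤ X j) ∧ ∑ j, X j = N ∧ ∑ j, X j • v j = x := by
  have hNR : (0 : ℝ) < N := by exact_mod_cast hN
  rw [Set.mem_smul_set]
  constructor
  · rintro ⟨y, hy, rfl⟩
    obtain ⟨w, hw⟩ := (mem_convexHull_image_iff _ _ _).1 hy
    refine ⟨fun j => N * w j, fun j => mul_nonneg hNR.le (hw.nonneg j), ?_, ?_⟩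
    · rw [← Finset.mul_sum, hw.sum_eq, mul_one]
    · rw [← hw.comb, Finset.smul_sum]
      simp [mul_smul]
  · rintro ⟨X, hX0, hX, rfl⟩
    refine ⟨(N : ℝ)⁻¹ • ∑ j, X j • v j, (mem_convexHull_image_iff _ _ _).2
      ⟨fun j => (N : ℝ)⁻¹ * X j, fun j => mul_nonneg (by positivity) (hX0 j), by simp, ?_, ?_⟩, ?_⟩
    · rw [← Finset.mul_sum, hX, inv_mul_cancel₀ hNR.ne']
    · simp [Finset.smul_sum, mul_smul]
    · rw [smul_smul, mul_inv_cancel₀ hNR.ne', one_smul]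

end Main

theorem statement17 (d : ℕ) (hd : 0 < d)
    (S : Set (Fin d → ℝ)) (hS : IsIntegralSimplex S)
    (hdim : affineSpan ℝ S = ⊤)
    (hind : 1 < polyIndex S) :
    ∃ T : Set (Set (Fin d → ℝ)),
      IsTriangulation T ((d.factorial : ℝ) • S) ∧
      ∀ S' ∈ T, IsIntegralSimplex S' ∧ polyIndex S' < polyIndex S := by
  obtain ⟨v, hvZ, hv, rfl⟩ := hS.exists_vertices hdim
  have hspan := span_vertexDiffs_eq_top hv hdim
  set S := convexHull ℝ (v '' ((Finset.univ : Finset (Fin (d + 1))) : Set (Fin (d + 1)))) with hSv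
  have hindex : polyIndex S = (latL S).relIndex (intLattice d) := by
    have : latN S = intLattice d := by
      rw [latN, hspan]
      simp
    rw [← this]
    rfl
  rw [hindex] at hind ⊢
  obtain ⟨b, h, hb0, hb1, hb, hh, hhd, hu⟩ := exists_box_point hvZ hv hspan hind.ne'
  set N := d.factorial
  have hN : 0 < N := d.factorial_pos
  have hdvd : h ∣ N := Nat.dvd_factorial hh hhd
  have := (weightedPts_finite (d := d) (N := N) hh).fintype
  obtain ⟨ω, hω⟩ := exists_chain_weight d h N
  have hindep : ∀ A ∈ cellComplex b ω, AffIndepOn (cellPt v b) A := by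
    rintro A ⟨hA, i, hi, hAi⟩
    exact affIndepOn_cellPt hv hb (hω A hA).affIndepOn hi hAi
  refine ⟨_, isTriangulation_of_unique (cellPt v b) (cellComplex b ω) ?_ hindep ?_ _ fun x => ?_, ?_⟩
  · rintro A ⟨hA, i, hi, hAi⟩ B hBA
    exact ⟨hA.mono hBA, i, hi, fun a ha => hAi a (hBA ha)⟩
  · exact fun A hA A' hA' w w' x hw hw' => cellComplex_unique hv hb hω hA hA' hw hw'
  · rw [mem_smul_simplex_iff hN]
    constructor
    · rintro ⟨X, hX0, hX, rfl⟩
      exact exists_isConvComb_cellPt hb0 hb hh hN hdvd ω hX0 hX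
    · rintro ⟨A, -, w, hw⟩
      refine ⟨_, fun j => ?_, (sum_moment hb w).trans (by rw [hw.sum_eq, one_mul]),
        (sum_smul_cellPt w).symm.trans hw.comb⟩
      refine add_nonneg (mul_nonneg (Finset.sum_nonneg fun p _ => mul_nonneg (hw.nonneg p) ?_)
        (hb0 j)) (Finset.sum_nonneg fun p _ => mul_nonneg (hw.nonneg p) ?_)
      · exact_mod_cast p.2.1
      · exact_mod_cast gap_nonneg p j
  · rintro _ ⟨A, hA, hne, rfl⟩
    refine ⟨(hindep A hA).isIntegralSimplex hne (isLatticePt_cellPt hvZ hu), ?_⟩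
    obtain ⟨hA, i, hi, hAi⟩ := hA
    obtain ⟨hfin, hlt⟩ := cellLattice_relIndex_lt hd hv hvZ hu hb (zero_lt_one.trans hind).ne' hi
      (hb1 i)
    exact (polyIndex_le_cellLattice hv hb (hω A hA) hi hAi hfin).trans_lt hlt
end
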